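/- Assume S ⊆ {full, almost-full, bowtie}. A graph is S-restricted if and only if the skeleton+ of each of its 3-connected components (the R-nodes of its SPR-trees, taken over all 2-connected components) is S-restricted. -/

import Mathlib

open scoped unitInterval

namespace OnePlanarity

/-- The six crossing types of a crossing in a 1-planar drawing. -/
inductive CrossingType : Type
  | full | almostFull | bowtie | arrow | chair | timesCross
  deriving DecidableEq

/-- The three crossing types in which the four endpoints of the crossing edges
lie on a common 4-cycle using the two crossing edges. -/
def goodTypes : Set CrossingType :=
  {CrossingType.full, CrossingType.almostFull, CrossingType.bowtie}

/-- The three "bad" crossing types. -/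
def badTypes : Set CrossingType :=
  {CrossingType.arrow, CrossingType.chair, CrossingType.timesCross}

variable {V : Type*} {W : Type*}

/-- `HasCrossingType G a b c d t` says that, assuming the edges `ab` and `cd` of `G`
cross, the subgraph of `G` induced by `{a,b,c,d}` witnesses the crossing type `t`. -/
def HasCrossingType (G : SimpleGraph V) (a b c d : V) : CrossingType → Prop
  | .full => G.Adj a c ∧ G.Adj a d ∧ G.Adj b c ∧ G.Adj b d
  | .almostFull =>
      (¬G.Adj a c ∧ G.Adj a d ∧ G.Adj b c ∧ G.Adj b d) ∨
      (G.Adj a c ∧ ¬G.Adj a d ∧ G.Adj b c ∧ G.Adj b d) ∨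
      (G.Adj a c ∧ G.Adj a d ∧ ¬G.Adj b c ∧ G.Adj b d) ∨
      (G.Adj a c ∧ G.Adj a d ∧ G.Adj b c ∧ ¬G.Adj b d)
  | .bowtie =>
      (G.Adj a c ∧ G.Adj b d ∧ ¬G.Adj a d ∧ ¬G.Adj b c) ∨
      (G.Adj a d ∧ G.Adj b c ∧ ¬G.Adj a c ∧ ¬G.Adj b d)
  | .arrow =>
      (G.Adj a c ∧ G.Adj a d ∧ ¬G.Adj b c ∧ ¬G.Adj b d) ∨
      (G.Adj b c ∧ G.Adj b d ∧ ¬G.Adj a c ∧ ¬G.Adj a d) ∨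
      (G.Adj a c ∧ G.Adj b c ∧ ¬G.Adj a d ∧ ¬G.Adj b d) ∨
      (G.Adj a d ∧ G.Adj b d ∧ ¬G.Adj a c ∧ ¬G.Adj b c)
  | .chair =>
      (G.Adj a c ∧ ¬G.Adj a d ∧ ¬G.Adj b c ∧ ¬G.Adj b d) ∨
      (¬G.Adj a c ∧ G.Adj a d ∧ ¬G.Adj b c ∧ ¬G.Adj b d) ∨
      (¬G.Adj a c ∧ ¬G.Adj a d ∧ G.Adj b c ∧ ¬G.Adj b d) ∨
      (¬G.Adj a c ∧ ¬G.Adj a d ∧ ¬G.Adj b c ∧ G.Adj b d)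
  | .timesCross => ¬G.Adj a c ∧ ¬G.Adj a d ∧ ¬G.Adj b c ∧ ¬G.Adj b d

/-- `IsArc A x y` says that `A` is the image of a simple curve from `x` to `y`. -/
def IsArc (A : Set (ℝ × ℝ)) (x y : ℝ × ℝ) : Prop :=
  ∃ f : I → ℝ × ℝ, Continuous f ∧ Function.Injective f ∧
    f 0 = x ∧ f 1 = y ∧ Set.range f = A

/-- A drawing of a graph `G` in the plane: vertices are mapped to distinct points,
every edge is mapped to a simple curve between the images of its endpoints avoiding the
images of all other vertices, and two edges intersect in finitely many points. -/
structure Drawing (G : SimpleGraph V) where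
  pos : V → ℝ × ℝ
  pos_inj : Function.Injective pos
  arc : Sym2 V → Set (ℝ × ℝ)
  arc_curve : ∀ e ∈ G.edgeSet, ∀ u v : V, e = s(u, v) → IsArc (arc e) (pos u) (pos v)
  arc_avoid : ∀ e ∈ G.edgeSet, ∀ w : V, pos w ∈ arc e → w ∈ e
  arc_finite_inter : ∀ e ∈ G.edgeSet, ∀ e' ∈ G.edgeSet, e ≠ e' →
    (arc e ∩ arc e').Finite

variable {G : SimpleGraph V}

/-- `D.Crosses e e' p` : the distinct edges `e` and `e'` of `G` cross at the point `p`
(an intersection point of their curves which is not the image of a vertex). -/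
def Drawing.Crosses (D : Drawing G) (e e' : Sym2 V) (p : ℝ × ℝ) : Prop :=
  e ∈ G.edgeSet ∧ e' ∈ G.edgeSet ∧ e ≠ e' ∧
    p ∈ D.arc e ∧ p ∈ D.arc e' ∧ p ∉ Set.range D.pos

/-- A drawing is 1-planar if every edge is involved in at most one crossing and
adjacent edges do not cross. -/
def Drawing.IsOnePlanar (D : Drawing G) : Prop :=
  (∀ e e₁ e₂ p q, D.Crosses e e₁ p → D.Crosses e e₂ q → e₁ = e₂ ∧ p = q) ∧
  (∀ e e' p, D.Crosses e e' p → ∀ v : V, v ∈ e → v ∉ e')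

/-- A drawing is `S`-restricted if it is 1-planar and every crossing has a type in `S`. -/
def Drawing.IsSRestricted (D : Drawing G) (S : Set CrossingType) : Prop :=
  D.IsOnePlanar ∧
  ∀ a b c d : V, ∀ p : ℝ × ℝ, D.Crosses s(a, b) s(c, d) p →
    ∃ t ∈ S, HasCrossingType G a b c d t

/-- A graph is 1-planar if it admits a 1-planar drawing. -/
def IsOnePlanarGraph (G : SimpleGraph V) : Prop :=
  ∃ D : Drawing G, D.IsOnePlanar

/-- A graph is `S`-restricted if it admits an `S`-restricted drawing. -/
def SRestricted (G : SimpleGraph V) (S : Set CrossingType) : Prop :=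
  ∃ D : Drawing G, D.IsSRestricted S

/-- A planar graph: one admitting a crossing-free drawing. -/
def IsPlanarGraph (G : SimpleGraph V) : Prop :=
  ∃ D : Drawing G, ∀ e e' p, ¬ D.Crosses e e' p

/-- A drawing is geometric if every edge is drawn as a straight-line segment. -/
def Drawing.IsGeometric (D : Drawing G) : Prop :=
  ∀ u v : V, G.Adj u v → D.arc s(u, v) = segment ℝ (D.pos u) (D.pos v)

/-- The point set of a drawing. -/
def Drawing.image (D : Drawing G) : Set (ℝ × ℝ) :=
  Set.range D.pos ∪ ⋃ e ∈ G.edgeSet, D.arc e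

/-- The set of points of the outer (unbounded) face of a point set `A`. -/
def outerRegion (A : Set (ℝ × ℝ)) : Set (ℝ × ℝ) :=
  {x | x ∉ A ∧ ¬ Bornology.IsBounded (connectedComponentIn Aᶜ x)}

/-- `Inside γ x` : the point `x` is separated from the outer face by the closed curve `γ`. -/
def Inside (γ : Set (ℝ × ℝ)) (x : ℝ × ℝ) : Prop :=
  x ∉ γ ∧ Bornology.IsBounded (connectedComponentIn γᶜ x)

/-- A vertex lies on (the boundary of) the outer face of a drawing. -/
def Drawing.OnOuterFace (D : Drawing G) (v : V) : Prop :=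
  D.pos v ∈ closure (outerRegion D.image)

/-- Two vertices are cofacial: they lie on the boundary of a common face. -/
def Drawing.Cofacial (D : Drawing G) (u v : V) : Prop :=
  ∃ p : ℝ × ℝ, p ∉ D.image ∧
    D.pos u ∈ closure (connectedComponentIn D.imageᶜ p) ∧
    D.pos v ∈ closure (connectedComponentIn D.imageᶜ p)

/-- A graph admits a geometric `S`-restricted drawing. -/
def GeoSRestricted (G : SimpleGraph V) (S : Set CrossingType) : Prop :=
  ∃ D : Drawing G, D.IsGeometric ∧ D.IsSRestricted S

/-- `OGeoSRestricted G S O` : the graph `G` admits a geometric `S`-restricted drawing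
in which the vertex of `O` (if any) lies on the outer face. -/
def OGeoSRestricted (G : SimpleGraph V) (S : Set CrossingType) (O : Set V) : Prop :=
  ∃ D : Drawing G, D.IsGeometric ∧ D.IsSRestricted S ∧ ∀ v ∈ O, D.OnOuterFace v

/-- `k`-connectivity. -/
def KConnected (k : ℕ) (G : SimpleGraph V) : Prop :=
  k < Nat.card V ∧ ∀ T : Set V, T.ncard < k → (G.induce Tᶜ).Connected

/-- A vertex has degree exactly two. -/
def DegTwo (G : SimpleGraph V) (w : V) : Prop :=
  ∃ a b : V, a ≠ b ∧ G.neighborSet w = {a, b}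

/-- The simple graph obtained from `G` by suppressing the degree-2 vertices in `W`. -/
def suppress (G : SimpleGraph V) (Ws : Set V) : SimpleGraph {v : V // v ∉ Ws} :=
  SimpleGraph.fromRel (fun a b =>
    G.Adj a.1 b.1 ∨ ∃ w ∈ Ws, G.Adj w a.1 ∧ G.Adj w b.1)

/-- A graph is internally 3-connected if it is obtained from a 3-connected (multi)graph by
subdividing a subset of its edges once each. -/
def InternallyThreeConnected (G : SimpleGraph V) : Prop :=
  ∃ Ws : Set V, (∀ w ∈ Ws, DegTwo G w) ∧ (∀ w ∈ Ws, ∀ u ∈ Ws, ¬ G.Adj w u) ∧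
    KConnected 3 (suppress G Ws)

/-- `IsSeparation G T X₁ X₂` : `(X₁, X₂)` is a separation of `G` induced by the separator `T`. -/
def IsSeparation (G : SimpleGraph V) (T X₁ X₂ : Set V) : Prop :=
  X₁ ∪ X₂ = Set.univ ∧ X₁ ∩ X₂ = T ∧ (X₁ \ T).Nonempty ∧ (X₂ \ T).Nonempty ∧
  ∀ u ∈ X₁ \ T, ∀ v ∈ X₂ \ T, ∀ p : G.Walk u v, ∃ w ∈ T, w ∈ p.support

end OnePlanarity
namespace OnePlanarity

variable {V : Type*}

/-- A block (2-connected component) of `G`: a maximal vertex set inducing a connected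
subgraph without a cutvertex. -/
def IsBlock (G : SimpleGraph V) (B : Set V) : Prop :=
  B.Nonempty ∧ (G.induce B).Preconnected ∧
    (∀ v : V, (G.induce (B \ {v})).Preconnected) ∧
    ∀ B' : Set V, B ⊆ B' → B'.Nonempty → (G.induce B').Preconnected →
      (∀ v : V, (G.induce (B' \ {v})).Preconnected) → B = B'

/-- The graph `G[X] + {s t, t s'}` obtained from the induced subgraph `G[X]` by adding a
new vertex `t` (the `Sum.inr` vertex) adjacent exactly to `s` and `s'`. -/
def augment (G : SimpleGraph V) (X : Set V) (s s' : V) : SimpleGraph (↥X ⊕ Unit) :=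
  SimpleGraph.fromRel (fun a b =>
    (∃ u v : X, a = Sum.inl u ∧ b = Sum.inl v ∧ G.Adj u.1 v.1) ∨
    (∃ u : X, a = Sum.inl u ∧ ((u : V) = s ∨ (u : V) = s') ∧ b = Sum.inr ()))

/-- The copy of a set `O ⊆ V` inside the vertex set of `augment G X s s'`. -/
def liftO (X O : Set V) : Set (↥X ⊕ Unit) :=
  {x | ∃ u : X, x = Sum.inl u ∧ (u : V) ∈ O}

end OnePlanarity
namespace OnePlanarity

variable {V : Type*}

/-- Labels of the nodes of an SPR-tree. -/
inductive SPRLabel | S | P | R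
  deriving DecidableEq

/-- The simple graph underlying a family of skeleton edges. -/
def skGraph {E : Type*} (ends : E → Sym2 V) : SimpleGraph V :=
  SimpleGraph.fromRel (fun u v => ∃ e : E, ends e = s(u, v))

/-- The vertices used by a family of skeleton edges. -/
def skSupport {E : Type*} (ends : E → Sym2 V) : Set V :=
  {v | ∃ e : E, v ∈ ends e}

/-- The skeleton of an S-node: a cycle. -/
def IsCycleSkeleton {E : Type*} (ends : E → Sym2 V) : Prop :=
  Function.Injective ends ∧ ((skGraph ends).induce (skSupport ends)).Connected ∧
  (∀ v ∈ skSupport ends, {e : E | v ∈ ends e}.ncard = 2) ∧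
  3 ≤ (skSupport ends).ncard

/-- The skeleton of a P-node: a dipole with at least three parallel edges. -/
def IsDipoleSkeleton {E : Type*} (ends : E → Sym2 V) : Prop :=
  (∃ u v : V, u ≠ v ∧ ∀ e : E, ends e = s(u, v)) ∧ 3 ≤ Nat.card E

/-- The skeleton of an R-node: a simple 3-connected graph. -/
def IsRSkeleton {E : Type*} (ends : E → Sym2 V) : Prop :=
  Function.Injective ends ∧ KConnected 3 ((skGraph ends).induce (skSupport ends))

/-- An SPR-tree of a (2-connected) graph `G`: a tree whose nodes carry skeletons (families
of real and virtual edges over the vertex set of `G`) which are cycles (S-nodes), dipoles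
(P-nodes) or 3-connected graphs (R-nodes); the real edges of the skeletons partition the
edges of `G`, the virtual edges are matched in pairs with equal endpoints along the tree
edges (one pair per tree edge), no two adjacent nodes are both S-nodes or both P-nodes,
and the paired virtual edges separate `G` accordingly: the supports of the two sides of a
tree edge meet exactly in the endpoints of its pair of virtual edges. -/
structure SPRTree (G : SimpleGraph V) where
  ι : Type
  tree : SimpleGraph ι
  tree_conn : tree.Connected
  tree_acyclic : tree.IsAcyclic
  label : ι → SPRLabel
  E : ι → Type
  ends : ∀ x : ι, E x → Sym2 V
  ends_not_diag : ∀ (x : ι) (e : E x), ¬ (ends x e).IsDiag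
  IsVirt : ∀ x : ι, E x → Prop
  skel_S : ∀ x, label x = SPRLabel.S → IsCycleSkeleton (ends x)
  skel_P : ∀ x, label x = SPRLabel.P → IsDipoleSkeleton (ends x)
  skel_R : ∀ x, label x = SPRLabel.R → IsRSkeleton (ends x)
  no_SS : ∀ x y, tree.Adj x y → ¬(label x = SPRLabel.S ∧ label y = SPRLabel.S)
  no_PP : ∀ x y, tree.Adj x y → ¬(label x = SPRLabel.P ∧ label y = SPRLabel.P)
  real_edge : ∀ (x : ι) (e : E x), ¬ IsVirt x e → ends x e ∈ G.edgeSet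
  real_cover : ∀ f ∈ G.edgeSet,
    ∃! p : Σ x : ι, E x, ¬ IsVirt p.1 p.2 ∧ ends p.1 p.2 = f
  paired : (Σ x : ι, E x) → (Σ x : ι, E x) → Prop
  paired_symm : ∀ p q, paired p q → paired q p
  paired_virt : ∀ p q, paired p q → IsVirt p.1 p.2
  paired_tree : ∀ p q, paired p q → tree.Adj p.1 q.1
  paired_ends : ∀ p q, paired p q → ends p.1 p.2 = ends q.1 q.2
  virt_paired : ∀ p : Σ x : ι, E x, IsVirt p.1 p.2 → ∃! q, paired p q
  tree_edge_pair : ∀ x y, tree.Adj x y → ∃! pq : E x × E y, paired ⟨x, pq.1⟩ ⟨y, pq.2⟩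
  support_cover : (⋃ x : ι, skSupport (ends x)) = Set.univ
  side_condition : ∀ p q : Σ x : ι, E x, paired p q →
    (⋃ z ∈ {z : ι | (tree.deleteEdges {s(p.1, q.1)}).Reachable z p.1},
        skSupport (ends z)) ∩
    (⋃ z ∈ {z : ι | (tree.deleteEdges {s(p.1, q.1)}).Reachable z q.1},
        skSupport (ends z)) ⊆ {v : V | v ∈ ends p.1 p.2}

/-- The skeleton+ of a node `x` of an SPR-tree: all real edges of the skeleton of `x`;
for each virtual edge `uv` of the skeleton, a path `u - t - v` through a new subdivision
vertex `t` (the vertex `Sum.inr` of the virtual edge), and additionally the edge `uv`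
itself whenever `uv` is an actual edge of `G`. -/
def SPRTree.skeletonPlus {G : SimpleGraph V} (T : SPRTree G) (x : T.ι) :
    SimpleGraph (V ⊕ T.E x) :=
  SimpleGraph.fromRel (fun a b =>
    (∃ u w : V, a = Sum.inl u ∧ b = Sum.inl w ∧
      ((∃ e : T.E x, ¬ T.IsVirt x e ∧ T.ends x e = s(u, w)) ∨
       (∃ e : T.E x, T.IsVirt x e ∧ T.ends x e = s(u, w) ∧ s(u, w) ∈ G.edgeSet))) ∨
    (∃ (u : V) (e : T.E x), a = Sum.inl u ∧ b = Sum.inr e ∧ T.IsVirt x e ∧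
      u ∈ T.ends x e))

end OnePlanarity
namespace OnePlanarity

lemma isArc_of_Icc {f : ℝ → ℝ × ℝ} {a b : ℝ} (hab : a < b) (hc : ContinuousOn f (Set.Icc a b))
    (hi : Set.InjOn f (Set.Icc a b)) : IsArc (f '' Set.Icc a b) (f a) (f b) := by
  have hmem : ∀ t : I, a + t * (b - a) ∈ Set.Icc a b := fun t =>
    ⟨by nlinarith [t.2.1, t.2.2], by nlinarith [t.2.1, t.2.2]⟩
  refine ⟨fun t => f (a + t * (b - a)), ?_, ?_, by simp, by simp, ?_⟩
  · exact hc.comp_continuous (by fun_prop) hmem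
  · intro s t h
    have := hi (hmem s) (hmem t) h
    have h2 : (s : ℝ) * (b - a) = t * (b - a) := by linarith
    exact Subtype.ext (mul_right_cancel₀ (by linarith) h2)
  · ext p
    constructor
    · rintro ⟨t, rfl⟩
      exact ⟨_, hmem t, rfl⟩
    · rintro ⟨t, ht, rfl⟩
      have hba : 0 < b - a := by linarith
      refine ⟨⟨(t - a) / (b - a), ?_, ?_⟩, ?_⟩
      · exact div_nonneg (by linarith [ht.1]) hba.le
      · rw [div_le_one hba]; linarith [ht.2]
      · simp only
        congr 1
        field_simp
        ring

lemma IsArc.exists_fun {A : Set (ℝ × ℝ)} {x y : ℝ × ℝ} (h : IsArc A x y) :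
    ∃ f : ℝ → ℝ × ℝ, ContinuousOn f (Set.Icc 0 1) ∧ Set.InjOn f (Set.Icc 0 1) ∧
      f 0 = x ∧ f 1 = y ∧ f '' Set.Icc 0 1 = A := by
  obtain ⟨f, hc, hi, h0, h1, hr⟩ := h
  have key : ∀ t (ht : t ∈ Set.Icc (0 : ℝ) 1), Set.IccExtend zero_le_one f t = f ⟨t, ht⟩ :=
    fun t ht => Set.IccExtend_of_mem _ _ ht
  refine ⟨Set.IccExtend zero_le_one f, hc.Icc_extend'.continuousOn, ?_, ?_, ?_, ?_⟩
  · intro s hs t ht hst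
    rw [key s hs, key t ht] at hst
    exact congrArg Subtype.val (hi hst)
  · rw [key 0 (by simp)]; exact h0
  · rw [key 1 (by simp)]; exact h1
  · rw [← hr]
    ext p
    constructor
    · rintro ⟨t, ht, rfl⟩
      exact ⟨⟨t, ht⟩, (key t ht).symm⟩
    · rintro ⟨t, rfl⟩
      exact ⟨t, t.2, key t t.2⟩

lemma IsArc.symm {A : Set (ℝ × ℝ)} {x y : ℝ × ℝ} (h : IsArc A x y) : IsArc A y x := by
  obtain ⟨f, hc, hi, h0, h1, hr⟩ := h
  refine ⟨f ∘ unitInterval.symm, hc.comp unitInterval.continuous_symm,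
    hi.comp unitInterval.symm_bijective.1, by simp [h1], by simp [h0], ?_⟩
  rw [Set.range_comp, unitInterval.symm_bijective.2.range_eq, Set.image_univ, hr]

lemma IsArc.left_mem {A : Set (ℝ × ℝ)} {x y : ℝ × ℝ} (h : IsArc A x y) : x ∈ A := by
  obtain ⟨f, hc, hi, h0, h1, hr⟩ := h
  exact hr ▸ ⟨0, h0⟩

lemma IsArc.right_mem {A : Set (ℝ × ℝ)} {x y : ℝ × ℝ} (h : IsArc A x y) : y ∈ A :=
  h.symm.left_mem

lemma IsArc.ne {A : Set (ℝ × ℝ)} {x y : ℝ × ℝ} (h : IsArc A x y) : x ≠ y := by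
  obtain ⟨f, hc, hi, h0, h1, hr⟩ := h
  rintro rfl
  exact zero_ne_one (hi (h0.trans h1.symm))

lemma IsArc.isCompact {A : Set (ℝ × ℝ)} {x y : ℝ × ℝ} (h : IsArc A x y) : IsCompact A := by
  obtain ⟨f, hc, hi, h0, h1, hr⟩ := h
  exact hr ▸ isCompact_range hc

lemma IsArc.image {A : Set (ℝ × ℝ)} {x y : ℝ × ℝ} (h : IsArc A x y) {φ : ℝ × ℝ → ℝ × ℝ}
    (hc : ContinuousOn φ A) (hi : Set.InjOn φ A) : IsArc (φ '' A) (φ x) (φ y) := by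
  obtain ⟨f, hfc, hfi, h0, h1, hr⟩ := h
  subst hr
  refine ⟨φ ∘ f, hc.comp_continuous hfc (fun t => ⟨t, rfl⟩), ?_, by simp [h0], by simp [h1],
    Set.range_comp _ _⟩
  intro s t hst
  exact hfi (hi ⟨s, rfl⟩ ⟨t, rfl⟩ hst)

lemma isArc_segment {a b : ℝ × ℝ} (h : a ≠ b) : IsArc (segment ℝ a b) a b := by
  have := isArc_of_Icc (f := fun t : ℝ => a + t • (b - a)) zero_lt_one
    (by fun_prop) (fun s _ t _ hst => by
      have h1 : (s - t) • (b - a) = 0 := by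
        rw [sub_smul, sub_eq_zero]; exact add_left_cancel hst
      rcases smul_eq_zero.1 h1 with h2 | h2
      · linarith
      · exact absurd (sub_eq_zero.1 h2).symm h)
  rw [segment_eq_image']
  simpa using this

/-- Concatenation of two arcs meeting only in their common endpoint. -/
lemma IsArc.trans {A B : Set (ℝ × ℝ)} {x y z : ℝ × ℝ} (hA : IsArc A x y) (hB : IsArc B y z)
    (hAB : ∀ p ∈ A, p ∈ B → p = y) : IsArc (A ∪ B) x z := by
  obtain ⟨f, hfc, hfi, f0, f1, rfl⟩ := hA.exists_fun
  obtain ⟨g, hgc, hgi, g0, g1, rfl⟩ := hB.exists_fun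
  set h : ℝ → ℝ × ℝ := fun t => if t ≤ 1 then f t else g (t - 1) with hh
  have hl : ∀ t ∈ Set.Icc (0 : ℝ) 1, h t = f t := fun t ht => by simp [hh, ht.2]
  have hr : ∀ t ∈ Set.Icc (1 : ℝ) 2, h t = g (t - 1) := fun t ht => by
    rcases eq_or_lt_of_le ht.1 with h1 | h1
    · subst h1; simp [hh, f1, g0]
    · simp [hh, not_le.2 h1]
  have hun : Set.Icc (0 : ℝ) 2 = Set.Icc 0 1 ∪ Set.Icc 1 2 :=
    (Set.Icc_union_Icc_eq_Icc (by norm_num) (by norm_num)).symm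
  have hsub : Set.MapsTo (fun t : ℝ => t - 1) (Set.Icc 1 2) (Set.Icc 0 1) := fun t ht =>
    ⟨by linarith [ht.1], by linarith [ht.2]⟩
  have hgc' : ContinuousOn (fun t => g (t - 1)) (Set.Icc 1 2) :=
    hgc.comp (by fun_prop) hsub
  have hcont : ContinuousOn h (Set.Icc 0 2) := by
    rw [hun]
    exact (hfc.congr hl).union_of_isClosed (hgc'.congr hr) isClosed_Icc isClosed_Icc
  have hcross : ∀ s ∈ Set.Icc (0 : ℝ) 1, ∀ t ∈ Set.Icc (1 : ℝ) 2, h s = h t → s = t := by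
    intro s hs t ht hst
    rw [hl s hs, hr t ht] at hst
    have e1 : f s = y := hAB _ ⟨s, hs, rfl⟩ ⟨t - 1, hsub ht, hst.symm⟩
    have e2 : s = 1 := hfi hs (by simp) (e1.trans f1.symm)
    have e3 : t - 1 = 0 := hgi (hsub ht) (by simp) (by rw [← hst, e1, g0])
    linarith
  have hinj : Set.InjOn h (Set.Icc 0 2) := by
    rw [hun]
    rintro s (hs | hs) t (ht | ht) hst
    · rw [hl s hs, hl t ht] at hst; exact hfi hs ht hst
    · exact hcross s hs t ht hst
    · exact (hcross t ht s hs hst.symm).symm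
    · rw [hr s hs, hr t ht] at hst
      have := hgi (hsub hs) (hsub ht) hst
      linarith
  have := isArc_of_Icc (by norm_num) hcont hinj
  rw [hl 0 (by simp), f0, hr 2 (by norm_num), show (2 : ℝ) - 1 = 1 by norm_num, g1] at this
  convert this using 1
  rw [hun, Set.image_union, Set.EqOn.image_eq (fun t ht => hl t ht),
    Set.EqOn.image_eq (fun t ht => hr t ht)]
  congr 1
  ext p
  constructor
  · rintro ⟨t, ht, rfl⟩
    exact ⟨t + 1, ⟨by linarith [ht.1], by linarith [ht.2]⟩, by simp⟩
  · rintro ⟨t, ht, rfl⟩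
    exact ⟨t - 1, hsub ht, rfl⟩

/-- An interior point splits an arc into two. -/
lemma IsArc.split {A : Set (ℝ × ℝ)} {x y p : ℝ × ℝ} (hA : IsArc A x y) (hp : p ∈ A)
    (hx : p ≠ x) (hy : p ≠ y) : ∃ B C, B ∪ C = A ∧ B ∩ C = {p} ∧ IsArc B x p ∧ IsArc C p y := by
  obtain ⟨f, hfc, hfi, f0, f1, rfl⟩ := hA.exists_fun
  obtain ⟨s, hs, rfl⟩ := hp
  have hs0 : 0 < s := lt_of_le_of_ne hs.1 (by rintro rfl; exact hx f0)
  have hs1 : s < 1 := lt_of_le_of_ne hs.2 (by rintro rfl; exact hy f1)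
  have s1 : Set.Icc 0 s ⊆ Set.Icc (0 : ℝ) 1 := Set.Icc_subset_Icc le_rfl hs.2
  have s2 : Set.Icc s 1 ⊆ Set.Icc (0 : ℝ) 1 := Set.Icc_subset_Icc hs.1 le_rfl
  refine ⟨f '' Set.Icc 0 s, f '' Set.Icc s 1, ?_, ?_, ?_, ?_⟩
  · rw [← Set.image_union, Set.Icc_union_Icc_eq_Icc hs.1 hs.2]
  · rw [← hfi.image_inter s1 s2, Set.Icc_inter_Icc_eq_singleton hs.1 hs.2, Set.image_singleton]
  · rw [← f0]; exact isArc_of_Icc hs0 (hfc.mono s1) (hfi.mono s1)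
  · rw [← f1]; exact isArc_of_Icc hs1 (hfc.mono s2) (hfi.mono s2)

/-- The part of an arc after its last visit to a closed ball around its first endpoint. -/
lemma IsArc.trim {A : Set (ℝ × ℝ)} {x y c : ℝ × ℝ} {r : ℝ} (hA : IsArc A x y)
    (hx : x ∈ Metric.closedBall c r) (hy : y ∉ Metric.closedBall c r) :
    ∃ a B, B ⊆ A ∧ IsArc B a y ∧ dist a c = r ∧ ∀ p ∈ B, p ∈ Metric.closedBall c r → p = a := by
  obtain ⟨f, hfc, hfi, f0, f1, rfl⟩ := hA.exists_fun
  have hcl : IsCompact (Set.Icc (0 : ℝ) 1 ∩ f ⁻¹' Metric.closedBall c r) :=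
    isCompact_Icc.of_isClosed_subset
      (hfc.preimage_isClosed_of_isClosed isClosed_Icc Metric.isClosed_closedBall)
      Set.inter_subset_left
  obtain ⟨s, ⟨hs, hsb⟩, hmax⟩ := hcl.exists_isGreatest ⟨0, by simp, by simpa [f0] using hx⟩
  have hs1 : s < 1 := lt_of_le_of_ne hs.2 (by rintro rfl; exact hy (f1 ▸ hsb))
  have s2 : Set.Icc s 1 ⊆ Set.Icc (0 : ℝ) 1 := Set.Icc_subset_Icc hs.1 le_rfl
  refine ⟨f s, f '' Set.Icc s 1, Set.image_mono s2, f1 ▸ isArc_of_Icc hs1 (hfc.mono s2)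
    (hfi.mono s2), ?_, ?_⟩
  · have hle : dist (f s) c ≤ r := hsb
    by_contra hne
    have hlt : dist (f s) c < r := lt_of_le_of_ne hle hne
    have hd : ContinuousOn (fun t => dist (f t) c) (Set.Icc s 1) :=
      continuous_dist.comp_continuousOn ((hfc.mono s2).prodMk continuousOn_const)
    have h1 : r < dist (f 1) c := by rw [f1]; simpa using hy
    obtain ⟨t, ht, hteq⟩ := intermediate_value_Icc hs1.le hd ⟨hlt.le, h1.le⟩
    have := hmax ⟨s2 ht, (show dist (f t) c ≤ r from hteq.le)⟩
    have hts : t = s := le_antisymm this ht.1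
    subst hts
    exact hne hteq
  · rintro _ ⟨t, ht, rfl⟩ hb
    rw [le_antisymm (hmax ⟨s2 ht, hb⟩) ht.1]

lemma IsArc.isPreconnected_interior {A : Set (ℝ × ℝ)} {x y : ℝ × ℝ} (h : IsArc A x y) :
    IsPreconnected (A \ {x, y}) := by
  obtain ⟨f, hfc, hfi, f0, f1, rfl⟩ := h.exists_fun
  have : f '' Set.Icc 0 1 \ {x, y} = f '' Set.Ioo 0 1 := by
    ext p
    constructor
    · rintro ⟨⟨t, ht, rfl⟩, hne⟩
      simp only [Set.mem_insert_iff, Set.mem_singleton_iff, not_or] at hne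
      refine ⟨t, ⟨lt_of_le_of_ne ht.1 ?_, lt_of_le_of_ne ht.2 ?_⟩, rfl⟩
      · rintro rfl; exact hne.1 f0
      · rintro rfl; exact hne.2 f1
    · rintro ⟨t, ht, rfl⟩
      refine ⟨⟨t, Set.Ioo_subset_Icc_self ht, rfl⟩, ?_⟩
      rintro (hx | hy)
      · exact ht.1.ne' (hfi (Set.Ioo_subset_Icc_self ht) (by simp) (hx.trans f0.symm))
      · exact ht.2.ne (hfi (Set.Ioo_subset_Icc_self ht) (by simp)
          ((Set.mem_singleton_iff.1 hy).trans f1.symm))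
  rw [this]
  exact isPreconnected_Ioo.image _ (hfc.mono Set.Ioo_subset_Icc_self)

/-- Both ends of an arc trimmed at disjoint closed balls around its endpoints. -/
lemma IsArc.trim_both {A : Set (ℝ × ℝ)} {x y : ℝ × ℝ} {r : ℝ} (hA : IsArc A x y) (hr : 0 ≤ r)
    (hd : Disjoint (Metric.closedBall x r) (Metric.closedBall y r)) :
    ∃ a b B, B ⊆ A ∧ IsArc B a b ∧ dist a x = r ∧ dist b y = r ∧
      (∀ p ∈ B, p ∈ Metric.closedBall x r → p = a) ∧
      (∀ p ∈ B, p ∈ Metric.closedBall y r → p = b) := by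
  have hx := Metric.mem_closedBall_self (x := x) hr
  have hy := Metric.mem_closedBall_self (x := y) hr
  obtain ⟨a, B, hBA, hB, ha, haB⟩ := hA.trim hx (hd.notMem_of_mem_right hy)
  have ha' : a ∈ Metric.closedBall x r := ha.le
  obtain ⟨b, C, hCB, hC, hb, hbC⟩ := hB.symm.trim hy (hd.notMem_of_mem_left ha')
  exact ⟨a, b, C, hCB.trans hBA, hC.symm, ha, hb, fun p hp h => haB p (hCB hp) h, hbC⟩

/-- A crossing-free drawing of the non-isolated vertices and the edges of `H`. -/
structure IsEmb {W : Type*} (H : SimpleGraph W) (pos : W → ℝ × ℝ) (arc : Sym2 W → Set (ℝ × ℝ)) :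
    Prop where
  inj : Set.InjOn pos H.support
  isArc : ∀ ⦃a b⦄, H.Adj a b → IsArc (arc s(a, b)) (pos a) (pos b)
  avoid : ∀ ⦃e⦄, e ∈ H.edgeSet → ∀ ⦃w⦄, w ∈ H.support → pos w ∈ arc e → w ∈ e
  inter : ∀ ⦃e⦄, e ∈ H.edgeSet → ∀ ⦃e'⦄, e' ∈ H.edgeSet → e ≠ e' → ∀ ⦃p⦄, p ∈ arc e → p ∈ arc e' →
    ∃ w, w ∈ e ∧ w ∈ e' ∧ p = pos w

/-- Planarity, ignoring isolated vertices. -/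
def Planar {W : Type*} (H : SimpleGraph W) : Prop := ∃ pos arc, IsEmb H pos arc

section
variable {W : Type*} {H : SimpleGraph W} {pos : W → ℝ × ℝ} {arc : Sym2 W → Set (ℝ × ℝ)}

lemma mem_support_of_mem_edge {e : Sym2 W} (he : e ∈ H.edgeSet) {w : W} (hw : w ∈ e) :
    w ∈ H.support := by
  induction e with | _ a b => ?_
  rw [SimpleGraph.mem_edgeSet] at he
  rcases Sym2.mem_iff.1 hw with rfl | rfl
  · exact ⟨b, he⟩
  · exact ⟨a, he.symm⟩

lemma IsEmb.isCompact_arc (h : IsEmb H pos arc) {e : Sym2 W} (he : e ∈ H.edgeSet) :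
    IsCompact (arc e) := by
  induction e with | _ a b => exact (h.isArc he).isCompact

lemma IsEmb.pos_mem (h : IsEmb H pos arc) {e : Sym2 W} (he : e ∈ H.edgeSet) {w : W}
    (hw : w ∈ e) : pos w ∈ arc e := by
  induction e with | _ a b => ?_
  rcases Sym2.mem_iff.1 hw with rfl | rfl
  · exact (h.isArc he).left_mem
  · exact (h.isArc he).right_mem

lemma segment_subset_closedBall (c p : ℝ × ℝ) : segment ℝ c p ⊆ Metric.closedBall c (dist p c) :=
  (convex_closedBall c _).segment_subset (Metric.mem_closedBall_self dist_nonneg)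
    (Metric.mem_closedBall.2 le_rfl)

lemma eq_of_mem_segment_of_dist {c p z : ℝ × ℝ} (hz : z ∈ segment ℝ c p)
    (hd : dist z c = dist p c) : z = p := by
  rw [segment_eq_image'] at hz
  obtain ⟨t, ht, rfl⟩ := hz
  rw [dist_eq_norm, dist_eq_norm, add_sub_cancel_left, norm_smul, Real.norm_eq_abs,
    abs_of_nonneg ht.1] at hd
  rcases eq_or_ne p c with rfl | h
  · simp
  · have : t = 1 := by
      have := norm_pos_iff.2 (sub_ne_zero.2 h)
      nlinarith
    simp [this]

lemma eq_of_mem_two_segments {c p p' z : ℝ × ℝ} (hz : z ∈ segment ℝ c p)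
    (hz' : z ∈ segment ℝ c p') (hd : dist p c = dist p' c) : z = c ∨ p = p' := by
  rw [segment_eq_image'] at hz hz'
  obtain ⟨t, ht, rfl⟩ := hz
  obtain ⟨t', ht', h⟩ := hz'
  replace h : t' • (p' - c) = t • (p - c) := by simpa using h
  have h1 := congrArg norm h
  rw [norm_smul, norm_smul, Real.norm_of_nonneg ht.1, Real.norm_of_nonneg ht'.1, ← dist_eq_norm,
    ← dist_eq_norm, hd] at h1
  rcases eq_or_ne (dist p' c) 0 with h0 | h0
  · left; rw [h0, dist_eq_zero] at hd; simp [hd]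
  · have : t' = t := mul_right_cancel₀ h0 h1
    subst this
    rcases eq_or_ne t' 0 with h2 | h2
    · left; simp [h2]
    · right; exact (sub_left_injective (smul_right_injective _ h2 h)).symm

lemma IsEmb.exists_radius [Finite W] (h : IsEmb H pos arc) :
    ∃ r > 0, (∀ a ∈ H.support, ∀ b ∈ H.support, a ≠ b →
      Disjoint (Metric.closedBall (pos a) r) (Metric.closedBall (pos b) r)) ∧
      ∀ c ∈ H.support, ∀ e ∈ H.edgeSet, c ∉ e →
        Disjoint (Metric.closedBall (pos c) r) (arc e) := by
  have key : ∀ᶠ r : ℝ in nhdsWithin 0 (Set.Ioi 0), (∀ a b, a ∈ H.support → b ∈ H.support → a ≠ b →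
      Disjoint (Metric.closedBall (pos a) r) (Metric.closedBall (pos b) r)) ∧
      ∀ c e, c ∈ H.support → e ∈ H.edgeSet → c ∉ e →
        Disjoint (Metric.closedBall (pos c) r) (arc e) := by
    refine Filter.Eventually.and ?_ ?_
    · rw [Filter.eventually_all]; intro a
      rw [Filter.eventually_all]; intro b
      by_cases hab : a ∈ H.support ∧ b ∈ H.support ∧ a ≠ b
      · have hd : 0 < dist (pos a) (pos b) :=
          dist_pos.2 fun h' => hab.2.2 (h.inj hab.1 hab.2.1 h')
        have : ∀ᶠ r : ℝ in nhdsWithin 0 (Set.Ioi 0), r < dist (pos a) (pos b) / 2 :=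
          nhdsWithin_le_nhds (Iio_mem_nhds (by linarith))
        filter_upwards [this] with r hr _ _ _
        exact Metric.closedBall_disjoint_closedBall (by linarith)
      · filter_upwards with r h1 h2 h3
        exact absurd ⟨h1, h2, h3⟩ hab
    · rw [Filter.eventually_all]; intro c
      rw [Filter.eventually_all]; intro e
      by_cases hce : c ∈ H.support ∧ e ∈ H.edgeSet ∧ c ∉ e
      · have hn : (arc e)ᶜ ∈ nhds (pos c) :=
          (h.isCompact_arc hce.2.1).isClosed.isOpen_compl.mem_nhds fun h' =>
            hce.2.2 (h.avoid hce.2.1 hce.1 h')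
        obtain ⟨ε, hε, hs⟩ := Metric.nhds_basis_closedBall.mem_iff.1 hn
        have : ∀ᶠ r : ℝ in nhdsWithin 0 (Set.Ioi 0), r < ε :=
          nhdsWithin_le_nhds (Iio_mem_nhds hε)
        filter_upwards [this] with r hr _ _ _
        exact (Set.disjoint_left.2 fun p hp hpe =>
          hs (Metric.closedBall_subset_closedBall hr.le hp) hpe)
      · filter_upwards with r h1 h2 h3
        exact absurd ⟨h1, h2, h3⟩ hce
  obtain ⟨r, ⟨h1, h2⟩, hr⟩ := (key.and self_mem_nhdsWithin).exists
  exact ⟨r, hr, fun a ha b hb => h1 a b ha hb, fun c hc e he => h2 c e hc he⟩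

/-- Every embedding can be changed so that edges leave their endpoints along segments. -/
lemma IsEmb.exists_radial [Finite W] (h : IsEmb H pos arc) :
    ∃ arc', IsEmb H pos arc' ∧ ∀ e ∈ H.edgeSet, ∀ a ∈ e, ∃ p, p ≠ pos a ∧
      p ∉ pos '' H.support ∧ segment ℝ (pos a) p ⊆ arc' e := by
  classical
  obtain ⟨r, hr, hd, hav⟩ := h.exists_radius
  have hB : ∀ e : Sym2 W, ∃ (B : Set (ℝ × ℝ)) (t : W → ℝ × ℝ), e ∈ H.edgeSet →
      B ⊆ arc e ∧ (∀ a b, e = s(a, b) → IsArc B (t a) (t b)) ∧ ∀ a ∈ e, dist (t a) (pos a) = r ∧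
        ∀ p ∈ B, p ∈ Metric.closedBall (pos a) r → p = t a := by
    intro e
    by_cases he : e ∈ H.edgeSet
    · induction e with | _ a b => ?_
      have hab : H.Adj a b := he
      obtain ⟨p, q, B, hBA, hB, hp, hq, h1, h2⟩ := (h.isArc hab).trim_both hr.le
        (hd a ⟨b, hab⟩ b ⟨a, hab.symm⟩ hab.ne)
      refine ⟨B, fun w => if w = a then p else q, fun _ => ⟨hBA, ?_, ?_⟩⟩
      · intro c d hcd
        rcases Sym2.eq_iff.1 hcd with ⟨rfl, rfl⟩ | ⟨rfl, rfl⟩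
        · simpa [hab.ne'] using hB
        · simpa [hab.ne'] using hB.symm
      · intro c hc
        rcases Sym2.mem_iff.1 hc with rfl | rfl
        · simpa using ⟨hp, by simpa using h1⟩
        · simpa [hab.ne'] using ⟨hq, by simpa using h2⟩
    · exact ⟨∅, pos, fun h' => absurd h' he⟩
  choose B t hBt using hB
  have hseg : ∀ e ∈ H.edgeSet, ∀ a ∈ e, segment ℝ (pos a) (t e a) ⊆ Metric.closedBall (pos a) r :=
    fun e he a ha => ((hBt e he).2.2 a ha).1 ▸ segment_subset_closedBall _ _
  have htB : ∀ e ∈ H.edgeSet, ∀ a ∈ e, t e a ∈ B e := by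
    intro e he a ha
    obtain ⟨b, rfl⟩ := Sym2.mem_iff_exists.1 ha
    exact ((hBt _ he).2.1 a b rfl).left_mem
  have htne : ∀ e ∈ H.edgeSet, ∀ a ∈ e, ∀ w ∈ H.support, t e a ≠ pos w := by
    intro e he a ha w hw h'
    have h1 := ((hBt e he).2.2 a ha).1
    rcases eq_or_ne w a with rfl | hwa
    · rw [h', dist_self] at h1; exact hr.ne h1
    · exact Set.disjoint_left.1 (hd w hw a (mem_support_of_mem_edge he ha) hwa)
        (Metric.mem_closedBall_self hr.le) (h' ▸ Metric.mem_closedBall.2 h1.le)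
  set arc' : Sym2 W → Set (ℝ × ℝ) := fun e => B e ∪ ⋃ a ∈ e, segment ℝ (pos a) (t e a) with harc
  have hmem : ∀ e p, p ∈ arc' e ↔ p ∈ B e ∨ ∃ a ∈ e, p ∈ segment ℝ (pos a) (t e a) := by
    intro e p; simp [harc]
  refine ⟨arc', ⟨h.inj, ?_, ?_, ?_⟩, ?_⟩
  · intro a b hab
    obtain ⟨hBA, hBarc, hBb⟩ := hBt s(a, b) hab
    have ha : a ∈ s(a, b) := Sym2.mem_mk_left _ _
    have hb : b ∈ s(a, b) := Sym2.mem_mk_right _ _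
    have e1 : arc' s(a, b) = (segment ℝ (pos a) (t s(a, b) a) ∪ B s(a, b)) ∪
        segment ℝ (t s(a, b) b) (pos b) := by
      ext p; rw [hmem, segment_symm ℝ (t _ b)]; simp only [Sym2.mem_iff, Set.mem_union]
      constructor
      · rintro (h | ⟨c, rfl | rfl, h⟩) <;> simp [h]
      · rintro ((h | h) | h)
        exacts [.inr ⟨a, .inl rfl, h⟩, .inl h, .inr ⟨b, .inr rfl, h⟩]
    rw [e1]
    have hdd := Set.disjoint_left.1 (hd a ⟨b, hab⟩ b ⟨a, hab.symm⟩ hab.ne)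
    refine ((isArc_segment (htne _ hab a ha a ⟨b, hab⟩).symm).trans (hBarc a b rfl) ?_).trans
      (isArc_segment (htne _ hab b hb b ⟨a, hab.symm⟩)) ?_
    · intro p hp hpB
      exact (hBb a ha).2 p hpB (hseg _ hab a ha hp)
    · intro p hp hpb
      rw [segment_symm] at hpb
      rcases hp with hp | hp
      · exact absurd (hseg _ hab b hb hpb) (hdd (hseg _ hab a ha hp))
      · exact (hBb b hb).2 p hp (hseg _ hab b hb hpb)
  · intro e he w hw hwe
    rcases (hmem _ _).1 hwe with h1 | ⟨a, ha, h1⟩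
    · exact h.avoid he hw ((hBt e he).1 h1)
    · rcases eq_or_ne w a with rfl | hwa
      · exact ha
      · exact absurd (hseg e he a ha h1) (Set.disjoint_left.1
          (hd w hw a (mem_support_of_mem_edge he ha) hwa) (Metric.mem_closedBall_self hr.le))
  · have mixed : ∀ e ∈ H.edgeSet, ∀ e' ∈ H.edgeSet, e ≠ e' → ∀ p, p ∈ B e → ∀ c ∈ e',
        p ∈ segment ℝ (pos c) (t e' c) → ∃ w, w ∈ e ∧ w ∈ e' ∧ p = pos w := by
      intro e he e' he' hne p hp c hc hpc
      by_cases hce : c ∈ e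
      · have h1 := ((hBt e he).2.2 c hce).2 p hp (hseg _ he' c hc hpc)
        have h2 : p = t e' c := eq_of_mem_segment_of_dist hpc (by
          rw [h1, ((hBt e he).2.2 c hce).1, ((hBt e' he').2.2 c hc).1])
        exact h.inter he he' hne ((hBt e he).1 hp) ((hBt e' he').1 (h2 ▸ htB e' he' c hc))
      · exact absurd ((hBt e he).1 hp) (Set.disjoint_left.1
          (hav c (mem_support_of_mem_edge he' hc) e he hce) (hseg _ he' c hc hpc))
    intro e he e' he' hne p hp hp'
    rcases (hmem _ _).1 hp with h1 | ⟨a, ha, h1⟩ <;> rcases (hmem _ _).1 hp' with h2 | ⟨c, hc, h2⟩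
    · exact h.inter he he' hne ((hBt e he).1 h1) ((hBt e' he').1 h2)
    · exact mixed e he e' he' hne p h1 c hc h2
    · obtain ⟨w, h3, h4, h5⟩ := mixed e' he' e he hne.symm p h2 a ha h1
      exact ⟨w, h4, h3, h5⟩
    · rcases eq_or_ne a c with rfl | hac
      · rcases eq_of_mem_two_segments h1 h2 (by
          rw [((hBt e he).2.2 a ha).1, ((hBt e' he').2.2 a hc).1]) with h3 | h3
        · exact ⟨a, ha, hc, h3⟩
        · obtain ⟨w, h4, h5, h6⟩ := h.inter he he' hne ((hBt e he).1 (htB e he a ha))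
            ((hBt e' he').1 (h3 ▸ htB e' he' a hc))
          exact absurd h6 (htne e he a ha w (mem_support_of_mem_edge he h4))
      · exact absurd (hseg e' he' c hc h2) (Set.disjoint_left.1
          (hd a (mem_support_of_mem_edge he ha) c (mem_support_of_mem_edge he' hc) hac)
          (hseg e he a ha h1))
  · intro e he a ha
    refine ⟨t e a, htne e he a ha a (mem_support_of_mem_edge he ha), ?_, fun p hp =>
      (hmem _ _).2 (.inr ⟨a, ha, hp⟩)⟩
    rintro ⟨w, hw, hwe⟩
    exact htne e he a ha w hw hwe.symm

end

/-- `SPoly A p q`: the set `A` is a simple polyline from `p` to `q`. -/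
inductive SPoly : Set (ℝ × ℝ) → ℝ × ℝ → ℝ × ℝ → Prop
  | seg {p q : ℝ × ℝ} (h : p ≠ q) : SPoly (segment ℝ p q) p q
  | cons {p p₁ q : ℝ × ℝ} {A : Set (ℝ × ℝ)} (h : p ≠ p₁) (hA : SPoly A p₁ q)
      (hi : segment ℝ p p₁ ∩ A = {p₁}) : SPoly (segment ℝ p p₁ ∪ A) p q

lemma SPoly.isArc {A : Set (ℝ × ℝ)} {p q : ℝ × ℝ} (h : SPoly A p q) : IsArc A p q := by
  induction h with
  | seg h => exact isArc_segment h
  | cons h hA hi ih =>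
    exact (isArc_segment h).trans ih fun z hz hz' => (hi ▸ ⟨hz, hz'⟩ : z ∈ ({_} : Set _))

lemma SPoly.tail {A : Set (ℝ × ℝ)} {p q z : ℝ × ℝ} (h : SPoly A p q) (hz : z ∈ A) (hq : z ≠ q) :
    ∃ A' ⊆ A, SPoly A' z q := by
  induction h with
  | seg h =>
    exact ⟨_, (convex_segment _ _).segment_subset hz (right_mem_segment ℝ _ _), .seg hq⟩
  | @cons p p₁ q A h hA hi ih =>
    by_cases hzA : z ∈ A
    · obtain ⟨A', hA', h'⟩ := ih hzA hq
      exact ⟨A', hA'.trans Set.subset_union_right, h'⟩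
    · have hz' := hz.resolve_right hzA
      have hs := (convex_segment p p₁).segment_subset hz' (right_mem_segment ℝ _ _)
      refine ⟨segment ℝ z p₁ ∪ A, Set.union_subset_union_left _ hs, .cons ?_ hA ?_⟩
      · rintro rfl; exact hzA hA.isArc.left_mem
      · refine Set.Subset.antisymm (hi ▸ Set.inter_subset_inter_left _ hs) ?_
        simpa using ⟨right_mem_segment ℝ z p₁, hA.isArc.left_mem⟩

lemma exists_first_mem_segment {A : Set (ℝ × ℝ)} (hA : IsClosed A) {c a : ℝ × ℝ} (ha : a ∈ A) :
    ∃ z ∈ A, segment ℝ c z ⊆ segment ℝ c a ∧ segment ℝ c z ∩ A = {z} := by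
  have hc : Continuous fun t : ℝ => c + t • (a - c) := by fun_prop
  have hcl : IsCompact (Set.Icc (0 : ℝ) 1 ∩ (fun t : ℝ => c + t • (a - c)) ⁻¹' A) :=
    isCompact_Icc.inter_right (hA.preimage hc)
  obtain ⟨s, ⟨hs, hsA⟩, hmin⟩ := hcl.exists_isLeast ⟨1, by simp, by simpa using ha⟩
  have hsub : segment ℝ c (c + s • (a - c)) = (fun t : ℝ => c + t • (a - c)) '' Set.Icc 0 s := by
    rw [segment_eq_image']
    ext z
    constructor
    · rintro ⟨t, ht, rfl⟩
      exact ⟨t * s, ⟨mul_nonneg ht.1 hs.1, mul_le_of_le_one_left hs.1 ht.2⟩, by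
        simp [mul_smul]⟩
    · rintro ⟨t, ht, rfl⟩
      rcases hs.1.eq_or_lt with h0 | h0
      · obtain rfl : t = 0 := le_antisymm (h0 ▸ ht.2) ht.1
        exact ⟨0, by simp, by simp⟩
      · refine ⟨t / s, ⟨div_nonneg ht.1 hs.1, div_le_one_of_le₀ ht.2 hs.1⟩, ?_⟩
        simp only [add_sub_cancel_left, smul_smul]
        rw [div_mul_cancel₀ _ h0.ne']
  refine ⟨c + s • (a - c), hsA, ?_, ?_⟩
  · rw [hsub, segment_eq_image']
    exact Set.image_mono (Set.Icc_subset_Icc_right hs.2)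
  · refine Set.Subset.antisymm ?_ (by simpa using ⟨right_mem_segment ℝ _ _, hsA⟩)
    rw [hsub]
    rintro _ ⟨⟨t, ht, rfl⟩, htA⟩
    have := hmin ⟨⟨ht.1, ht.2.trans hs.2⟩, htA⟩
    rw [Set.mem_singleton_iff, le_antisymm ht.2 this]

lemma SPoly.exists_of_chain {O : Set (ℝ × ℝ)} {p q : ℝ × ℝ}
    (h : Relation.ReflTransGen (fun a b => segment ℝ a b ⊆ O) p q) (hpq : p ≠ q) :
    ∃ A ⊆ O, SPoly A p q := by
  induction h using Relation.ReflTransGen.head_induction_on with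
  | refl => exact absurd rfl hpq
  | @head c a hca _ ih =>
    rcases eq_or_ne a q with rfl | haq
    · exact ⟨_, hca, .seg hpq⟩
    obtain ⟨A, hAO, hA⟩ := ih haq
    obtain ⟨z, hzA, hzs, hzi⟩ := exists_first_mem_segment hA.isArc.isCompact.isClosed (c := c)
      hA.isArc.left_mem
    rcases eq_or_ne z q with rfl | hzq
    · exact ⟨_, hzs.trans hca, .seg hpq⟩
    obtain ⟨A', hA', hP⟩ := hA.tail hzA hzq
    rcases eq_or_ne c z with rfl | hcz
    · exact ⟨A', hA'.trans hAO, hP⟩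
    refine ⟨_, Set.union_subset (hzs.trans hca) (hA'.trans hAO), .cons hcz hP ?_⟩
    exact Set.Subset.antisymm (hzi ▸ Set.inter_subset_inter_right _ hA')
      (by simpa using ⟨right_mem_segment ℝ c z, hP.isArc.left_mem⟩)

lemma exists_chain_of_isPreconnected {O S : Set (ℝ × ℝ)} (hO : IsOpen O) (hS : IsPreconnected S)
    (hSO : S ⊆ O) {a b : ℝ × ℝ} (ha : a ∈ S) (hb : b ∈ S) :
    Relation.ReflTransGen (fun a b => segment ℝ a b ⊆ O) a b := by
  refine hS.induction₂ (Relation.ReflTransGen (fun a b => segment ℝ a b ⊆ O)) ?_ ?_ ?_ ha hb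
  · intro x hx
    obtain ⟨ε, hε, hs⟩ := Metric.isOpen_iff.1 hO x (hSO hx)
    filter_upwards [mem_nhdsWithin_of_mem_nhds (Metric.ball_mem_nhds x hε)] with y hy
    exact .single (((convex_ball x ε).segment_subset (Metric.mem_ball_self hε) hy).trans hs)
  · exact fun x y z _ _ _ => Relation.ReflTransGen.trans
  · intro x y hx hy h
    clear hy
    induction h with
    | refl => exact .refl
    | tail _ hs ih => exact .head (by rwa [segment_symm]) ih

/-- The edge `xy` of an embedding can be redrawn as a polyline, after a change of the other arcs. -/
lemma IsEmb.exists_spoly {W : Type*} [Finite W] {H : SimpleGraph W} {pos : W → ℝ × ℝ}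
    {arc : Sym2 W → Set (ℝ × ℝ)} (h : IsEmb H pos arc) {x y : W} (hxy : H.Adj x y) :
    ∃ arc', IsEmb H pos arc' ∧ SPoly (arc' s(x, y)) (pos x) (pos y) := by
  classical
  obtain ⟨arc', h', hrad⟩ := h.exists_radial
  have hx : x ∈ H.support := ⟨y, hxy⟩
  have hy : y ∈ H.support := ⟨x, hxy.symm⟩
  set K : Set (ℝ × ℝ) := pos '' H.support ∪ ⋃ e ∈ H.edgeSet \ {s(x, y)}, arc' e with hK
  have hKc : IsClosed K := by
    refine ((Set.toFinite _).image _).isClosed.union ?_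
    exact (Set.toFinite _).isClosed_biUnion fun e he => (h'.isCompact_arc he.1).isClosed
  have hAK : ∀ z ∈ arc' s(x, y), z ∈ K → z = pos x ∨ z = pos y := by
    rintro z hz (⟨w, hw, rfl⟩ | hzK)
    · rcases Sym2.mem_iff.1 (h'.avoid hxy hw hz) with rfl | rfl <;> simp
    · simp only [Set.mem_iUnion] at hzK
      obtain ⟨e, he, hze⟩ := hzK
      obtain ⟨w, hw, -, rfl⟩ := h'.inter (e := s(x, y)) hxy he.1 (Ne.symm he.2) hz hze
      rcases Sym2.mem_iff.1 hw with rfl | rfl <;> simp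
  obtain ⟨a, hax, haK, has⟩ := hrad s(x, y) hxy x (Sym2.mem_mk_left _ _)
  obtain ⟨b, hby, hbK, hbs⟩ := hrad s(x, y) hxy y (Sym2.mem_mk_right _ _)
  have hne := (h'.isArc hxy).ne
  have hch : Relation.ReflTransGen (fun a b => segment ℝ a b ⊆ Kᶜ ∪ {pos x, pos y})
      (pos x) (pos y) := by
    have hsub : arc' s(x, y) ⊆ Kᶜ ∪ {pos x, pos y} := fun z hz => by
      by_cases hzK : z ∈ K
      · exact .inr (hAK z hz hzK)
      · exact .inl hzK
    have hmid := exists_chain_of_isPreconnected hKc.isOpen_compl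
      (h'.isArc hxy).isPreconnected_interior
      (fun z hz hzK => hz.2 (hAK z hz.1 hzK)) (a := a) (b := b)
      ⟨has (right_mem_segment ℝ _ _), by
        rintro (h1 | h1)
        · exact hax h1
        · exact haK ⟨y, hy, h1.symm⟩⟩
      ⟨hbs (right_mem_segment ℝ _ _), by
        rintro (h1 | h1)
        · exact hbK ⟨x, hx, h1.symm⟩
        · exact hby h1⟩
    refine .head (has.trans hsub) (.tail (b := b)
      (Relation.ReflTransGen.mono (fun p q hpq => ?_) a b hmid) ?_)
    · exact hpq.trans Set.subset_union_left
    · rw [segment_symm]; exact hbs.trans hsub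
  obtain ⟨A, hAO, hA⟩ := SPoly.exists_of_chain hch hne
  have hAK' : ∀ z ∈ A, z ∈ K → z = pos x ∨ z = pos y := fun z hz hzK =>
    (hAO hz).resolve_left fun h => h hzK
  have hup : ∀ e, e ≠ s(x, y) → Function.update arc' s(x, y) A e = arc' e :=
    fun e he => Function.update_of_ne he _ _
  have hAint : ∀ e ∈ H.edgeSet, e ≠ s(x, y) → ∀ p, p ∈ A → p ∈ arc' e →
      ∃ w, w ∈ s(x, y) ∧ w ∈ e ∧ p = pos w := by
    intro e he hne p hp hpe
    rcases hAK' p hp (.inr (Set.mem_biUnion (x := e) ⟨he, hne⟩ hpe)) with rfl | rfl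
    · exact ⟨x, by simp, h'.avoid he hx hpe, rfl⟩
    · exact ⟨y, by simp, h'.avoid he hy hpe, rfl⟩
  refine ⟨Function.update arc' s(x, y) A, ⟨h'.inj, ?_, ?_, ?_⟩, by simpa using hA⟩
  · intro c d hcd
    by_cases hc : s(c, d) = s(x, y)
    · rw [hc, Function.update_self]
      rcases Sym2.eq_iff.1 hc with ⟨rfl, rfl⟩ | ⟨rfl, rfl⟩
      · exact hA.isArc
      · exact hA.isArc.symm
    · rw [hup _ hc]; exact h'.isArc hcd
  · intro e he w hw hwe
    by_cases hc : e = s(x, y)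
    · subst hc
      rw [Function.update_self] at hwe
      rcases hAK' _ hwe (.inl ⟨w, hw, rfl⟩) with h1 | h1
      · rw [h'.inj hw hx h1]; simp
      · rw [h'.inj hw hy h1]; simp
    · rw [hup _ hc] at hwe; exact h'.avoid he hw hwe
  · intro e he e' he' hee p hp hp'
    by_cases hc : e = s(x, y)
    · subst hc
      rw [Function.update_self] at hp
      rw [hup _ hee.symm] at hp'
      exact hAint e' he' hee.symm p hp hp'
    · rw [hup _ hc] at hp
      by_cases hc' : e' = s(x, y)
      · subst hc'
        rw [Function.update_self] at hp'
        obtain ⟨w, h1, h2, h3⟩ := hAint e he hee p hp' hp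
        exact ⟨w, h2, h1, h3⟩
      · rw [hup _ hc'] at hp'
        exact h'.inter he he' hee hp hp'

lemma exists_affineEquiv_zero_one {p q : ℝ × ℝ} (h : p ≠ q) :
    ∃ e : (ℝ × ℝ) ≃ᵃ[ℝ] (ℝ × ℝ), e p = (1, 0) ∧ e q = 0 := by
  have hd : (p.1 - q.1) ^ 2 + (p.2 - q.2) ^ 2 ≠ 0 := by
    intro h0
    apply h
    ext <;> nlinarith [sq_nonneg (p.1 - q.1), sq_nonneg (p.2 - q.2)]
  set N := (p.1 - q.1) ^ 2 + (p.2 - q.2) ^ 2 with hN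
  let L : (ℝ × ℝ) ≃ₗ[ℝ] (ℝ × ℝ) :=
    { toFun := fun z => ((z.1 * (p.1 - q.1) + z.2 * (p.2 - q.2)) / N,
        (z.2 * (p.1 - q.1) - z.1 * (p.2 - q.2)) / N)
      map_add' := fun z w => by ext <;> simp <;> ring
      map_smul' := fun c z => by ext <;> simp <;> ring
      invFun := fun z => (z.1 * (p.1 - q.1) - z.2 * (p.2 - q.2),
        z.1 * (p.2 - q.2) + z.2 * (p.1 - q.1))
      left_inv := fun z => by ext <;> simp <;> field_simp <;> rw [hN] <;> ring
      right_inv := fun z => by ext <;> simp <;> field_simp <;> rw [hN] <;> ring }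
  refine ⟨(AffineEquiv.vaddConst ℝ q).symm.trans L.toAffineEquiv, ?_, ?_⟩
  · have h1 : (p.1 - q.1) * (p.1 - q.1) + (p.2 - q.2) * (p.2 - q.2) = N := by rw [hN]; ring
    simp [L, h1, hd]
    ring
  · simp

lemma exists_affineEquiv {p q p' q' : ℝ × ℝ} (h : p ≠ q) (h' : p' ≠ q') :
    ∃ e : (ℝ × ℝ) ≃ᵃ[ℝ] (ℝ × ℝ), e p = p' ∧ e q = q' := by
  obtain ⟨e, h1, h2⟩ := exists_affineEquiv_zero_one h
  obtain ⟨e', h3, h4⟩ := exists_affineEquiv_zero_one h'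
  exact ⟨e.trans e'.symm, by simp [h1, ← h3], by simp [h2, ← h4]⟩

/-- Collapse of the unit segment, moving only points of a thin kite. -/
noncomputable def collapse (δ η : ℝ) (z : ℝ × ℝ) : ℝ × ℝ :=
  (min z.1 (max (min 1 (|z.2| / η) + min 1 (|z.2| / η) * (z.1 - min 1 (|z.2| / η)))
    (z.1 + (z.1 - 1) / δ - 1 + min 1 (|z.2| / η))), z.2)

lemma continuous_collapse (δ η : ℝ) : Continuous (collapse δ η) := by
  unfold collapse; fun_prop

lemma mem_segment_zero_one {z : ℝ × ℝ} :
    z ∈ segment ℝ ((1 : ℝ), (0 : ℝ)) 0 ↔ z.2 = 0 ∧ 0 ≤ z.1 ∧ z.1 ≤ 1 := by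
  rw [segment_symm, segment_eq_image']
  constructor
  · rintro ⟨t, ht, rfl⟩; simpa using ht
  · rintro ⟨h, h1, h2⟩
    exact ⟨z.1, ⟨h1, h2⟩, by ext <;> simp [h]⟩

lemma collapse_eq_zero {δ η : ℝ} (hδ : 0 < δ) {z : ℝ × ℝ}
    (hz : z ∈ segment ℝ ((1 : ℝ), (0 : ℝ)) 0) : collapse δ η z = 0 := by
  obtain ⟨h, h0, h1⟩ := mem_segment_zero_one.1 hz
  have h2 : z.1 + (z.1 - 1) / δ - 1 ≤ 0 := by
    have : (z.1 - 1) / δ ≤ 0 := div_nonpos_of_nonpos_of_nonneg (by linarith) hδ.le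
    linarith
  ext
  · simp [collapse, h, h2, h0]
  · simp [collapse, h]

lemma collapse_inj {δ η : ℝ} (hδ : 0 < δ) (hη : 0 < η) {z z' : ℝ × ℝ}
    (h : collapse δ η z = collapse δ η z') : z = z' ∨
      z ∈ segment ℝ ((1 : ℝ), (0 : ℝ)) 0 ∧ z' ∈ segment ℝ ((1 : ℝ), (0 : ℝ)) 0 := by
  obtain ⟨x, y⟩ := z
  obtain ⟨x', y'⟩ := z'
  obtain rfl : y = y' := congrArg Prod.snd h
  have h1 := congrArg Prod.fst h
  simp only [collapse] at h1
  by_contra! hne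
  wlog hxx : x < x' generalizing x x'
  · refine this x' x h.symm h1.symm ⟨fun h => hne.1 h.symm, fun h3 h4 => hne.2 h4 h3⟩ ?_
    exact lt_of_le_of_ne (not_lt.1 hxx) fun h3 => hne.1 (by rw [h3])
  have hl0 : 0 ≤ min 1 (|y| / η) := le_min zero_le_one (by positivity)
  have hd : (x - 1) / δ < (x' - 1) / δ := div_lt_div_of_pos_right (by linarith) hδ
  rcases hl0.eq_or_lt with hl | hl
  · have hy : y = 0 := by
      by_contra hy
      have : 0 < min 1 (|y| / η) := lt_min one_pos (by positivity)
      exact this.ne hl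
    rw [← hl] at h1
    simp only [zero_mul, add_zero] at h1
    have hs : ¬ (0 ≤ x ∧ x' ≤ 1) := fun h3 => hne.2 (mem_segment_zero_one.2 ⟨hy, h3.1, by
      simp only; linarith⟩) (mem_segment_zero_one.2 ⟨hy, by simp only; linarith, h3.2⟩)
    have : min x (max 0 (x + (x - 1) / δ - 1)) < min x' (max 0 (x' + (x' - 1) / δ - 1)) := by
      by_cases hx : x < 0
      · refine (min_le_left _ _).trans_lt (lt_min hxx (lt_max_of_lt_left hx))
      · have hx' : 1 < x' := by by_contra! h4; exact hs ⟨not_lt.1 hx, h4⟩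
        have h5 : 0 < (x' - 1) / δ := div_pos (by linarith) hδ
        refine lt_min ((min_le_left _ _).trans_lt hxx) ?_
        refine (min_le_right _ _).trans_lt (max_lt (lt_max_of_lt_right ?_) (lt_max_of_lt_right ?_))
          <;> linarith
    exact this.ne h1
  · refine (min_lt_min hxx (max_lt_max ?_ ?_)).ne h1
    · have := mul_lt_mul_of_pos_left hxx hl
      linarith
    · linarith

lemma collapse_ne {δ η : ℝ} (hδ : 0 < δ) (hη : 0 < η) {z : ℝ × ℝ} (h : collapse δ η z ≠ z) :
    (|z.2| ≤ η * z.1 ∧ z.1 ≤ 1 + δ) ∧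
      |z.2| ≤ η * (collapse δ η z).1 ∧ (collapse δ η z).1 ≤ 1 + δ := by
  obtain ⟨x, y⟩ := z
  set l := min 1 (|y| / η) with hl
  have hl0 : 0 ≤ l := le_min zero_le_one (by positivity)
  have hc : (collapse δ η (x, y)).1 = min x (max (l + l * (x - l)) (x + (x - 1) / δ - 1 + l)) := rfl
  have hlt : max (l + l * (x - l)) (x + (x - 1) / δ - 1 + l) < x := by
    by_contra! h1
    apply h
    ext
    · rw [hc, min_eq_left h1]
    · rfl
  rw [min_eq_right hlt.le] at hc
  obtain ⟨h1, h2⟩ := max_lt_iff.1 hlt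
  have hl1 : l < 1 := by
    by_contra! h3
    have : l = 1 := le_antisymm (min_le_left _ _) h3
    rw [this] at h1; linarith
  have hlx : l < x := by nlinarith
  have hly : |y| = η * l := by
    have : l = |y| / η := by
      rcases min_choice 1 (|y| / η) with h3 | h3
      · exact absurd h3 hl1.ne
      · exact h3
    rw [this]; field_simp
  have hx : x ≤ 1 + δ := by
    have h3 : (x - 1) / δ < 1 := by linarith
    rw [div_lt_one hδ] at h3; linarith
  refine ⟨⟨?_, hx⟩, ?_, ?_⟩
  · simp only [hly]; exact mul_le_mul_of_nonneg_left hlx.le hη.le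
  · simp only [hly, hc]
    refine mul_le_mul_of_nonneg_left (le_max_of_le_left ?_) hη.le
    nlinarith
  · rw [hc]; exact hlt.le.trans hx

lemma exists_collapse_aux {w : ℝ × ℝ} {A : Set (ℝ × ℝ)} (hA : IsCompact A)
    (hd : Disjoint (segment ℝ ((1 : ℝ), (0 : ℝ)) 0) A)
    (hw : w.2 ≠ 0 ∨ w.1 < 0) :
    ∃ δ η : ℝ, 0 < δ ∧ 0 < η ∧ ∀ z ∈ segment ℝ 0 w ∪ A, |z.2| ≤ η * z.1 → z.1 ≤ 1 + δ → z = 0 := by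
  have hs : IsCompact (segment ℝ ((1 : ℝ), (0 : ℝ)) 0) := by
    rw [segment_eq_image']
    exact isCompact_Icc.image (by fun_prop)
  obtain ⟨ε, hε, hεd⟩ := hd.exists_thickenings hs hA.isClosed
  have key : ∀ δ η : ℝ, 0 < δ → 0 < η → δ < ε → 2 * η < ε → δ ≤ 1 → ∀ z ∈ A, |z.2| ≤ η * z.1 →
      z.1 ≤ 1 + δ → False := by
    intro δ η hδ hη h1 h2 h3 z hz h4 h5
    have hz0 : 0 ≤ z.1 := by
      by_contra! h6
      nlinarith [abs_nonneg z.2]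
    refine Set.disjoint_left.1 hεd (?_ : z ∈ _) (Metric.self_subset_thickening hε _ hz)
    refine Metric.mem_thickening_iff.2 ⟨(min z.1 1, 0), mem_segment_zero_one.2
      ⟨rfl, le_min hz0 zero_le_one, min_le_right _ _⟩, ?_⟩
    rw [Prod.dist_eq]
    refine max_lt ?_ ?_
    · rw [Real.dist_eq, abs_lt]
      rcases min_cases z.1 1 with h | h <;> simp only [h.1] <;> constructor <;> linarith
    · simp only [Real.dist_eq, sub_zero]
      nlinarith
  have hη : ∃ η > 0, 2 * η < ε ∧ (w.2 ≠ 0 → η * (1 + |w.1|) < |w.2|) := by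
    by_cases h0 : w.2 = 0
    · exact ⟨ε / 4, by positivity, by linarith, fun h => absurd h0 h⟩
    · have hw2 : 0 < |w.2| := abs_pos.2 h0
      refine ⟨min (ε / 4) (|w.2| / (2 * (1 + |w.1|))), by positivity,
        by linarith [min_le_left (ε / 4) (|w.2| / (2 * (1 + |w.1|)))], fun _ => ?_⟩
      calc _ ≤ |w.2| / (2 * (1 + |w.1|)) * (1 + |w.1|) := by gcongr; exact min_le_right _ _
        _ = |w.2| / 2 := by field_simp
        _ < |w.2| := by linarith
  obtain ⟨η, hη0, hη1, hη2⟩ := hη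
  refine ⟨min (ε / 2) 1, η, by positivity, hη0, ?_⟩
  rintro z (hz | hz) h1 h2
  · rw [segment_eq_image'] at hz
    obtain ⟨t, ht, rfl⟩ := hz
    rcases ht.1.eq_or_lt with rfl | h0
    · simp
    exfalso
    simp only [sub_zero, zero_add, Prod.smul_snd, Prod.smul_fst, smul_eq_mul, abs_mul,
      abs_of_pos h0] at h1
    have h3 : |w.2| ≤ η * w.1 := by
      have : t * |w.2| ≤ t * (η * w.1) := by linarith
      exact le_of_mul_le_mul_left this h0
    by_cases h4 : w.2 = 0
    · have h5 := hw.resolve_left (not_not.2 h4)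
      rw [h4, abs_zero] at h3
      nlinarith
    · have := hη2 h4
      nlinarith [le_abs_self w.1]
  · exact (key _ η (by positivity) hη0 ((min_le_left _ _).trans_lt (by linarith)) hη1
      (min_le_right _ _) z hz h1 h2).elim

lemma exists_collapse_std {w : ℝ × ℝ} {A : Set (ℝ × ℝ)} (hA : IsCompact A)
    (hd : Disjoint (segment ℝ ((1 : ℝ), (0 : ℝ)) 0) A) (hw : w.2 ≠ 0 ∨ w.1 < 0) :
    ∃ κ : ℝ × ℝ → ℝ × ℝ, Continuous κ ∧ κ (1, 0) = 0 ∧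
      (∀ z z', κ z = κ z' → z = z' ∨
        z ∈ segment ℝ ((1 : ℝ), (0 : ℝ)) 0 ∧ z' ∈ segment ℝ ((1 : ℝ), (0 : ℝ)) 0) ∧
      (∀ z ∈ segment ℝ 0 w ∪ A, κ z = z) ∧
      ∀ z, κ z ∈ segment ℝ 0 w ∪ A → z ∈ segment ℝ ((1 : ℝ), (0 : ℝ)) 0 ∨ κ z = z := by
  obtain ⟨δ, η, hδ, hη, hz⟩ := exists_collapse_aux hA hd hw
  have h0 : collapse δ η 0 = 0 := collapse_eq_zero hδ (right_mem_segment ℝ _ _)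
  refine ⟨collapse δ η, continuous_collapse δ η, collapse_eq_zero hδ (left_mem_segment ℝ _ _),
    fun z z' h => collapse_inj hδ hη h, fun z hzA => ?_, fun z hzA => ?_⟩
  · by_contra hne
    obtain ⟨⟨h1, h2⟩, -⟩ := collapse_ne hδ hη hne
    exact hne (by rw [hz z hzA h1 h2, h0])
  · refine or_iff_not_imp_right.2 fun hne => ?_
    obtain ⟨-, h1, h2⟩ := collapse_ne hδ hη hne
    have h3 := hz _ hzA h1 h2
    rcases collapse_inj hδ hη (h3.trans h0.symm) with h4 | h4
    · rw [h4]; exact right_mem_segment ℝ _ _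
    · exact h4.1

/-- The structure of a polyline near its start. -/
lemma SPoly.exists_head {A : Set (ℝ × ℝ)} {p q : ℝ × ℝ} (h : SPoly A p q) :
    ∃ b B, b ≠ p ∧ IsCompact B ∧ p ∉ B ∧ A = segment ℝ p b ∪ B := by
  cases h with
  | seg h => exact ⟨q, ∅, h.symm, isCompact_empty, by simp, by simp⟩
  | @cons _ p₁ _ A h hA hi =>
    refine ⟨p₁, A, h.symm, hA.isArc.isCompact, fun hp => h ?_, rfl⟩
    exact (hi ▸ ⟨left_mem_segment ℝ _ _, hp⟩ : p ∈ ({p₁} : Set _))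

lemma SPoly.exists_collapse {A : Set (ℝ × ℝ)} {p p₁ q : ℝ × ℝ} (hp : p ≠ p₁) (hA : SPoly A p₁ q)
    (hi : segment ℝ p p₁ ∩ A = {p₁}) :
    ∃ κ : ℝ × ℝ → ℝ × ℝ, Continuous κ ∧ κ p = p₁ ∧
      (∀ z z', κ z = κ z' → z = z' ∨ z ∈ segment ℝ p p₁ ∧ z' ∈ segment ℝ p p₁) ∧
      (∀ z ∈ A, κ z = z) ∧ ∀ z, κ z ∈ A → z ∈ segment ℝ p p₁ ∨ κ z = z := by
  obtain ⟨b, B, hb, hB, hpB, rfl⟩ := hA.exists_head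
  obtain ⟨e, he, he'⟩ := exists_affineEquiv_zero_one hp
  have hec : Continuous e := e.toAffineMap.continuous_of_finiteDimensional
  have hes : Continuous e.symm := e.symm.toAffineMap.continuous_of_finiteDimensional
  have him : ∀ a b z, e z ∈ segment ℝ (e a) (e b) ↔ z ∈ segment ℝ a b := by
    intro a b z
    have := image_segment ℝ e.toAffineMap a b
    simp only [AffineEquiv.coe_toAffineMap] at this
    rw [← this, e.injective.mem_set_image]
  have hseg : ∀ z, e z ∈ segment ℝ ((1 : ℝ), (0 : ℝ)) 0 ↔ z ∈ segment ℝ p p₁ := by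
    intro z; rw [← he, ← he', him]
  have hA' : ∀ z, e z ∈ segment ℝ 0 (e b) ∪ e '' B ↔ z ∈ segment ℝ p₁ b ∪ B := by
    intro z; rw [Set.mem_union, ← he', him, e.injective.mem_set_image]; rfl
  obtain ⟨κ, hκ, h0, h1, h2, h3⟩ := exists_collapse_std (w := e b) (A := e '' B) (hB.image hec)
    (by
      rw [Set.disjoint_left]
      rintro _ hz ⟨z, hzB, rfl⟩
      have h4 : z ∈ ({p₁} : Set _) := hi ▸ ⟨(hseg z).1 hz, .inr hzB⟩
      exact hpB (h4 ▸ hzB))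
    (by
      by_contra! hcon
      rcases le_or_gt (e b).1 1 with h4 | h4
      · have h5 : b ∈ ({p₁} : Set _) := hi ▸ ⟨(hseg b).1 (mem_segment_zero_one.2
          ⟨hcon.1, hcon.2, h4⟩), .inl (right_mem_segment ℝ _ _)⟩
        exact hb h5
      · have h5 : p ∈ ({p₁} : Set _) := by
          refine hi ▸ ⟨left_mem_segment ℝ _ _, .inl ((him p₁ b p).1 ?_)⟩
          rw [he, he', segment_eq_image']
          refine ⟨(e b).1⁻¹, ⟨by positivity, inv_le_one_of_one_le₀ h4.le⟩, ?_⟩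
          have : (e b).1 ≠ 0 := by positivity
          ext <;> simp [hcon.1, this]
        exact hp h5)
  refine ⟨fun z => e.symm (κ (e z)), by fun_prop, by simp [he, h0, ← he'], ?_, ?_, ?_⟩
  · intro z z' h
    rcases h1 _ _ (e.symm.injective h) with h | h
    · exact .inl (e.injective h)
    · exact .inr ⟨(hseg _).1 h.1, (hseg _).1 h.2⟩
  · intro z hz
    simp [h2 (e z) ((hA' z).2 hz)]
  · intro z hz
    rcases h3 (e z) (by simpa using (hA' _).2 hz) with h | h
    · exact .inl ((hseg _).1 h)
    · exact .inr (by simp [h])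

/-- The unit ball of `ℓ¹` is the diamond. -/
def diamond (z : ℝ × ℝ) : ℝ := |z.1| + |z.2|

/-- Opens the slit between `(-1, 0)` and `(1, 0)` to the diamond. -/
noncomputable def slit (z : ℝ × ℝ) : ℝ × ℝ :=
  if 0 ≤ z.2 then (z.1, z.2 + max 0 (1 - |z.1|)) else (z.1, z.2 - max 0 (1 - |z.1|))

lemma slit_injective : Function.Injective slit := by
  rintro ⟨x, y⟩ ⟨x', y'⟩ h
  simp only [slit] at h
  have hm : ∀ x : ℝ, 0 ≤ max 0 (1 - |x|) := fun x => le_max_left _ _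
  have := hm x
  have := hm x'
  split_ifs at h <;> simp only [Prod.mk.injEq] at h <;> obtain ⟨rfl, h⟩ := h <;> simp <;> linarith

lemma continuousOn_slit : ContinuousOn slit {z | z.2 = 0 → 1 ≤ |z.1|} := by
  refine ContinuousOn.if ?_ (by fun_prop) (by fun_prop)
  rintro z ⟨hz, hf⟩
  have h0 : 0 = z.2 := frontier_le_subset_eq continuous_const continuous_snd hf
  have : max 0 (1 - |z.1|) = 0 := max_eq_left (by linarith [hz h0.symm])
  simp [this]

lemma one_lt_diamond_slit {z : ℝ × ℝ} (hz : z.2 = 0 → 1 < |z.1|) : 1 < diamond (slit z) := by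
  have h1 := le_max_right 0 (1 - |z.1|)
  have h2 := le_max_left 0 (1 - |z.1|)
  have h3 : z.2 ≠ 0 → 1 < |z.1| + |z.2| + max 0 (1 - |z.1|) := fun h => by
    have := abs_pos.2 h; linarith
  have h4 : 1 < |z.1| + |z.2| + max 0 (1 - |z.1|) := by
    by_cases h : z.2 = 0
    · have := hz h; rw [h, abs_zero]; linarith
    · exact h3 h
  unfold slit diamond
  split_ifs with h
  · simp only
    rw [abs_of_nonneg h] at h4
    rw [abs_of_nonneg (by linarith : 0 ≤ z.2 + _)]; linarith
  · simp only
    rw [abs_of_neg (not_le.1 h)] at h4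
    rw [abs_of_neg (by linarith : z.2 - _ < 0)]; linarith

/-- The complement of a simple polyline embeds into the outside of the diamond. -/
lemma SPoly.exists_diamond {A : Set (ℝ × ℝ)} {p q : ℝ × ℝ} (h : SPoly A p q) {K : Set (ℝ × ℝ)}
    (hpK : p ∈ K) (hqK : q ∈ K) (hKA : ∀ z ∈ K, z ∈ A → z = p ∨ z = q) :
    ∃ φ : ℝ × ℝ → ℝ × ℝ, ContinuousOn φ K ∧ Set.InjOn φ K ∧ φ p = (1, 0) ∧ φ q = (-1, 0) ∧
      ∀ z ∈ K, z ≠ p → z ≠ q → 1 < diamond (φ z) := by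
  induction h generalizing K with
  | @seg p q hpq =>
    obtain ⟨e, he, he'⟩ := exists_affineEquiv (p' := (1, 0)) (q' := (-1, 0)) hpq
      (by simp; norm_num)
    have hec : Continuous e := e.toAffineMap.continuous_of_finiteDimensional
    have him : ∀ z, (e z).2 = 0 → |(e z).1| ≤ 1 → z ∈ segment ℝ p q := by
      intro z h1 h2
      have := image_segment ℝ e.toAffineMap p q
      simp only [AffineEquiv.coe_toAffineMap] at this
      rw [← e.injective.mem_set_image, this, he, he', segment_eq_image']
      rw [abs_le] at h2
      refine ⟨(1 - (e z).1) / 2, ⟨by linarith, by linarith⟩, ?_⟩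
      ext
      · simp; ring
      · simp [h1]
    have hK : ∀ z ∈ K, z ≠ p → z ≠ q → (e z).2 = 0 → 1 < |(e z).1| := by
      intro z hz h1 h2 h3
      by_contra! h4
      rcases hKA z hz (him z h3 h4) with h | h
      exacts [h1 h, h2 h]
    refine ⟨fun z => slit (e z), ?_, (slit_injective.comp e.injective).injOn, by simp [he, slit],
      by simp [he', slit], fun z hz h1 h2 => one_lt_diamond_slit (hK z hz h1 h2)⟩
    refine continuousOn_slit.comp hec.continuousOn fun z hz h3 => ?_
    by_cases h1 : z = p
    · simp [h1, he]
    by_cases h2 : z = q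
    · simp [h2, he']
    exact (hK z hz h1 h2 h3).le
  | @cons p p₁ q A hp hA hi ih =>
    obtain ⟨κ, hκ, h0, h1, h2, h3⟩ := SPoly.exists_collapse hp hA hi
    have hqA := hA.isArc.right_mem
    have hκq := h2 q hqA
    have hqs : q ∉ segment ℝ p p₁ := fun h =>
      hA.isArc.ne (hi ▸ ⟨h, hqA⟩ : q ∈ ({p₁} : Set _)).symm
    have hs : ∀ z ∈ K, z ∈ segment ℝ p p₁ → z = p := fun z hz hzs =>
      (hKA z hz (.inl hzs)).resolve_right fun h => hqs (h ▸ hzs)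
    have hinj : Set.InjOn κ K := by
      intro z hz z' hz' h
      rcases h1 z z' h with h | h
      · exact h
      · rw [hs z hz h.1, hs z' hz' h.2]
    obtain ⟨φ, hφ, hφi, hφp, hφq, hφK⟩ := ih (K := κ '' K) ⟨p, hpK, h0⟩ ⟨q, hqK, hκq⟩ (by
      rintro _ ⟨z, hz, rfl⟩ hzA
      rcases h3 z hzA with h | h
      · rw [hs z hz h]; exact .inl h0
      · rw [h] at hzA ⊢
        rcases hKA z hz (.inr hzA) with rfl | rfl
        · exact .inl (h.symm.trans h0)
        · exact .inr rfl)
    refine ⟨fun z => φ (κ z), hφ.comp hκ.continuousOn (Set.mapsTo_image _ _),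
      hφi.comp hinj (Set.mapsTo_image _ _), by simpa [h0], by simpa [hκq], ?_⟩
    intro z hz hzp hzq
    refine hφK _ ⟨z, hz, rfl⟩ (fun h => hzp ?_) (fun h => hzq ?_)
    · exact hinj hz hpK (h.trans h0.symm)
    · exact hinj hz hqK (h.trans hκq.symm)

section
variable {W : Type*} {H H₁ H₂ : SimpleGraph W} {pos pos₁ pos₂ : W → ℝ × ℝ}
  {arc arc₁ arc₂ : Sym2 W → Set (ℝ × ℝ)}

/-- The point set covered by an embedding. -/
def embImage (H : SimpleGraph W) (arc : Sym2 W → Set (ℝ × ℝ)) : Set (ℝ × ℝ) :=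
  {z | ∃ e ∈ H.edgeSet, z ∈ arc e}

lemma IsEmb.pos_mem_image (h : IsEmb H pos arc) {w : W} (hw : w ∈ H.support) :
    pos w ∈ embImage H arc := by
  obtain ⟨v, hv⟩ := hw
  exact ⟨s(w, v), hv, (h.isArc hv).left_mem⟩

lemma IsEmb.isCompact_image [Finite W] (h : IsEmb H pos arc) : IsCompact (embImage H arc) := by
  have : embImage H arc = ⋃ e ∈ H.edgeSet, arc e := by ext; simp [embImage]
  rw [this]
  exact (Set.toFinite _).isCompact_biUnion fun e he => h.isCompact_arc he

lemma IsEmb.mono (h : IsEmb H₁ pos arc) (hle : H₂ ≤ H₁) : IsEmb H₂ pos arc where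
  inj := h.inj.mono (SimpleGraph.support_mono hle)
  isArc _ _ hab := h.isArc (hle hab)
  avoid _ he _ hw := h.avoid (SimpleGraph.edgeSet_mono hle he) (SimpleGraph.support_mono hle hw)
  inter _ he _ he' := h.inter (SimpleGraph.edgeSet_mono hle he) (SimpleGraph.edgeSet_mono hle he')

lemma Planar.mono (h : Planar H₁) (hle : H₂ ≤ H₁) : Planar H₂ := by
  obtain ⟨pos, arc, h⟩ := h
  exact ⟨pos, arc, h.mono hle⟩

lemma IsEmb.map (h : IsEmb H pos arc) {φ : ℝ × ℝ → ℝ × ℝ}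
    (hc : ContinuousOn φ (embImage H arc)) (hi : Set.InjOn φ (embImage H arc)) :
    IsEmb H (φ ∘ pos) (fun e => φ '' arc e) := by
  have hsub : ∀ e ∈ H.edgeSet, arc e ⊆ embImage H arc := fun e he z hz => ⟨e, he, hz⟩
  refine ⟨hi.comp h.inj fun w hw => h.pos_mem_image hw, fun a b hab =>
    (h.isArc hab).image (hc.mono (hsub _ hab)) (hi.mono (hsub _ hab)), ?_, ?_⟩
  · rintro e he w hw ⟨z, hz, hzw⟩
    exact h.avoid he hw (hi (hsub e he hz) (h.pos_mem_image hw) hzw ▸ hz)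
  · rintro e he e' he' hne _ ⟨z, hz, rfl⟩ ⟨z', hz', hzz⟩
    obtain rfl := hi (hsub e' he' hz') (hsub e he hz) hzz
    obtain ⟨w, h1, h2, rfl⟩ := h.inter he he' hne hz hz'
    exact ⟨w, h1, h2, rfl⟩

open Classical in
lemma IsEmb.sup (h₁ : IsEmb H₁ pos₁ arc₁) (h₂ : IsEmb H₂ pos₂ arc₂)
    (hpos : ∀ w ∈ H₁.support, w ∈ H₂.support → pos₁ w = pos₂ w)
    (hcap : ∀ z ∈ embImage H₁ arc₁, z ∈ embImage H₂ arc₂ →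
      ∃ w ∈ H₁.support, w ∈ H₂.support ∧ z = pos₁ w) :
    IsEmb (H₁ ⊔ H₂) (fun w => if w ∈ H₁.support then pos₁ w else pos₂ w)
      (fun e => if e ∈ H₁.edgeSet then arc₁ e else arc₂ e) := by
  have hpos₁ : ∀ w ∈ H₁.support, (if w ∈ H₁.support then pos₁ w else pos₂ w) = pos₁ w :=
    fun w hw => if_pos hw
  have hpos₂ : ∀ w ∈ H₂.support, (if w ∈ H₁.support then pos₁ w else pos₂ w) = pos₂ w := by
    intro w hw
    split_ifs with h
    · exact hpos w h hw
    · rfl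
  have hmem : ∀ w ∈ (H₁ ⊔ H₂).support, w ∉ H₁.support → w ∈ H₂.support := by
    rintro w ⟨v, hv | hv⟩ hw
    · exact absurd ⟨v, hv⟩ hw
    · exact ⟨v, hv⟩
  have hvert : ∀ w ∈ H₂.support, pos₂ w ∈ embImage H₁ arc₁ → w ∈ H₁.support := by
    intro w hw hz
    obtain ⟨w', h1, h2, h3⟩ := hcap _ hz (h₂.pos_mem_image hw)
    rw [hpos w' h1 h2] at h3
    exact h₂.inj hw h2 h3 ▸ h1
  have hedge : ∀ e ∈ (H₁ ⊔ H₂).edgeSet, e ∉ H₁.edgeSet → e ∈ H₂.edgeSet := by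
    intro e he he'
    rw [SimpleGraph.edgeSet_sup] at he
    exact he.resolve_left he'
  have cross : ∀ e ∈ H₁.edgeSet, ∀ e' ∈ H₂.edgeSet, ∀ p ∈ arc₁ e, p ∈ arc₂ e' →
      ∃ w, w ∈ e ∧ w ∈ e' ∧ p = pos₁ w ∧ w ∈ H₁.support := by
    intro e he e' he' p hp hp'
    obtain ⟨w, h1, h2, rfl⟩ := hcap p ⟨e, he, hp⟩ ⟨e', he', hp'⟩
    exact ⟨w, h₁.avoid he h1 hp, h₂.avoid he' h2 (hpos w h1 h2 ▸ hp'), rfl, h1⟩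
  refine ⟨?_, ?_, ?_, ?_⟩
  · intro w hw w' hw' h
    simp only at h
    split_ifs at h with h1 h2 h2
    · exact h₁.inj h1 h2 h
    · exact absurd (hvert w' (hmem _ hw' h2) (h ▸ h₁.pos_mem_image h1)) h2
    · exact absurd (hvert w (hmem _ hw h1) (h ▸ h₁.pos_mem_image h2)) h1
    · exact h₂.inj (hmem _ hw h1) (hmem _ hw' h2) h
  · intro a b hab
    by_cases h : s(a, b) ∈ H₁.edgeSet
    · simp only [if_pos h, hpos₁ a ⟨b, h⟩, hpos₁ b ⟨a, SimpleGraph.Adj.symm h⟩]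
      exact h₁.isArc h
    · have h' : H₂.Adj a b := hedge _ hab h
      simp only [if_neg h, hpos₂ a ⟨b, h'⟩, hpos₂ b ⟨a, h'.symm⟩]
      exact h₂.isArc h'
  · intro e he w hw hz
    split_ifs at hz with h2 h1 h1
    · exact h₁.avoid h2 h1 hz
    · exact absurd (hvert w (hmem _ hw h1) ⟨e, h2, hz⟩) h1
    · have h3 := hedge _ he h2
      obtain ⟨w', h4, h5, h6⟩ := hcap _ (h₁.pos_mem_image h1) ⟨e, h3, hz⟩
      obtain rfl := h₁.inj h1 h4 h6
      exact h₂.avoid h3 h5 (hpos w h4 h5 ▸ hz)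
    · exact h₂.avoid (hedge _ he h2) (hmem _ hw h1) hz
  · intro e he e' he' hne p hp hp'
    split_ifs at hp hp' with h1 h2 h2
    · obtain ⟨w, h3, h4, rfl⟩ := h₁.inter h1 h2 hne hp hp'
      exact ⟨w, h3, h4, (hpos₁ w (mem_support_of_mem_edge h1 h3)).symm⟩
    · obtain ⟨w, h3, h4, rfl, h5⟩ := cross e h1 e' (hedge _ he' h2) p hp hp'
      exact ⟨w, h3, h4, (hpos₁ w h5).symm⟩
    · obtain ⟨w, h3, h4, rfl, h5⟩ := cross e' h2 e (hedge _ he h1) p hp' hp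
      exact ⟨w, h4, h3, (hpos₁ w h5).symm⟩
    · obtain ⟨w, h3, h4, rfl⟩ := h₂.inter (hedge _ he h1) (hedge _ he' h2) hne hp hp'
      exact ⟨w, h3, h4, (hpos₂ w (mem_support_of_mem_edge (hedge _ he h1) h3)).symm⟩

lemma isEmb_edge {u v : W} (huv : pos u ≠ pos v) :
    IsEmb (SimpleGraph.edge u v) pos (fun _ => segment ℝ (pos u) (pos v)) := by
  have hs : ∀ w ∈ (SimpleGraph.edge u v).support, w = u ∨ w = v := by
    intro w hw
    obtain ⟨x, hx⟩ := (SimpleGraph.mem_support _).1 hw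
    rw [SimpleGraph.edge_adj] at hx
    tauto
  have he : ∀ e ∈ (SimpleGraph.edge u v).edgeSet, e = s(u, v) := by
    intro e he
    induction e with | _ a b => ?_
    rw [SimpleGraph.mem_edgeSet, SimpleGraph.edge_adj] at he
    exact Sym2.eq_iff.2 he.1
  refine ⟨?_, ?_, ?_, ?_⟩
  · intro a ha b hb hab
    rcases hs a ha with rfl | rfl <;> rcases hs b hb with rfl | rfl
    exacts [rfl, absurd hab huv, absurd hab.symm huv, rfl]
  · intro a b hab
    rcases Sym2.eq_iff.1 (he _ hab) with ⟨rfl, rfl⟩ | ⟨rfl, rfl⟩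
    · exact isArc_segment huv
    · exact (isArc_segment huv).symm
  · intro e hee w hw _
    rw [he e hee]
    exact Sym2.mem_iff.2 (hs w hw)
  · intro e h1 e' h2 hne
    exact absurd ((he e h1).trans (he e' h2).symm) hne

lemma planar_edge (u v : W) : Planar (SimpleGraph.edge u v) := by
  classical
  by_cases h : u = v
  · subst h
    exact ⟨fun _ => 0, fun _ => ∅, by simp [Set.InjOn], by simp, by simp, by simp⟩
  · exact ⟨fun w => if w = u then 0 else (1, 0), _, isEmb_edge (by simp [Ne.symm h, Prod.ext_iff])⟩

/-- Disjoint unions of planar graphs are planar. -/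
lemma Planar.sup_of_disjoint [Finite W] (h₁ : Planar H₁) (h₂ : Planar H₂)
    (hd : Disjoint H₁.support H₂.support) : Planar (H₁ ⊔ H₂) := by
  obtain ⟨pos₁, arc₁, h₁⟩ := h₁
  obtain ⟨pos₂, arc₂, h₂⟩ := h₂
  obtain ⟨r, hr⟩ := h₁.isCompact_image.isBounded.subset_closedBall 0
  obtain ⟨r', hr'⟩ := h₂.isCompact_image.isBounded.subset_closedBall 0
  have h₃ := h₂.map (φ := fun z => z + (|r| + |r'| + 1, 0)) (by fun_prop)
    (fun _ _ _ _ h => add_right_cancel h)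
  refine ⟨_, _, h₁.sup h₃ (fun w h1 h2 => absurd h2 (Set.disjoint_left.1 hd h1)) ?_⟩
  rintro z hz ⟨e, he, z', hz', rfl⟩
  exfalso
  have e1 := mem_closedBall_zero_iff.1 (hr hz)
  have e2 := mem_closedBall_zero_iff.1 (hr' ⟨e, he, hz'⟩)
  have e3 := (norm_fst_le _).trans e1
  have e4 := (norm_fst_le _).trans e2
  simp only [Prod.fst_add, Real.norm_eq_abs] at e3 e4
  have := neg_abs_le z'.1
  have := le_abs_self (z'.1 + (|r| + |r'| + 1))
  linarith [le_abs_self r, le_abs_self r']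

/-- An embedding outside the diamond, except for one edge, which is its horizontal diagonal. -/
lemma Planar.exists_diamond [Finite W] (h : Planar H) {x y : W} (hxy : H.Adj x y) :
    ∃ pos arc, IsEmb H pos arc ∧ pos x = (1, 0) ∧ pos y = (-1, 0) ∧
      arc s(x, y) = segment ℝ (1, 0) (-1, 0) ∧
      ∀ e ∈ H.edgeSet, e ≠ s(x, y) → ∀ z ∈ arc e, z = (1, 0) ∨ z = (-1, 0) ∨ 1 < diamond z := by
  classical
  obtain ⟨pos, arc, h⟩ := h
  obtain ⟨arc', h', hA⟩ := h.exists_spoly hxy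
  have hdel : ∀ e, e ∈ (H.deleteEdges {s(x, y)}).edgeSet ↔ e ∈ H.edgeSet ∧ e ≠ s(x, y) := by
    intro e; simp [SimpleGraph.edgeSet_deleteEdges]
  have hx : x ∈ H.support := ⟨y, hxy⟩
  have hy : y ∈ H.support := ⟨x, hxy.symm⟩
  set K : Set (ℝ × ℝ) := embImage (H.deleteEdges {s(x, y)}) arc' ∪ {pos x, pos y} with hK
  obtain ⟨φ, hc, hi, hpx, hpy, hφ⟩ := hA.exists_diamond (K := K) (by simp [hK]) (by simp [hK]) (by
    rintro z (⟨e, he, hz⟩ | hz) hzA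
    · rw [hdel] at he
      obtain ⟨w, hw, -, rfl⟩ := h'.inter (e := s(x, y)) hxy he.1 he.2.symm hzA hz
      rcases Sym2.mem_iff.1 hw with rfl | rfl <;> simp
    · simpa using hz)
  have hsub : embImage (H.deleteEdges {s(x, y)}) arc' ⊆ K := Set.subset_union_left
  have h2 := (h'.mono (SimpleGraph.deleteEdges_le {s(x, y)})).map (hc.mono hsub) (hi.mono hsub)
  have h1 := isEmb_edge (pos := φ ∘ pos) (u := x) (v := y) (by simp [hpx, hpy]; norm_num)
  have hn : ∀ z, z = (1, 0) ∨ z = (-1, 0) ∨ 1 < diamond z →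
    z ∈ segment ℝ ((1 : ℝ), (0 : ℝ)) (-1, 0) →
      z = (1, 0) ∨ z = (-1, 0) := by
    intro z hz hs
    rw [segment_eq_image'] at hs
    obtain ⟨t, ht, rfl⟩ := hs
    rcases hz with h | h | h
    · exact .inl h
    · exact .inr h
    · simp only [diamond, Prod.fst_add, Prod.smul_fst, Prod.snd_add, Prod.smul_snd, Prod.fst_sub,
        Prod.snd_sub, smul_eq_mul] at h
      have : |1 + t * (-1 - 1)| ≤ 1 := abs_le.2 ⟨by linarith [ht.2], by linarith [ht.1]⟩
      norm_num at h this
      linarith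
  have hKn : ∀ z ∈ K, φ z = (1, 0) ∨ φ z = (-1, 0) ∨ 1 < diamond (φ z) := by
    intro z hz
    by_cases h3 : z = pos x
    · simp [h3, hpx]
    by_cases h4 : z = pos y
    · simp [h4, hpy]
    exact .inr (.inr (hφ z hz h3 h4))
  have hsx : ∀ e ∈ (H.deleteEdges {s(x, y)}).edgeSet, ∀ z ∈ arc' e, ∀ w ∈ H.support,
      φ z = φ (pos w) → pos w ∈ K → w ∈ e := by
    intro e he z hz w hw hzw hwK
    have := hi (hsub ⟨e, he, hz⟩) hwK hzw
    exact h'.avoid ((hdel _).1 he).1 hw (this ▸ hz)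
  have key := h1.sup h2 (fun w _ _ => rfl) (by
    rintro z ⟨e, he, hz⟩ ⟨e', he', z', hz', rfl⟩
    simp only [Function.comp, hpx, hpy] at hz
    rcases hn _ (hKn z' (hsub ⟨e', he', hz'⟩)) hz with h3 | h3
    · exact ⟨x, ⟨y, by simp [SimpleGraph.edge_adj, hxy.ne]⟩, mem_support_of_mem_edge he'
        (hsx e' he' z' hz' x hx (h3.trans hpx.symm) (by simp [hK])), h3.trans hpx.symm⟩
    · exact ⟨y, ⟨x, by simp [SimpleGraph.edge_adj, hxy.ne']⟩, mem_support_of_mem_edge he'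
        (hsx e' he' z' hz' y hy (h3.trans hpy.symm) (by simp [hK])), h3.trans hpy.symm⟩)
  have hle : H ≤ SimpleGraph.edge x y ⊔ H.deleteEdges {s(x, y)} := by
    intro a b hab
    simp only [SimpleGraph.sup_adj, SimpleGraph.edge_adj, SimpleGraph.deleteEdges_adj,
      Set.mem_singleton_iff, Sym2.eq_iff]
    have := hab.ne
    tauto
  have hxe : s(x, y) ∈ (SimpleGraph.edge x y).edgeSet := by
    simp [hxy.ne]
  refine ⟨_, _, key.mono hle, ?_, ?_, ?_, ?_⟩
  · simp [hpx]
  · simp [hpy]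
  · simp only [if_pos hxe, Function.comp, hpx, hpy]
  · intro e he hne z hz
    have : e ∉ (SimpleGraph.edge x y).edgeSet := by
      intro h3
      induction e with | _ a b => ?_
      rw [SimpleGraph.mem_edgeSet, SimpleGraph.edge_adj] at h3
      exact hne (Sym2.eq_iff.2 h3.1)
    simp only [if_neg this] at hz
    obtain ⟨z', hz', rfl⟩ := hz
    exact hKn z' (hsub ⟨e, (hdel _).2 ⟨he, hne⟩, hz'⟩)

end

lemma continuous_diamond : Continuous diamond := by unfold diamond; fun_prop

lemma diamond_smul {c : ℝ} (hc : 0 ≤ c) (z : ℝ × ℝ) : diamond (c • z) = c * diamond z := by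
  simp [diamond, abs_mul, abs_of_nonneg hc, mul_add]

lemma diamond_one : diamond (1, 0) = 1 := by simp [diamond]

lemma diamond_neg_one : diamond (-1, 0) = 1 := by simp [diamond]

lemma one_le_diamond {z : ℝ × ℝ} (h : z = (1, 0) ∨ z = (-1, 0) ∨ 1 < diamond z) :
    1 ≤ diamond z := by
  rcases h with rfl | rfl | h
  · exact diamond_one.ge
  · exact diamond_neg_one.ge
  · exact h.le

/-- Collapses the diamond to a point. -/
noncomputable def pinch (z : ℝ × ℝ) : ℝ × ℝ := (1 - (diamond z)⁻¹) • z

lemma continuousOn_pinch : ContinuousOn pinch {z | 1 ≤ diamond z} := by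
  unfold pinch
  refine ContinuousOn.smul (continuousOn_const.sub (continuous_diamond.continuousOn.inv₀ ?_))
    continuousOn_id
  intro z hz
  have : 1 ≤ diamond z := hz
  positivity

lemma diamond_pinch {z : ℝ × ℝ} (hz : 1 ≤ diamond z) : diamond (pinch z) = diamond z - 1 := by
  have h0 : 0 < diamond z := by linarith
  rw [pinch, diamond_smul (sub_nonneg.2 (inv_le_one_of_one_le₀ hz)), sub_mul, one_mul,
    inv_mul_cancel₀ h0.ne']

lemma pinch_eq {z z' : ℝ × ℝ} (hz : 1 < diamond z) (hz' : 1 ≤ diamond z')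
    (h : pinch z = pinch z') : z = z' := by
  have h1 := congrArg diamond h
  rw [diamond_pinch hz.le, diamond_pinch hz', sub_left_inj] at h1
  rw [pinch, pinch, h1] at h
  refine smul_right_injective _ (sub_ne_zero.2 fun h2 => ?_) h
  rw [← h1, eq_comm, inv_eq_one] at h2
  exact hz.ne' h2

lemma pinch_one : pinch (1, 0) = 0 := by simp [pinch, diamond_one]

lemma pinch_neg_one : pinch (-1, 0) = 0 := by simp [pinch, diamond_neg_one]

section
variable {W : Type*} {H H₁ H₂ : SimpleGraph W}

/-- Contracting an edge preserves planarity. -/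
lemma Planar.contract [Finite W] (h : Planar H) {x y : W} (hxy : H.Adj x y) {H' : SimpleGraph W}
    {f : W → W} (hfy : f y = x) (hf : ∀ w, w ≠ y → f w = w)
    (hH : ∀ ⦃a b⦄, H'.Adj a b → ∃ a' b', H.Adj a' b' ∧ f a' = a ∧ f b' = b) : Planar H' := by
  classical
  obtain ⟨pos, arc, h, hpx, hpy, -, hout⟩ := h.exists_diamond hxy
  have hg : ∀ e : Sym2 W, ∃ e', e ∈ H'.edgeSet → e' ∈ H.edgeSet ∧ e'.map f = e := by
    intro e
    induction e with | _ a b => ?_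
    by_cases hab : H'.Adj a b
    · obtain ⟨a', b', h1, rfl, rfl⟩ := hH hab
      exact ⟨s(a', b'), fun _ => ⟨h1, rfl⟩⟩
    · exact ⟨s(a, b), fun h1 => absurd h1 hab⟩
  choose g hg using hg
  have hfx : f x = x := hf x hxy.ne
  have hpf : ∀ w, pinch (pos (f w)) = pinch (pos w) := by
    intro w
    by_cases hw : w = y
    · rw [hw, hfy, hpx, hpy, pinch_one, pinch_neg_one]
    · rw [hf w hw]
  have hne : ∀ e ∈ H'.edgeSet, g e ≠ s(x, y) := by
    intro e he h1
    have h2 := (hg e he).2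
    rw [h1, Sym2.map_mk, hfx, hfy] at h2
    exact H'.not_isDiag_of_mem_edgeSet he (h2 ▸ rfl)
  have hx : x ∈ H.support := ⟨y, hxy⟩
  have hy : y ∈ H.support := ⟨x, hxy.symm⟩
  have hK : ∀ e ∈ H'.edgeSet, ∀ z ∈ arc (g e), z = (1, 0) ∨ z = (-1, 0) ∨ 1 < diamond z :=
    fun e he => hout _ (hg e he).1 (hne e he)
  have hmap : ∀ e ∈ H'.edgeSet, ∀ w ∈ g e, f w ∈ e := by
    intro e he w hw
    rw [← (hg e he).2]
    exact Sym2.mem_map.2 ⟨w, hw, rfl⟩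
  have hxe : ∀ e ∈ H'.edgeSet, ∀ z ∈ arc (g e), z = (1, 0) ∨ z = (-1, 0) → x ∈ e := by
    rintro e he z hz (rfl | rfl)
    · have := hmap e he x (h.avoid (hg e he).1 hx (hpx ▸ hz))
      rwa [hfx] at this
    · have := hmap e he y (h.avoid (hg e he).1 hy (hpy ▸ hz))
      rwa [hfy] at this
  have hpe : ∀ z z', (z = (1, 0) ∨ z = (-1, 0) ∨ 1 < diamond z) →
      (z' = (1, 0) ∨ z' = (-1, 0) ∨ 1 < diamond z') → pinch z = pinch z' →
      z = z' ∨ (z = (1, 0) ∨ z = (-1, 0)) ∧ (z' = (1, 0) ∨ z' = (-1, 0)) := by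
    intro z z' hz hz' h1
    by_cases h2 : 1 < diamond z
    · exact .inl (pinch_eq h2 (one_le_diamond hz') h1)
    by_cases h3 : 1 < diamond z'
    · exact .inl (pinch_eq h3 (one_le_diamond hz) h1.symm).symm
    tauto
  have hsupp : ∀ w ∈ H'.support, ∃ w' e, f w' = w ∧ w' ∈ g e ∧ e ∈ H'.edgeSet := by
    intro w hw
    obtain ⟨v, hv⟩ := (SimpleGraph.mem_support _).1 hw
    have h1 : w ∈ (g s(w, v)).map f := by rw [(hg s(w, v) hv).2]; simp
    obtain ⟨w', h2, h3⟩ := Sym2.mem_map.1 h1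
    exact ⟨w', _, h3, h2, hv⟩
  have hposx : ∀ w' ∈ H.support, pos w' = (1, 0) ∨ pos w' = (-1, 0) → f w' = x := by
    rintro w' hw' (h1 | h1)
    · rw [h.inj hw' hx (h1.trans hpx.symm), hfx]
    · rw [h.inj hw' hy (h1.trans hpy.symm), hfy]
  refine ⟨fun w => pinch (pos w), fun e => pinch '' arc (g e), ?_, ?_, ?_, ?_⟩
  · intro w hw v hv hwv
    obtain ⟨w', e, rfl, hw', he⟩ := hsupp w hw
    obtain ⟨v', e', rfl, hv', he'⟩ := hsupp v hv
    simp only [hpf] at hwv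
    have hws := mem_support_of_mem_edge (hg e he).1 hw'
    have hvs := mem_support_of_mem_edge (hg e' he').1 hv'
    rcases hpe _ _ (hK e he _ (h.pos_mem (hg e he).1 hw'))
      (hK e' he' _ (h.pos_mem (hg e' he').1 hv')) hwv with h1 | h1
    · rw [h.inj hws hvs h1]
    · rw [hposx _ hws h1.1, hposx _ hvs h1.2]
  · intro a b hab
    have hab' : s(a, b) ∈ H'.edgeSet := hab
    obtain ⟨h1, h2⟩ := hg _ hab'
    have key : ∀ a' b', g s(a, b) = s(a', b') → f a' = a → f b' = b →
        IsArc (pinch '' arc (g s(a, b))) (pinch (pos a)) (pinch (pos b)) := by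
      rintro a' b' h3 rfl rfl
      rw [hpf, hpf]
      have hadj : H.Adj a' b' := by rw [h3] at h1; exact h1
      rw [h3]
      have h4 : ∀ z ∈ arc s(a', b'), z = (1, 0) ∨ z = (-1, 0) ∨ 1 < diamond z := by
        rw [← h3]; exact hK _ hab'
      refine (h.isArc hadj).image (continuousOn_pinch.mono fun z hz => one_le_diamond (h4 z hz)) ?_
      intro z hz z' hz' hzz
      rcases hpe _ _ (h4 z hz) (h4 z' hz') hzz with h5 | ⟨h5, h6⟩
      · exact h5
      · have h7 : ¬(x ∈ s(a', b') ∧ y ∈ s(a', b')) := fun h8 =>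
          hne _ hab' (h3.trans ((Sym2.mem_and_mem_iff hxy.ne).1 h8))
        rcases h5 with rfl | rfl <;> rcases h6 with rfl | rfl
        · rfl
        · exact absurd ⟨h.avoid hadj hx (hpx ▸ hz), h.avoid hadj hy (hpy ▸ hz')⟩ h7
        · exact absurd ⟨h.avoid hadj hx (hpx ▸ hz'), h.avoid hadj hy (hpy ▸ hz)⟩ h7
        · rfl
    generalize hge : g s(a, b) = ge at *
    induction ge with | _ a' b' => ?_
    rw [Sym2.map_mk, Sym2.eq_iff] at h2
    rcases h2 with ⟨h2, h3⟩ | ⟨h2, h3⟩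
    · exact key a' b' rfl h2 h3
    · exact key b' a' Sym2.eq_swap h3 h2
  · rintro e he w hw ⟨z, hz, hzw⟩
    obtain ⟨w', e', rfl, hw', he'⟩ := hsupp w hw
    simp only [hpf] at hzw
    have hws := mem_support_of_mem_edge (hg e' he').1 hw'
    rcases hpe _ _ (hK e he z hz) (hK e' he' _ (h.pos_mem (hg e' he').1 hw')) hzw with h1 | h1
    · exact hmap e he w' (h.avoid (hg e he).1 hws (h1 ▸ hz))
    · rw [hposx _ hws h1.2]
      exact hxe e he z hz h1.1
  · rintro e he e' he' hee _ ⟨z, hz, rfl⟩ ⟨z', hz', hzz⟩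
    rcases hpe _ _ (hK e he z hz) (hK e' he' z' hz') hzz.symm with rfl | h1
    · have h2 : g e ≠ g e' := fun h3 => hee (by rw [← (hg e he).2, h3, (hg e' he').2])
      obtain ⟨w, h3, h4, rfl⟩ := h.inter (hg e he).1 (hg e' he').1 h2 hz hz'
      exact ⟨f w, hmap e he w h3, hmap e' he' w h4, (hpf w).symm⟩
    · refine ⟨x, hxe e he z hz h1.1, hxe e' he' z' hz' h1.2, ?_⟩
      rcases h1.1 with rfl | rfl <;> simp [pinch_one, pinch_neg_one, hpx]

lemma planar_bot : Planar (⊥ : SimpleGraph W) :=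
  ⟨fun _ => 0, fun _ => ∅, by simp [Set.InjOn], by simp, by simp, by simp⟩

/-- Minors of planar graphs are planar: `f` sends the vertices of a branch set to the vertex it
represents, and deleted vertices to `none`. -/
lemma Planar.minor [Finite W] {W' : Type*} {H' : SimpleGraph W'} (h : Planar H)
    (f : W → Option W')
    (hconn : ∀ c, (H.induce {w | f w = some c}).Preconnected)
    (hadj : ∀ ⦃a b⦄, H'.Adj a b → ∃ a' b', H.Adj a' b' ∧ f a' = some a ∧ f b' = some b) :
    Planar H' := by
  classical
  rcases isEmpty_or_nonempty W with hW | hW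
  · have hbot : H' = ⊥ := by
      ext a b
      simp only [SimpleGraph.bot_adj, iff_false]
      exact fun hab => hW.elim (hadj hab).choose
    subst hbot
    exact planar_bot
  induction hn : {w | f w ≠ none}.ncard using Nat.strong_induction_on generalizing H f with
  | _ n ih => ?_
  by_cases hinj : ∀ x y c, f x = some c → f y = some c → x = y
  · obtain ⟨pos, arc, h⟩ := h
    have hsupp : ∀ w, ∃ v, w ∈ H'.support → f v = some w ∧ v ∈ H.support := by
      intro w
      by_cases hw : w ∈ H'.support
      · obtain ⟨u, hu⟩ := (SimpleGraph.mem_support _).1 hw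
        obtain ⟨a', b', h1, h2, h3⟩ := hadj hu
        exact ⟨a', fun _ => ⟨h2, b', h1⟩⟩
      · exact ⟨Classical.arbitrary W, fun h1 => absurd h1 hw⟩
    choose g hg using hsupp
    have hedge : ∀ ⦃a b⦄, H'.Adj a b → H.Adj (g a) (g b) := by
      intro a b hab
      obtain ⟨a', b', h1, h2, h3⟩ := hadj hab
      rw [hinj _ _ _ (hg a ⟨b, hab⟩).1 h2, hinj _ _ _ (hg b ⟨a, hab.symm⟩).1 h3]
      exact h1
    have hmapE : ∀ e ∈ H'.edgeSet, e.map g ∈ H.edgeSet := by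
      intro e he
      induction e with | _ a b => exact hedge he
    have hginj : ∀ a ∈ H'.support, ∀ b ∈ H'.support, g a = g b → a = b := by
      intro a ha b hb hab
      have := (hg a ha).1
      rw [hab, (hg b hb).1] at this
      exact (Option.some_injective _ this).symm
    have hmem : ∀ e ∈ H'.edgeSet, ∀ w ∈ H'.support, g w ∈ e.map g → w ∈ e := by
      intro e he w hw hwe
      obtain ⟨v, hv, hvw⟩ := Sym2.mem_map.1 hwe
      exact hginj v (mem_support_of_mem_edge he hv) w hw hvw ▸ hv
    refine ⟨fun w => pos (g w), fun e => arc (e.map g), ?_, ?_, ?_, ?_⟩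
    · intro a ha b hb hab
      exact hginj a ha b hb (h.inj (hg a ha).2 (hg b hb).2 hab)
    · intro a b hab
      exact h.isArc (hedge hab)
    · intro e he w hw hz
      exact hmem e he w hw (h.avoid (hmapE e he) (hg w hw).2 hz)
    · intro e he e' he' hne p hp hp'
      have h1 : e.map g ≠ e'.map g := by
        intro h2
        apply hne
        have key : ∀ e ∈ H'.edgeSet, ∀ e' ∈ H'.edgeSet, e.map g = e'.map g → ∀ w ∈ e, w ∈ e' := by
          intro e he e' he' h2 w hw
          exact hmem e' he' w (mem_support_of_mem_edge he hw) (h2 ▸ Sym2.mem_map.2 ⟨w, hw, rfl⟩)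
        exact Sym2.ext fun w => ⟨key e he e' he' h2 w, key e' he' e he h2.symm w⟩
      obtain ⟨w, h3, h4, rfl⟩ := h.inter (hmapE e he) (hmapE e' he') h1 hp hp'
      obtain ⟨v, hv, rfl⟩ := Sym2.mem_map.1 h3
      exact ⟨v, hv, hmem e' he' v (mem_support_of_mem_edge he hv) h4, rfl⟩
  · push Not at hinj
    obtain ⟨x, z, c, hx, hz, hxz⟩ := hinj
    obtain ⟨y, hy, hxy⟩ : ∃ y, f y = some c ∧ H.Adj x y := by
      obtain ⟨p⟩ := hconn c ⟨x, hx⟩ ⟨z, hz⟩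
      cases p with
      | nil => exact absurd rfl hxz
      | @cons _ v _ hv p => exact ⟨v.1, v.2, hv⟩
    set r : W → W := fun w => if w = y then x else w with hr
    have hry : r y = x := by simp [hr]
    have hrw : ∀ w, w ≠ y → r w = w := fun w hw => by simp [hr, hw]
    set H₁ : SimpleGraph W := SimpleGraph.fromRel fun a b => ∃ a' b', H.Adj a' b' ∧ r a' = a ∧
      r b' = b
      with hH₁
    have hH₁a : ∀ a b, H₁.Adj a b ↔ a ≠ b ∧ ∃ a' b', H.Adj a' b' ∧ r a' = a ∧ r b' = b := by
      intro a b
      rw [hH₁, SimpleGraph.fromRel_adj]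
      refine and_congr_right fun _ => ⟨?_, .inl⟩
      rintro (h1 | ⟨a', b', h1, h2, h3⟩)
      exacts [h1, ⟨b', a', h1.symm, h3, h2⟩]
    have hplan : Planar H₁ := h.contract hxy hry hrw fun a b hab => ((hH₁a a b).1 hab).2
    set f₁ : W → Option W' := fun w => if w = y then none else f w with hf₁
    have hfr : ∀ w c', f w = some c' → f₁ (r w) = some c' := by
      intro w c' hw
      by_cases hwy : w = y
      · subst hwy
        rw [hry, hf₁]
        simp only [if_neg hxy.ne]
        rw [hx, ← hy, hw]
      · rw [hrw w hwy, hf₁]; simpa [hwy] using hw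
    have hf₁f : ∀ w c', f₁ w = some c' → w ≠ y ∧ f w = some c' := by
      intro w c' hw
      rw [hf₁] at hw
      by_cases hwy : w = y
      · simp [hwy] at hw
      · simpa [hwy] using hw
    refine ih _ ?_ hplan f₁ ?_ ?_ rfl
    · rw [← hn]
      refine Set.ncard_lt_ncard ⟨fun w hw => ?_, fun hsub => ?_⟩ (Set.toFinite _)
      · simp only [Set.mem_ofPred_eq, hf₁] at hw ⊢
        by_cases hwy : w = y
        · simp [hwy] at hw
        · simpa [hwy] using hw
      · have : f₁ y ≠ none := hsub (show f y ≠ none by simp [hy])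
        simp [hf₁] at this
    · rintro c' ⟨a, ha⟩ ⟨b, hb⟩
      obtain ⟨p⟩ := hconn c' ⟨a, (hf₁f a c' ha).2⟩ ⟨b, (hf₁f b c' hb).2⟩
      have key : ∀ a b : {w | f w = some c'}, (H.induce {w | f w = some c'}).Walk a b →
          (H₁.induce {w | f₁ w = some c'}).Reachable ⟨r a, hfr a c' a.2⟩ ⟨r b, hfr b c' b.2⟩ := by
        intro a b p
        induction p with
        | nil => exact .rfl
        | @cons u v w huv p ih' =>
          refine .trans ?_ ih'
          by_cases h1 : r u = r v
          · have : (⟨r u, hfr u c' u.2⟩ : {w | f₁ w = some c'}) = ⟨r v, hfr v c' v.2⟩ :=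
              Subtype.ext h1
            rw [this]
          · refine SimpleGraph.Adj.reachable ?_
            exact (hH₁a _ _).2 ⟨h1, u, v, huv, rfl, rfl⟩
      have := key _ _ p
      simpa only [hrw a (hf₁f a c' ha).1, hrw b (hf₁f b c' hb).1] using this
    · intro a b hab
      obtain ⟨a', b', h1, h2, h3⟩ := hadj hab
      refine ⟨r a', r b', (hH₁a _ _).2 ⟨fun h4 => ?_, a', b', h1, rfl, rfl⟩, hfr _ _ h2, hfr _ _ h3⟩
      have h5 := hfr _ _ h2
      rw [h4, hfr _ _ h3] at h5
      exact hab.ne (Option.some_injective _ h5).symm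

end

/-- Maps the outside of the diamond to its upper half. -/
noncomputable def foldIn (z : ℝ × ℝ) : ℝ × ℝ :=
  (z.1 / diamond z ^ 2, (z.2 / diamond z ^ 2 + 1 - |z.1 / diamond z ^ 2|) / 2)

lemma continuousOn_foldIn : ContinuousOn foldIn {z | 1 ≤ diamond z} := by
  unfold foldIn
  have h1 : ∀ z ∈ {z | 1 ≤ diamond z}, diamond z ^ 2 ≠ 0 := by
    intro z hz
    have : 1 ≤ diamond z := hz
    positivity
  have h2 : ContinuousOn (fun z => diamond z ^ 2) {z | 1 ≤ diamond z} :=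
    (continuous_diamond.pow 2).continuousOn
  have h3 : ContinuousOn (fun z : ℝ × ℝ => z.1 / diamond z ^ 2) {z | 1 ≤ diamond z} :=
    continuousOn_fst.div h2 h1
  have h4 : ContinuousOn (fun z : ℝ × ℝ => z.2 / diamond z ^ 2) {z | 1 ≤ diamond z} :=
    continuousOn_snd.div h2 h1
  exact h3.prodMk (((h4.add continuousOn_const).sub h3.abs).div_const 2)

lemma injOn_foldIn : Set.InjOn foldIn {z | 1 ≤ diamond z} := by
  have key : ∀ z : ℝ × ℝ, 1 ≤ diamond z →
      |z.1 / diamond z ^ 2| + |z.2 / diamond z ^ 2| = (diamond z)⁻¹ := by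
    intro z hz
    have h0 : 0 < diamond z := by linarith
    rw [abs_div, abs_div, ← add_div, abs_of_pos (pow_pos h0 2), ← diamond]
    field_simp
  intro z hz z' hz' h
  have hz0 : (0 : ℝ) < diamond z := lt_of_lt_of_le zero_lt_one hz
  simp only [foldIn, Prod.mk.injEq] at h
  have h2 : z.2 / diamond z ^ 2 = z'.2 / diamond z' ^ 2 := by
    have := h.2
    rw [h.1] at this
    linarith
  have h3 := key z hz
  rw [h.1, h2, key z' hz', inv_inj] at h3
  rw [h3] at h h2
  have h4 : diamond z ^ 2 ≠ 0 := by positivity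
  exact Prod.ext ((div_left_inj' h4).1 h.1) ((div_left_inj' h4).1 h2)

lemma foldIn_one : foldIn (1, 0) = (1, 0) := by simp [foldIn, diamond_one]

lemma foldIn_neg_one : foldIn (-1, 0) = (-1, 0) := by simp [foldIn, diamond_neg_one]

lemma foldIn_mem {z : ℝ × ℝ} (hz : 1 < diamond z) :
    0 < (foldIn z).2 ∧ diamond (foldIn z) < 1 := by
  have h0 : 0 < diamond z := by linarith
  have h1 : |z.1 / diamond z ^ 2| + |z.2 / diamond z ^ 2| < 1 := by
    rw [abs_div, abs_div, ← add_div, abs_of_pos (pow_pos h0 2), ← diamond]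
    rw [div_lt_one (by positivity)]
    nlinarith
  have h2 := neg_abs_le (z.2 / diamond z ^ 2)
  have h3 := le_abs_self (z.2 / diamond z ^ 2)
  have h4 : 0 < (foldIn z).2 := by simp only [foldIn]; linarith
  refine ⟨h4, ?_⟩
  rw [diamond, abs_of_pos h4]
  simp only [foldIn]
  linarith

section
variable {W : Type*} {H H₁ H₂ : SimpleGraph W}

lemma snd_eq_zero_of_mem_segment {z : ℝ × ℝ} (hz : z ∈ segment ℝ ((1 : ℝ), (0 : ℝ)) (-1, 0)) :
    z.2 = 0 := by
  rw [segment_eq_image'] at hz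
  obtain ⟨t, -, rfl⟩ := hz
  simp

/-- Gluing along an edge. -/
lemma Planar.sup_of_edge [Finite W] (h₁ : Planar H₁) (h₂ : Planar H₂) {u v : W} (hu₁ : H₁.Adj u v)
    (hu₂ : H₂.Adj u v) (hd : ∀ w ∈ H₁.support, w ∈ H₂.support → w = u ∨ w = v) :
    Planar (H₁ ⊔ H₂) := by
  classical
  obtain ⟨pos₁, arc₁, h₁, hu, hv, huv, ho₁⟩ := h₁.exists_diamond hu₁
  obtain ⟨pos₂, arc₂, h₂, hu', hv', -, ho₂⟩ := h₂.exists_diamond hu₂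
  have hdel : ∀ e, e ∈ (H₂.deleteEdges {s(u, v)}).edgeSet ↔ e ∈ H₂.edgeSet ∧ e ≠ s(u, v) := by
    intro e; simp [SimpleGraph.edgeSet_deleteEdges]
  have hle : H₂.deleteEdges {s(u, v)} ≤ H₂ := SimpleGraph.deleteEdges_le _
  have hout : embImage (H₂.deleteEdges {s(u, v)}) arc₂ ⊆ {z | 1 ≤ diamond z} := by
    rintro z ⟨e, he, hz⟩
    exact one_le_diamond (ho₂ e ((hdel e).1 he).1 ((hdel e).1 he).2 z hz)
  have h₃ := (h₂.mono hle).map (continuousOn_foldIn.mono hout) (injOn_foldIn.mono hout)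
  have key := h₁.sup h₃ (by
    intro w hw hw'
    rcases hd w hw (SimpleGraph.support_mono hle hw') with rfl | rfl
    · simp [hu, hu', foldIn_one]
    · simp [hv, hv', foldIn_neg_one]) (by
    rintro _ ⟨e, he, hz⟩ ⟨e', he', z, hz', rfl⟩
    have hus : u ∈ H₁.support := ⟨v, hu₁⟩
    have hvs : v ∈ H₁.support := ⟨u, hu₁.symm⟩
    have he'' := (hdel e').1 he'
    rcases ho₂ e' he''.1 he''.2 z hz' with rfl | rfl | h3
    · exact ⟨u, hus, mem_support_of_mem_edge he'
        (h₂.avoid he''.1 ⟨v, hu₂⟩ (hu' ▸ hz')), by rw [foldIn_one, hu]⟩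
    · exact ⟨v, hvs, mem_support_of_mem_edge he'
        (h₂.avoid he''.1 ⟨u, hu₂.symm⟩ (hv' ▸ hz')), by rw [foldIn_neg_one, hv]⟩
    · exfalso
      have h4 := foldIn_mem h3
      by_cases h5 : e = s(u, v)
      · subst h5
        rw [huv] at hz
        exact h4.1.ne' (snd_eq_zero_of_mem_segment hz)
      · exact absurd (one_le_diamond (ho₁ e he h5 _ hz)) (not_le.2 h4.2))
  refine Planar.mono ⟨_, _, key⟩ ?_
  intro a b hab
  rw [SimpleGraph.sup_adj, SimpleGraph.deleteEdges_adj, Set.mem_singleton_iff]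
  rcases hab with hab | hab
  · exact .inl hab
  · by_cases h5 : s(a, b) = s(u, v)
    · left
      rw [← SimpleGraph.mem_edgeSet, h5]
      exact hu₁
    · exact .inr ⟨hab, h5⟩

lemma planar_triangle {u v t : W} (huv : u ≠ v) (htu : t ≠ u) (htv : t ≠ v) :
    Planar (SimpleGraph.edge u t ⊔ SimpleGraph.edge v t ⊔ SimpleGraph.edge u v) := by
  classical
  set pos : W → ℝ × ℝ := fun w => if w = u then (1, 0) else if w = v then (-1, 0) else (0, 1)
  have hpu : pos u = (1, 0) := by simp [pos]
  have hpv : pos v = (-1, 0) := by simp [pos, huv.symm]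
  have hpt : pos t = (0, 1) := by simp [pos, htu, htv]
  have him : ∀ {a b : W} {z : ℝ × ℝ}, z ∈ embImage (SimpleGraph.edge a b)
      (fun _ => segment ℝ (pos a) (pos b)) → ∃ r : ℝ, 0 ≤ r ∧ r ≤ 1 ∧
        z = pos a + r • (pos b - pos a) := by
    rintro a b z ⟨e, he, hz⟩
    simp only [segment_eq_image'] at hz
    obtain ⟨t, ht, rfl⟩ := hz
    exact ⟨t, ht.1, ht.2, rfl⟩
  have h1 := isEmb_edge (pos := pos) (u := u) (v := t) (by simp [hpu, hpt])
  have h2 := isEmb_edge (pos := pos) (u := v) (v := t) (by simp [hpv, hpt])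
  have h3 := isEmb_edge (pos := pos) (u := u) (v := v) (by rw [hpu, hpv]; norm_num)
  have hs : ∀ {a b : W}, a ≠ b → a ∈ (SimpleGraph.edge a b).support ∧
      b ∈ (SimpleGraph.edge a b).support := by
    intro a b hab
    exact ⟨⟨b, by simp [SimpleGraph.edge_adj, hab]⟩, ⟨a, by simp [SimpleGraph.edge_adj, hab.symm]⟩⟩
  have h12 := h1.sup h2 (fun w _ _ => rfl) (by
    intro z hz hz'
    obtain ⟨r, hr0, hr1, rfl⟩ := him hz
    obtain ⟨r', hr0', hr1', h⟩ := him hz'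
    refine ⟨t, (hs htu.symm).2, (hs htv.symm).2, ?_⟩
    rw [hpu, hpv, hpt] at *
    simp only [Prod.ext_iff, Prod.fst_add, Prod.snd_add, Prod.smul_fst, Prod.smul_snd,
      Prod.fst_sub, Prod.snd_sub, smul_eq_mul] at h ⊢
    constructor <;> linarith [h.1, h.2])
  have h123 := h12.sup h3 (fun w _ _ => by split_ifs <;> rfl) (by
    rintro z ⟨e, he, hz⟩ hz'
    beta_reduce at hz
    have hz2 : z ∈ embImage (SimpleGraph.edge u t) (fun _ => segment ℝ (pos u) (pos t)) ∨
        z ∈ embImage (SimpleGraph.edge v t) (fun _ => segment ℝ (pos v) (pos t)) := by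
      by_cases h : e ∈ (SimpleGraph.edge u t).edgeSet
      · rw [if_pos h] at hz; exact .inl ⟨e, h, hz⟩
      · rw [if_neg h] at hz
        rw [SimpleGraph.edgeSet_sup] at he
        exact .inr ⟨e, he.resolve_left h, hz⟩
    have hmono : ∀ w, w ∈ (SimpleGraph.edge u t).support ∨ w ∈ (SimpleGraph.edge v t).support →
        w ∈ (SimpleGraph.edge u t ⊔ SimpleGraph.edge v t).support := by
      rintro w (h | h)
      exacts [SimpleGraph.support_mono le_sup_left h, SimpleGraph.support_mono le_sup_right h]
    obtain ⟨r', hr0', hr1', rfl⟩ := him hz'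
    rcases hz2 with h | h
    · obtain ⟨r, hr0, hr1, h⟩ := him h
      refine ⟨u, hmono u (.inl (hs htu.symm).1), (hs huv).1, ?_⟩
      rw [if_pos (hs htu.symm).1]
      rw [hpu, hpv] at *
      rw [hpt] at h
      simp only [Prod.ext_iff, Prod.fst_add, Prod.snd_add, Prod.smul_fst, Prod.smul_snd,
        Prod.fst_sub, Prod.snd_sub, smul_eq_mul] at h ⊢
      constructor <;> linarith [h.1, h.2]
    · obtain ⟨r, hr0, hr1, h⟩ := him h
      refine ⟨v, hmono v (.inr (hs htv.symm).1), (hs huv).2, ?_⟩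
      rw [ite_self]
      rw [hpu, hpv] at *
      rw [hpt] at h
      simp only [Prod.ext_iff, Prod.fst_add, Prod.snd_add, Prod.smul_fst, Prod.smul_snd,
        Prod.fst_sub, Prod.snd_sub, smul_eq_mul] at h ⊢
      constructor <;> linarith [h.1, h.2])
  exact ⟨_, _, h123⟩

lemma mem_support_edge {a b w : W} (h : w ∈ (SimpleGraph.edge a b).support) :
    w = a ∨ w = b := by
  obtain ⟨x, hx⟩ := (SimpleGraph.mem_support _).1 h
  rw [SimpleGraph.edge_adj] at hx
  tauto

lemma mem_support_sup {w : W} : w ∈ (H₁ ⊔ H₂).support ↔ w ∈ H₁.support ∨ w ∈ H₂.support := by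
  simp [SimpleGraph.mem_support, exists_or]

/-- A new path of length two may be drawn along an edge. -/
lemma Planar.sup_path [Finite W] (h : Planar H) {u v t : W} (huv : H.Adj u v)
    (ht : t ∉ H.support) : Planar (H ⊔ (SimpleGraph.edge u t ⊔ SimpleGraph.edge v t)) := by
  have htu : t ≠ u := fun h => ht (h ▸ ⟨v, huv⟩)
  have htv : t ≠ v := fun h => ht (h ▸ ⟨u, huv.symm⟩)
  refine Planar.mono (h.sup_of_edge (planar_triangle huv.ne htu htv) huv
    (by simp [SimpleGraph.edge_adj, huv.ne]) ?_) (sup_le_sup_left le_sup_left _)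
  intro w hw hw'
  have h2 : w = u ∨ w = v ∨ w = t := by
    rcases mem_support_sup.1 hw' with h3 | h3
    · rcases mem_support_sup.1 h3 with h3 | h3 <;> have := mem_support_edge h3 <;> tauto
    · have := mem_support_edge h3; tauto
  rcases h2 with h2 | h2 | rfl
  exacts [.inl h2, .inr h2, absurd hw ht]

lemma Planar.sup_pendant [Finite W] (h : Planar H) {u t : W} (ht : t ∉ H.support) :
    Planar (H ⊔ SimpleGraph.edge u t) := by
  by_cases hu : u ∈ H.support
  · obtain ⟨v, huv⟩ := (SimpleGraph.mem_support _).1 hu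
    exact (h.sup_path huv ht).mono (sup_le_sup_left le_sup_left _)
  · refine h.sup_of_disjoint (planar_edge u t) (Set.disjoint_left.2 fun w hw hw' => ?_)
    rcases mem_support_edge hw' with rfl | rfl
    exacts [hu hw, ht hw]

/-- Gluing along at most one vertex. -/
lemma Planar.sup_of_vertex [Finite W] (h₁ : Planar H₁) (h₂ : Planar H₂)
    (hd : (H₁.support ∩ H₂.support).Subsingleton) : Planar (H₁ ⊔ H₂) := by
  by_cases hdis : Disjoint H₁.support H₂.support
  · exact h₁.sup_of_disjoint h₂ hdis
  obtain ⟨u, hu₁, hu₂⟩ := Set.not_disjoint_iff.1 hdis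
  obtain ⟨w, hw⟩ := (SimpleGraph.mem_support _).1 hu₂
  have hw₂ : w ∈ H₂.support := ⟨u, hw.symm⟩
  have hw₁ : w ∉ H₁.support := fun h => hw.ne (hd ⟨hu₁, hu₂⟩ ⟨h, hw₂⟩)
  refine Planar.mono ((h₁.sup_pendant (u := u) hw₁).sup_of_edge h₂ (u := u) (v := w)
    (by simp [SimpleGraph.edge_adj, hw.ne]) hw ?_) (sup_le_sup_right le_sup_left _)
  intro x hx hx'
  rcases mem_support_sup.1 hx with h | h
  · exact .inl (hd ⟨h, hx'⟩ ⟨hu₁, hu₂⟩)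
  · exact mem_support_edge h

/-- Disjoint unions of paths and cycles are planar. -/
lemma planar_of_degree_le_two [Finite W] (hdeg : ∀ w, (H.neighborSet w).ncard ≤ 2) :
    Planar H := by
  classical
  induction hn : H.edgeSet.ncard using Nat.strong_induction_on generalizing H with
  | _ n ih => ?_
  by_cases hbot : H = ⊥
  · exact hbot ▸ planar_bot
  obtain ⟨b, a, hba⟩ : ∃ b a, H.Adj b a := by
    by_contra! h
    exact hbot (by ext x y; simp [h])
  set K := H.deleteIncidenceSet b with hK
  have hKadj : ∀ x y, K.Adj x y ↔ H.Adj x y ∧ x ≠ b ∧ y ≠ b := by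
    intro x y; rw [hK, SimpleGraph.deleteIncidenceSet_adj]
  have hbK : b ∉ K.support := by
    intro h
    obtain ⟨x, hx⟩ := (SimpleGraph.mem_support _).1 h
    exact ((hKadj _ _).1 hx).2.1 rfl
  have hKle : K ≤ H := fun x y h => ((hKadj x y).1 h).1
  by_cases hc : ∃ c, c ≠ a ∧ H.Adj b c
  · obtain ⟨c, hca, hbc⟩ := hc
    have hall : ∀ x, H.Adj b x → x = a ∨ x = c := by
      intro x hx
      by_contra! hne
      have h3 : ({x, a, c} : Set W) ⊆ H.neighborSet b := by
        rintro y (rfl | rfl | rfl)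
        exacts [hx, hba, hbc]
      have h4 := (Set.ncard_le_ncard h3).trans (hdeg b)
      rw [Set.ncard_eq_three.2 ⟨x, a, c, hne.1, hne.2, hca.symm, rfl⟩] at h4
      omega
    have hH' : Planar (K ⊔ SimpleGraph.edge a c) := by
      refine ih _ ?_ ?_ rfl
      · rw [← hn]
        have h1 : (K ⊔ SimpleGraph.edge a c).edgeSet ⊆
          insert s(a, c) (H.edgeSet \ {s(b, a), s(b, c)}) := by
          intro e he
          induction e with | _ x y => ?_
          rw [SimpleGraph.mem_edgeSet, SimpleGraph.sup_adj, hKadj, SimpleGraph.edge_adj] at he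
          rcases he with h | h
          · right
            refine ⟨h.1, ?_⟩
            rintro (h2 | h2)
            · rcases Sym2.eq_iff.1 h2 with h2 | h2
              exacts [h.2.1 h2.1, h.2.2 h2.2]
            · rcases Sym2.eq_iff.1 h2 with h2 | h2
              exacts [h.2.1 h2.1, h.2.2 h2.2]
          · exact .inl (Sym2.eq_iff.2 h.1)
        have h2 : ({s(b, a), s(b, c)} : Set (Sym2 W)) ⊆ H.edgeSet := by
          rintro _ (rfl | rfl)
          exacts [hba, hbc]
        have h3 : ({s(b, a), s(b, c)} : Set (Sym2 W)).ncard = 2 := by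
          refine Set.ncard_pair fun h => ?_
          rcases Sym2.eq_iff.1 h with h | h
          exacts [hca h.2.symm, hbc.ne h.1]
        have h4 := Set.ncard_sdiff h2
        have h5 := Set.ncard_le_ncard h2
        have h6 := (Set.ncard_le_ncard h1).trans (Set.ncard_insert_le _ _)
        omega
      · intro x
        by_cases hxa : x = a ∨ x = c
        · obtain ⟨y, hxy, hbx, hsub⟩ : ∃ y, x ≠ y ∧ H.Adj x b ∧
            (K ⊔ SimpleGraph.edge a c).neighborSet x ⊆
              insert y (H.neighborSet x \ {b}) := by
            rcases hxa with rfl | rfl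
            · refine ⟨c, hca.symm, hba.symm, fun z hz => ?_⟩
              rw [SimpleGraph.mem_neighborSet, SimpleGraph.sup_adj, hKadj,
                SimpleGraph.edge_adj] at hz
              rcases hz with h | h
              · exact .inr ⟨h.1, h.2.2⟩
              · rcases h.1 with h | h
                exacts [.inl h.2, absurd h.1 hca.symm]
            · refine ⟨a, hca, hbc.symm, fun z hz => ?_⟩
              rw [SimpleGraph.mem_neighborSet, SimpleGraph.sup_adj, hKadj,
                SimpleGraph.edge_adj] at hz
              rcases hz with h | h
              · exact .inr ⟨h.1, h.2.2⟩
              · rcases h.1 with h | h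
                exacts [absurd h.1 hca, .inl h.2]
          have h1 := (Set.ncard_le_ncard hsub).trans (Set.ncard_insert_le _ _)
          have h2 := Set.ncard_sdiff_singleton_add_one (s := H.neighborSet x) (a := b) hbx
          have := hdeg x
          omega
        · push Not at hxa
          refine (Set.ncard_le_ncard fun z hz => ?_).trans (hdeg x)
          rw [SimpleGraph.mem_neighborSet, SimpleGraph.sup_adj, hKadj, SimpleGraph.edge_adj] at hz
          rcases hz with h | h
          · exact h.1
          · rcases h.1 with h | h
            exacts [absurd h.1 hxa.1, absurd h.1 hxa.2]
    refine (hH'.sup_path (u := a) (v := c) (t := b)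
      (by simp [SimpleGraph.edge_adj, hca.symm]) ?_).mono ?_
    · intro h
      rcases mem_support_sup.1 h with h | h
      · exact hbK h
      · rcases mem_support_edge h with h | h
        exacts [hba.ne h, hbc.ne h]
    · have key : ∀ y, H.Adj b y → (SimpleGraph.edge a b ⊔ SimpleGraph.edge c b).Adj y b := by
        intro y hy
        rcases hall y hy with rfl | rfl
        · exact .inl (by simp [SimpleGraph.edge_adj, hba.ne'])
        · exact .inr (by simp [SimpleGraph.edge_adj, hbc.ne'])
      intro x y hxy
      by_cases hx : x = b
      · subst hx; exact .inr (key y hxy).symm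
      by_cases hy : y = b
      · subst hy; exact .inr (key x hxy.symm)
      exact .inl (.inl ((hKadj x y).2 ⟨hxy, hx, hy⟩))
  · push Not at hc
    have hpl : Planar K := by
      refine ih _ ?_ (fun w => (Set.ncard_le_ncard fun x hx => hKle hx).trans (hdeg w)) rfl
      rw [← hn]
      refine Set.ncard_lt_ncard ⟨SimpleGraph.edgeSet_mono hKle, fun h => ?_⟩
      exact ((hKadj b a).1 (h (show s(b, a) ∈ H.edgeSet from hba))).2.1 rfl
    have key : ∀ y, H.Adj b y → (SimpleGraph.edge a b).Adj y b := by
      intro y hy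
      have : y = a := by by_contra h; exact hc y h hy
      subst this
      simp [SimpleGraph.edge_adj, hba.ne']
    refine (hpl.sup_pendant (u := a) hbK).mono fun x y hxy => ?_
    by_cases hx : x = b
    · subst hx; exact .inr (key y hxy).symm
    by_cases hy : y = b
    · subst hy; exact .inr (key x hxy.symm)
    exact .inl ((hKadj x y).2 ⟨hxy, hx, hy⟩)

end

section
variable {V : Type*}

/-- The planarization of the edges `A` with respect to the crossing pairs `C`, together with the
additional plain edges `L`. -/
def plan (A : Set (Sym2 V)) (C : Set (Sym2 (Sym2 V))) (L : Set (Sym2 V)) :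
    SimpleGraph (V ⊕ Sym2 (Sym2 V)) where
  Adj a b := match a, b with
    | .inl u, .inl v => u ≠ v ∧ (s(u, v) ∈ L ∨ s(u, v) ∈ A ∧ ∀ c ∈ C, s(u, v) ∉ c)
    | .inl u, .inr c => c ∈ C ∧ ∃ e ∈ c, u ∈ e
    | .inr c, .inl u => c ∈ C ∧ ∃ e ∈ c, u ∈ e
    | .inr _, .inr _ => False
  symm := ⟨by
    rintro (u | c) (v | d) h
    · exact ⟨h.1.symm, Sym2.eq_swap (a := u) (b := v) ▸ h.2⟩
    all_goals exact h⟩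
  loopless := ⟨by
    rintro (u | c) h
    exacts [h.1 rfl, h]⟩

variable {A A' L L' : Set (Sym2 V)} {C C' : Set (Sym2 (Sym2 V))} {G : SimpleGraph V}
  {S : Set CrossingType}

lemma plan_inl_inl {u v : V} : (plan A C L).Adj (.inl u) (.inl v) ↔
    u ≠ v ∧ (s(u, v) ∈ L ∨ s(u, v) ∈ A ∧ ∀ c ∈ C, s(u, v) ∉ c) := Iff.rfl

lemma plan_inl_inr {u : V} {c : Sym2 (Sym2 V)} : (plan A C L).Adj (.inl u) (.inr c) ↔
    c ∈ C ∧ ∃ e ∈ c, u ∈ e := Iff.rfl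

lemma plan_inr_inl {u : V} {c : Sym2 (Sym2 V)} : (plan A C L).Adj (.inr c) (.inl u) ↔
    c ∈ C ∧ ∃ e ∈ c, u ∈ e := Iff.rfl

lemma not_plan_inr_inr {c d : Sym2 (Sym2 V)} : ¬ (plan A C L).Adj (.inr c) (.inr d) := id

/-- A set of pairs of edges of `A` which may cross in an `S`-restricted drawing of `G`. -/
structure IsCrossingSet (G : SimpleGraph V) (S : Set CrossingType) (A : Set (Sym2 V))
    (C : Set (Sym2 (Sym2 V))) : Prop where
  mem : ∀ c ∈ C, ∀ e ∈ c, e ∈ A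
  disj : ∀ e f, s(e, f) ∈ C → ∀ v ∈ e, v ∉ f
  type : ∀ a b c d, s(s(a, b), s(c, d)) ∈ C → ∃ t ∈ S, HasCrossingType G a b c d t
  uniq : ∀ c ∈ C, ∀ c' ∈ C, ∀ e, e ∈ c → e ∈ c' → c = c'

/-- The edges `A` of `G` and the uncrossed edges `L` can be drawn such that the crossings
(of types with respect to `G`) are as in an `S`-restricted drawing. -/
def Drawable (G : SimpleGraph V) (S : Set CrossingType) (A L : Set (Sym2 V)) : Prop :=
  ∃ C, IsCrossingSet G S A C ∧ Planar (plan A C L)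

lemma exists_other {α : Type*} {c : Sym2 α} {e : α} (h : e ∈ c) : ∃ f, c = s(e, f) :=
  ⟨_, (Sym2.other_spec h).symm⟩

lemma halves_exist {A : Set (ℝ × ℝ)} {pos : V → ℝ × ℝ} {e : Sym2 V}
    (hA : ∀ u v, e = s(u, v) → IsArc A (pos u) (pos v)) {p : ℝ × ℝ} (hp : p ∈ A)
    (hpr : p ∉ Set.range pos) :
    ∃ h : V → Set (ℝ × ℝ), ∀ u ∈ e, h u ⊆ A ∧ IsArc (h u) (pos u) p ∧
      ∀ v ∈ e, u ≠ v → h u ∩ h v = {p} := by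
  classical
  induction e with | _ u v => ?_
  have harc := hA u v rfl
  obtain ⟨B, B', h1, h2, h3, h4⟩ := harc.split hp (fun h => hpr ⟨u, h.symm⟩)
    (fun h => hpr ⟨v, h.symm⟩)
  have huv : u ≠ v := fun h => harc.ne (by rw [h])
  refine ⟨fun w => if w = u then B else B', fun w hw => ?_⟩
  rcases Sym2.mem_iff.1 hw with rfl | rfl
  · refine ⟨by simp [← h1], by simpa using h3, fun v' hv' hne => ?_⟩
    rcases Sym2.mem_iff.1 hv' with rfl | rfl
    · exact absurd rfl hne
    · simpa [huv.symm] using h2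
  · refine ⟨by simp [← h1, huv.symm], by simpa [huv.symm] using h4.symm, fun v' hv' hne => ?_⟩
    rcases Sym2.mem_iff.1 hv' with rfl | rfl
    · simpa [huv.symm, Set.inter_comm] using h2
    · exact absurd rfl hne

lemma SRestricted.drawable (h : SRestricted G S) : Drawable G S G.edgeSet ∅ := by
  classical
  obtain ⟨D, ⟨h1, h2⟩, h3⟩ := h
  have hsymm : ∀ {e f p}, D.Crosses e f p → D.Crosses f e p :=
    fun h => ⟨h.2.1, h.1, h.2.2.1.symm, h.2.2.2.2.1, h.2.2.2.1, h.2.2.2.2.2⟩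
  set C : Set (Sym2 (Sym2 V)) := {c | ∃ e f p, c = s(e, f) ∧ D.Crosses e f p} with hC
  have hCmem : ∀ {e f}, s(e, f) ∈ C → ∃ p, D.Crosses e f p := by
    rintro e f ⟨e', f', p, h, hp⟩
    rcases Sym2.eq_iff.1 h with ⟨rfl, rfl⟩ | ⟨rfl, rfl⟩
    exacts [⟨p, hp⟩, ⟨p, hsymm hp⟩]
  have hpt : ∀ c : Sym2 (Sym2 V), ∃ p, c ∈ C → ∀ e f, c = s(e, f) → D.Crosses e f p := by
    intro c
    by_cases hc : c ∈ C
    · induction c with | _ e f => ?_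
      obtain ⟨p, hp⟩ := hCmem hc
      refine ⟨p, fun _ e' f' h => ?_⟩
      rcases Sym2.eq_iff.1 h with ⟨rfl, rfl⟩ | ⟨rfl, rfl⟩
      exacts [hp, hsymm hp]
    · exact ⟨0, fun h => absurd h hc⟩
  choose pt hpt using hpt
  have hval : IsCrossingSet G S G.edgeSet C := by
    refine ⟨fun c hc e he => ?_, fun e f hef => ?_, fun a b c d habcd => ?_, ?_⟩
    · obtain ⟨f, rfl⟩ := exists_other he
      exact (hpt _ hc e f rfl).1
    · obtain ⟨p, hp⟩ := hCmem hef
      exact h2 e f p hp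
    · obtain ⟨p, hp⟩ := hCmem habcd
      exact h3 a b c d p hp
    · intro c hc c' hc' e he he'
      obtain ⟨f, rfl⟩ := exists_other he
      obtain ⟨f', rfl⟩ := exists_other he'
      rw [(h1 _ _ _ _ _ (hpt _ hc e f rfl) (hpt _ hc' e f' rfl)).1]
  have hptc : ∀ c ∈ C, ∀ e ∈ c, pt c ∈ D.arc e ∧ pt c ∉ Set.range D.pos ∧ e ∈ G.edgeSet := by
    intro c hc e he
    obtain ⟨f, rfl⟩ := exists_other he
    have := hpt _ hc e f rfl
    exact ⟨this.2.2.2.1, this.2.2.2.2.2, this.1⟩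
  -- a crossing point on an edge is the crossing of that edge
  have hon : ∀ c ∈ C, ∀ e ∈ G.edgeSet, pt c ∈ D.arc e → e ∈ c := by
    intro c hc e he hce
    induction c with | _ f g => ?_
    have hx := hpt _ hc f g rfl
    by_contra hne
    rw [Sym2.mem_iff] at hne
    push Not at hne
    have h4 : D.Crosses f e (pt s(f, g)) := ⟨hx.1, he, hne.1.symm, hx.2.2.2.1, hce, hx.2.2.2.2.2⟩
    exact hne.2 (h1 _ _ _ _ _ h4 hx).1
  have hcr : ∀ e ∈ G.edgeSet, ∀ e' ∈ G.edgeSet, e ≠ e' → ∀ p ∈ D.arc e, p ∈ D.arc e' →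
      p ∉ Set.range D.pos → s(e, e') ∈ C ∧ p = pt s(e, e') := by
    intro e he e' he' hne p hp hp' hpr
    have hx : D.Crosses e e' p := ⟨he, he', hne, hp, hp', hpr⟩
    have hc : s(e, e') ∈ C := ⟨e, e', p, rfl, hx⟩
    exact ⟨hc, (h1 _ _ _ _ _ hx (hpt _ hc e e' rfl)).2⟩
  have hhalf : ∀ (c : Sym2 (Sym2 V)) (e : Sym2 V), ∃ h : V → Set (ℝ × ℝ), c ∈ C → e ∈ c →
      ∀ u ∈ e, h u ⊆ D.arc e ∧ IsArc (h u) (D.pos u) (pt c) ∧ ∀ v ∈ e, u ≠ v →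
        h u ∩ h v = {pt c} := by
    intro c e
    by_cases hce : c ∈ C ∧ e ∈ c
    · obtain ⟨h, hh⟩ := halves_exist (D.arc_curve e (hptc c hce.1 e hce.2).2.2)
        (hptc c hce.1 e hce.2).1 (hptc c hce.1 e hce.2).2.1
      exact ⟨h, fun _ _ => hh⟩
    · exact ⟨fun _ => ∅, fun h1 h2 => absurd ⟨h1, h2⟩ hce⟩
  choose half hhalf using hhalf
  have harc : ∀ g : Sym2 (V ⊕ Sym2 (Sym2 V)), ∃ B : Set (ℝ × ℝ), g ∈ (plan G.edgeSet C ∅).edgeSet →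
      (∃ e ∈ G.edgeSet, (∀ c ∈ C, e ∉ c) ∧ g = e.map Sum.inl ∧ B = D.arc e) ∨
      (∃ c ∈ C, ∃ e ∈ c, ∃ u ∈ e, g = s(.inl u, .inr c) ∧ B = half c e u) := by
    intro g
    by_cases hg : g ∈ (plan G.edgeSet C ∅).edgeSet
    · induction g with | _ a b => ?_
      rcases a with u | c <;> rcases b with v | d
      · have := plan_inl_inl.1 hg
        simp only [Set.mem_empty_iff_false, false_or] at this
        exact ⟨_, fun _ => .inl ⟨_, this.2.1, this.2.2, rfl, rfl⟩⟩
      · obtain ⟨hd, e, he, hu⟩ := (plan_inl_inr (A := G.edgeSet) (L := ∅)).1 hg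
        exact ⟨_, fun _ => .inr ⟨_, hd, e, he, u, hu, rfl, rfl⟩⟩
      · obtain ⟨hd, e, he, hu⟩ := (plan_inr_inl (A := G.edgeSet) (L := ∅)).1 hg
        exact ⟨_, fun _ => .inr ⟨_, hd, e, he, v, hu, Sym2.eq_swap, rfl⟩⟩
      · exact (show False from hg).elim
    · exact ⟨∅, fun h => absurd h hg⟩
  choose arc harc using harc
  -- every piece lies on an edge
  have hpiece : ∀ g ∈ (plan G.edgeSet C ∅).edgeSet, ∃ e ∈ G.edgeSet, arc g ⊆ D.arc e ∧
      (∀ v ∈ e, D.pos v ∈ arc g → .inl v ∈ g) ∧ ∀ c ∈ C, e ∈ c → .inr c ∈ g := by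
    intro g hg
    rcases harc g hg with ⟨e, he, hec, rfl, hB⟩ | ⟨c, hc, e, he, u, hu, rfl, hB⟩
    · exact ⟨e, he, hB.le, fun v hv _ => Sym2.mem_map.2 ⟨v, hv, rfl⟩, fun c hc h =>
        absurd h (hec c hc)⟩
    · refine ⟨e, (hptc c hc e he).2.2, hB ▸ (hhalf c e hc he u hu).1, fun v hv hvB => ?_,
        fun c' hc' h => ?_⟩
      · by_cases huv : u = v
        · subst huv; simp
        · have h4 := (hhalf c e hc he v hv)
          have h5 : D.pos v ∈ half c e v ∩ half c e u := ⟨h4.2.1.left_mem, hB ▸ hvB⟩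
          rw [h4.2.2 u hu (Ne.symm huv)] at h5
          exact absurd ⟨v, h5⟩ (hptc c hc e he).2.1
      · rw [hval.uniq c' hc' c hc e h he]; simp
  have hposr : ∀ c ∈ C, ∀ v, pt c ≠ D.pos v := by
    intro c hc v h
    induction c with | _ e f => exact (hptc _ hc e (by simp)).2.1 ⟨v, h.symm⟩
  have hav : ∀ g ∈ (plan G.edgeSet C ∅).edgeSet, ∀ w ∈ (plan G.edgeSet C ∅).support,
      Sum.elim D.pos pt w ∈ arc g → w ∈ g := by
    intro g hg w hw hwg
    obtain ⟨e, he, hsub, hv, hc⟩ := hpiece g hg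
    rcases w with v | c
    · exact hv v (D.arc_avoid e he v (hsub hwg)) hwg
    · have hcC : c ∈ C := by
        obtain ⟨b, hb⟩ := (SimpleGraph.mem_support _).1 hw
        rcases b with b | b
        exacts [hb.1, hb.elim]
      exact hc c hcC (hon c hcC e he (hsub hwg))
  refine ⟨C, hval, Sum.elim D.pos pt, arc, ?_, ?_, hav, ?_⟩
  · rintro (u | c) ha (v | d) hb hab
    · exact congrArg _ (D.pos_inj hab)
    · have hdC : d ∈ C := by
        obtain ⟨b, hb⟩ := (SimpleGraph.mem_support _).1 hb
        rcases b with b | b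
        exacts [hb.1, hb.elim]
      exact absurd hab.symm (hposr d hdC u)
    · have hdC : c ∈ C := by
        obtain ⟨b, hb⟩ := (SimpleGraph.mem_support _).1 ha
        rcases b with b | b
        exacts [hb.1, hb.elim]
      exact absurd hab (hposr c hdC v)
    · have hcC : c ∈ C := by
        obtain ⟨b, hb⟩ := (SimpleGraph.mem_support _).1 ha
        rcases b with b | b
        exacts [hb.1, hb.elim]
      have hdC : d ∈ C := by
        obtain ⟨b, hb⟩ := (SimpleGraph.mem_support _).1 hb
        rcases b with b | b
        exacts [hb.1, hb.elim]
      induction c with | _ e f => ?_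
      have h4 := hptc _ hcC e (by simp)
      exact congrArg _ (hval.uniq _ hcC d hdC e (by simp) (hon d hdC e h4.2.2
        ((show pt s(e, f) = pt d from hab) ▸ h4.1)))
  · intro a b hab
    rcases harc s(a, b) hab with ⟨e, he, hec, hg, hB⟩ | ⟨c, hc, e, he, u, hu, hg, hB⟩
    · rw [hB]
      rcases a with u | c <;> rcases b with v | d
      · exact D.arc_curve e he u v (Sym2.map.injective
          (Sum.inl_injective (α := V) (β := Sym2 (Sym2 V))) (hg.symm.trans rfl))
      · have : Sum.inr d ∈ e.map Sum.inl := hg ▸ Sym2.mem_mk_right _ _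
        simp [Sym2.mem_map] at this
      · have : Sum.inr c ∈ e.map Sum.inl := hg ▸ Sym2.mem_mk_left _ _
        simp [Sym2.mem_map] at this
      · have : Sum.inr c ∈ e.map Sum.inl := hg ▸ Sym2.mem_mk_left _ _
        simp [Sym2.mem_map] at this
    · rw [hB]
      have h4 := (hhalf c e hc he u hu).2.1
      rcases Sym2.eq_iff.1 hg with ⟨rfl, rfl⟩ | ⟨rfl, rfl⟩
      exacts [h4, h4.symm]
  · intro g hg g' hg' hne z hz hz'
    obtain ⟨e, he, hsub, hv, hc⟩ := hpiece g hg
    obtain ⟨e', he', hsub', hv', hc'⟩ := hpiece g' hg'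
    by_cases hzr : z ∈ Set.range D.pos
    · obtain ⟨w, rfl⟩ := hzr
      exact ⟨.inl w, hv w (D.arc_avoid e he w (hsub hz)) hz,
        hv' w (D.arc_avoid e' he' w (hsub' hz')) hz', rfl⟩
    by_cases hee : e = e'
    · subst hee
      rcases harc g hg with ⟨f, hf, hfc, rfl, hB⟩ | ⟨c, hcC, f, hfc, u, hu, rfl, hB⟩ <;>
        rcases harc g' hg' with ⟨f', hf', hfc', rfl, hB'⟩ | ⟨c', hcC', f', hfc', u', hu', rfl, hB'⟩
      · have hff : f ≠ f' := fun h => hne (by rw [h])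
        have := hcr f hf f' hf' hff z (hB ▸ hz) (hB' ▸ hz') hzr
        exact absurd (Sym2.mem_mk_left _ _) (hfc _ this.1)
      · have h6 := hptc c' hcC' f' hfc'
        by_cases hff : f = f'
        · subst hff; exact absurd hfc' (hfc c' hcC')
        · have := hcr f hf f' h6.2.2 hff z (hB ▸ hz)
            ((hhalf c' f' hcC' hfc' u' hu').1 (hB' ▸ hz')) hzr
          exact absurd (Sym2.mem_mk_left _ _) (hfc _ this.1)
      · have h6 := hptc c hcC f hfc
        by_cases hff : f = f'
        · subst hff; exact absurd hfc (hfc' c hcC)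
        · have := hcr f h6.2.2 f' hf' hff z ((hhalf c f hcC hfc u hu).1 (hB ▸ hz)) (hB' ▸ hz') hzr
          exact absurd (Sym2.mem_mk_right _ _) (hfc' _ this.1)
      · have h6 := hptc c hcC f hfc
        have h6' := hptc c' hcC' f' hfc'
        by_cases hff : f = f'
        · subst hff
          obtain rfl := hval.uniq c hcC c' hcC' f hfc hfc'
          have huu : u ≠ u' := fun h => hne (by rw [h])
          have h7 : z ∈ half c f u ∩ half c f u' := ⟨hB ▸ hz, hB' ▸ hz'⟩
          rw [(hhalf c f hcC hfc u hu).2.2 u' hu' huu] at h7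
          exact ⟨.inr c, by simp, by simp, h7⟩
        · have := hcr f h6.2.2 f' h6'.2.2 hff z ((hhalf c f hcC hfc u hu).1 (hB ▸ hz))
            ((hhalf c' f' hcC' hfc' u' hu').1 (hB' ▸ hz')) hzr
          have h8 := hval.uniq c hcC _ this.1 f hfc (Sym2.mem_mk_left _ _)
          have h9 := hval.uniq c' hcC' _ this.1 f' hfc' (Sym2.mem_mk_right _ _)
          exact ⟨.inr c, by simp, by simp [h8, h9], by rw [this.2, h8]; rfl⟩
    · have := hcr e he e' he' hee z (hsub hz) (hsub' hz') hzr
      exact ⟨.inr _, hc _ this.1 (by simp), hc' _ this.1 (by simp), this.2⟩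

end

section
variable {V : Type*} {A A' L L' : Set (Sym2 V)} {C C' : Set (Sym2 (Sym2 V))} {G : SimpleGraph V}
  {S : Set CrossingType}

/-- The edges of the planarization which make up the edge `e`. -/
def pieces (C : Set (Sym2 (Sym2 V))) (e : Sym2 V) : Set (Sym2 (V ⊕ Sym2 (Sym2 V))) :=
  {g | (g = e.map Sum.inl ∧ ∀ c ∈ C, e ∉ c) ∨ ∃ c ∈ C, e ∈ c ∧ ∃ u ∈ e, g = s(.inl u, .inr c)}

lemma pieces_subset (hA : A ⊆ G.edgeSet) {e : Sym2 V} (he : e ∈ A) :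
    pieces C e ⊆ (plan A C L).edgeSet := by
  rintro g (⟨rfl, h⟩ | ⟨c, hc, hec, u, hu, rfl⟩)
  · induction e with | _ u v => ?_
    exact plan_inl_inl.2 ⟨(hA he : G.Adj u v).ne, .inr ⟨he, h⟩⟩
  · exact (plan_inl_inr (A := A) (L := L)).2 ⟨hc, e, hec, hu⟩

lemma IsCrossingSet.pieces_disjoint (h : IsCrossingSet G S A C) {e e' : Sym2 V} (hne : e ≠ e') :
    Disjoint (pieces C e) (pieces C e') := by
  rw [Set.disjoint_left]
  rintro g (⟨rfl, h1⟩ | ⟨c, hc, hec, u, hu, rfl⟩) (⟨h2, h3⟩ | ⟨c', hc', hec', u', hu', h2⟩)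
  · exact hne (Sym2.map.injective (Sum.inl_injective (α := V) (β := Sym2 (Sym2 V))) h2)
  · have : (Sum.inr c' : V ⊕ Sym2 (Sym2 V)) ∈ e.map Sum.inl := h2 ▸ Sym2.mem_mk_right _ _
    simp [Sym2.mem_map] at this
  · have : (Sum.inr c : V ⊕ Sym2 (Sym2 V)) ∈ e'.map Sum.inl := h2 ▸ Sym2.mem_mk_right _ _
    simp [Sym2.mem_map] at this
  · simp only [Sym2.eq_iff, Sum.inl.injEq, Sum.inr.injEq, reduceCtorEq, and_false, or_false] at h2
    obtain ⟨rfl, rfl⟩ := h2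
    obtain rfl := (Sym2.mem_and_mem_iff hne).1 ⟨hec, hec'⟩
    exact h.disj _ _ hc u hu hu'

lemma inr_mem_piece {e : Sym2 V} {g : Sym2 (V ⊕ Sym2 (Sym2 V))} (hg : g ∈ pieces C e)
    {c : Sym2 (Sym2 V)} (hc : .inr c ∈ g) : c ∈ C ∧ e ∈ c := by
  rcases hg with ⟨rfl, h1⟩ | ⟨c', hc', hec, u, hu, rfl⟩
  · simp [Sym2.mem_map] at hc
  · simp only [Sym2.mem_iff, reduceCtorEq, Sum.inr.injEq, false_or] at hc
    exact hc ▸ ⟨hc', hec⟩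

lemma inl_mem_piece {e : Sym2 V} {g : Sym2 (V ⊕ Sym2 (Sym2 V))} (hg : g ∈ pieces C e)
    {v : V} (hv : .inl v ∈ g) : v ∈ e := by
  rcases hg with ⟨rfl, h1⟩ | ⟨c', hc', hec, u, hu, rfl⟩
  · simpa [Sym2.mem_map] using hv
  · simp only [Sym2.mem_iff, reduceCtorEq, Sum.inl.injEq, or_false] at hv
    exact hv ▸ hu

lemma inl_mem_support_plan (hA : A ⊆ G.edgeSet) {e : Sym2 V} (he : e ∈ A) {v : V} (hv : v ∈ e) :
    .inl v ∈ (plan A C L).support := by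
  by_cases h : ∃ c ∈ C, e ∈ c
  · obtain ⟨c, hc, hec⟩ := h
    exact ⟨.inr c, (plan_inl_inr (A := A) (L := L)).2 ⟨hc, e, hec, hv⟩⟩
  · push Not at h
    obtain ⟨w, rfl⟩ := exists_other hv
    exact ⟨.inl w, plan_inl_inl.2 ⟨(hA he : G.Adj v w).ne, .inr ⟨he, h⟩⟩⟩

lemma Drawable.sRestricted [Finite V] (h : Drawable G S G.edgeSet L) : SRestricted G S := by
  classical
  have := Fintype.ofFinite V
  obtain ⟨C, hC, p, a, h⟩ := h
  obtain ⟨r, hr⟩ := h.isCompact_image.isBounded.subset_closedBall 0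
  set P := plan G.edgeSet C L with hP
  set far : V → ℝ × ℝ := fun v => (|r| + 1 + (Fintype.equivFin V v : ℕ), 0) with hfar
  have hfar_inj : ∀ u v, far u = far v → u = v := by
    intro u v huv
    simp only [hfar, Prod.mk.injEq, add_right_inj, Nat.cast_inj, and_true] at huv
    exact (Fintype.equivFin V).injective (Fin.ext huv)
  have hfar_not : ∀ v, far v ∉ embImage P a := by
    intro v hv
    have h1 := (norm_fst_le _).trans (mem_closedBall_zero_iff.1 (hr hv))
    simp only [hfar, Real.norm_eq_abs] at h1
    have h2 := le_abs_self (|r| + 1 + ((Fintype.equivFin V v : ℕ) : ℝ))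
    have h3 : (0 : ℝ) ≤ (Fintype.equivFin V v : ℕ) := Nat.cast_nonneg _
    linarith [le_abs_self r]
  set pos : V → ℝ × ℝ := fun v => if .inl v ∈ P.support then p (.inl v) else far v with hpos
  have hpos1 : ∀ v, .inl v ∈ P.support → pos v = p (.inl v) := fun v hv => by simp [hpos, hv]
  have hpos2 : ∀ v, .inl v ∉ P.support → pos v = far v := fun v hv => by simp [hpos, hv]
  have hpim : ∀ v, pos v ∈ embImage P a → .inl v ∈ P.support := by
    intro v hv
    by_contra hvs
    rw [hpos2 v hvs] at hv
    exact hfar_not v hv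
  have hsup : ∀ e ∈ G.edgeSet, ∀ v ∈ e, .inl v ∈ P.support := fun e he v hv =>
    inl_mem_support_plan (G := G) le_rfl he hv
  have hps : ∀ e ∈ G.edgeSet, ∀ g ∈ pieces C e, g ∈ P.edgeSet := fun e he =>
    pieces_subset (G := G) le_rfl he
  have hinter : ∀ e ∈ G.edgeSet, ∀ e' ∈ G.edgeSet, e ≠ e' → ∀ z, (∃ g ∈ pieces C e, z ∈ a g) →
      (∃ g ∈ pieces C e', z ∈ a g) → (∃ v, v ∈ e ∧ z = pos v) ∨
      s(e, e') ∈ C ∧ z = p (.inr s(e, e')) := by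
    rintro e he e' he' hne z ⟨g, hg, hz⟩ ⟨g', hg', hz'⟩
    have hgg : g ≠ g' := fun h1 => Set.disjoint_left.1 (hC.pieces_disjoint hne) hg (h1 ▸ hg')
    obtain ⟨w, hw, hw', rfl⟩ := h.inter (hps e he g hg) (hps e' he' g' hg') hgg hz hz'
    rcases w with v | c
    · exact .inl ⟨v, inl_mem_piece hg hw, (hpos1 v (hsup e he v (inl_mem_piece hg hw))).symm⟩
    · have h1 := inr_mem_piece hg hw
      have h2 := inr_mem_piece hg' hw'
      obtain rfl := (Sym2.mem_and_mem_iff hne).1 ⟨h1.2, h2.2⟩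
      exact .inr ⟨h1.1, rfl⟩
  set D : Drawing G :=
    { pos := pos
      pos_inj := by
        intro u v huv
        by_cases hu : .inl u ∈ P.support <;> by_cases hv : .inl v ∈ P.support
        · rw [hpos1 u hu, hpos1 v hv] at huv
          exact Sum.inl_injective (h.inj hu hv huv)
        · rw [hpos1 u hu, hpos2 v hv] at huv
          exact absurd (huv ▸ h.pos_mem_image hu) (hfar_not v)
        · rw [hpos2 u hu, hpos1 v hv] at huv
          exact absurd (huv ▸ h.pos_mem_image hv) (hfar_not u)
        · rw [hpos2 u hu, hpos2 v hv] at huv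
          exact hfar_inj u v huv
      arc := fun e => {z | ∃ g ∈ pieces C e, z ∈ a g}
      arc_curve := by
        rintro e he u v rfl
        rw [hpos1 u (hsup _ he u (by simp)), hpos1 v (hsup _ he v (by simp))]
        by_cases hc : ∃ c ∈ C, s(u, v) ∈ c
        · obtain ⟨c, hc, hec⟩ := hc
          have h1 : P.Adj (.inl u) (.inr c) := plan_inl_inr.2 ⟨hc, _, hec, by simp⟩
          have h2 : P.Adj (.inr c) (.inl v) := plan_inr_inl.2 ⟨hc, _, hec, by simp⟩
          have hne : s(Sum.inl u, Sum.inr c) ≠ s(Sum.inr c, Sum.inl v) := by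
            simp [(show G.Adj u v from he).ne]
          convert (h.isArc h1).trans (h.isArc h2) ?_ using 1
          · ext z
            constructor
            · rintro ⟨g, (⟨rfl, h3⟩ | ⟨c', hc', hec', w, hw, rfl⟩), hz⟩
              · exact absurd hec (h3 c hc)
              · obtain rfl := hC.uniq c' hc' c hc _ hec' hec
                rcases Sym2.mem_iff.1 hw with rfl | rfl
                · exact .inl hz
                · exact .inr (Sym2.eq_swap (a := Sum.inl w) (b := Sum.inr c') ▸ hz)
            · rintro (hz | hz)
              · exact ⟨_, .inr ⟨c, hc, hec, u, by simp, rfl⟩, hz⟩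
              · exact ⟨_, .inr ⟨c, hc, hec, v, by simp, Sym2.eq_swap⟩, hz⟩
          · intro z hz hz'
            obtain ⟨w, hw, hw', rfl⟩ := h.inter (P.mem_edgeSet.2 h1) (P.mem_edgeSet.2 h2) hne hz hz'
            congr 1
            simp only [Sym2.mem_iff] at hw hw'
            rcases hw with rfl | rfl
            · simp [(show G.Adj u v from he).ne] at hw'
            · rfl
        · push Not at hc
          have h1 : P.Adj (.inl u) (.inl v) :=
            plan_inl_inl.2 ⟨(show G.Adj u v from he).ne, .inr ⟨he, hc⟩⟩
          convert h.isArc h1 using 1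
          ext z
          constructor
          · rintro ⟨g, (⟨rfl, h3⟩ | ⟨c', hc', hec', w, hw, rfl⟩), hz⟩
            · exact hz
            · exact absurd hec' (hc c' hc')
          · intro hz
            exact ⟨_, .inl ⟨rfl, hc⟩, hz⟩
      arc_avoid := by
        rintro e he w ⟨g, hg, hw⟩
        have h1 := hpim w ⟨g, hps e he g hg, hw⟩
        rw [hpos1 w h1] at hw
        exact inl_mem_piece hg (h.avoid (hps e he g hg) h1 hw)
      arc_finite_inter := by
        intro e he e' he' hne
        refine (((Set.finite_range pos).union (Set.finite_singleton (p (.inr s(e, e')))))).subset ?_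
        rintro z ⟨hz, hz'⟩
        rcases hinter e he e' he' hne z hz hz' with ⟨v, -, rfl⟩ | ⟨-, rfl⟩
        · exact .inl ⟨v, rfl⟩
        · exact .inr rfl } with hD
  have hcross : ∀ e e' z, D.Crosses e e' z → s(e, e') ∈ C ∧ z = p (.inr s(e, e')) := by
    rintro e e' z ⟨he, he', hne, hz, hz', hzr⟩
    rcases hinter e he e' he' hne z hz hz' with ⟨v, -, rfl⟩ | h1
    · exact absurd ⟨v, rfl⟩ hzr
    · exact h1
  refine ⟨D, ⟨fun e e₁ e₂ z₁ z₂ h1 h2 => ?_, fun e e' z h1 => ?_⟩, fun a b c d z h1 => ?_⟩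
  · obtain ⟨h3, rfl⟩ := hcross _ _ _ h1
    obtain ⟨h4, rfl⟩ := hcross _ _ _ h2
    have := hC.uniq _ h3 _ h4 e (by simp) (by simp)
    obtain rfl := Sym2.congr_right.1 this
    exact ⟨rfl, rfl⟩
  · exact hC.disj _ _ (hcross _ _ _ h1).1
  · exact hC.type _ _ _ _ (hcross _ _ _ h1).1

end

section
variable {V : Type*} {A A' A₁ A₂ L L' L₁ L₂ : Set (Sym2 V)} {C C' C₁ C₂ : Set (Sym2 (Sym2 V))}
  {G : SimpleGraph V} {S : Set CrossingType}

/-- The vertices covered by a set of edges. -/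
def vset (A : Set (Sym2 V)) : Set V := {v | ∃ e ∈ A, v ∈ e}

lemma vset_mono (h : A ⊆ A') : vset A ⊆ vset A' := fun _ ⟨e, he, hv⟩ => ⟨e, h he, hv⟩

lemma IsCrossingSet.subset (h : IsCrossingSet G S A C) (hC : C' ⊆ C)
    (hA : ∀ c ∈ C', ∀ e ∈ c, e ∈ A') : IsCrossingSet G S A' C' :=
  ⟨hA, fun e f hef => h.disj e f (hC hef), fun a b c d hc => h.type a b c d (hC hc),
    fun c hc c' hc' => h.uniq c (hC hc) c' (hC hc')⟩

lemma preconnected_induce_of_center {W : Type*} {H : SimpleGraph W} {s : Set W} (x : W)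
    (hx : s.Nonempty → x ∈ s)
    (h : ∀ y (hy : y ∈ s), (H.induce s).Reachable ⟨y, hy⟩ ⟨x, hx ⟨y, hy⟩⟩) :
    (H.induce s).Preconnected :=
  fun a b => (h a a.2).trans (h b b.2).symm

lemma Drawable.mono [Finite V] (h : Drawable G S A L) (hA : A' ⊆ A) (hL : L' ⊆ L) :
    Drawable G S A' L' := by
  classical
  obtain ⟨C, hC, hp⟩ := h
  set C' : Set (Sym2 (Sym2 V)) := {c | c ∈ C ∧ ∀ e ∈ c, e ∈ A'} with hC'
  have hrep : ∀ c : Sym2 (Sym2 V), ∃ u : V, (∃ e ∈ c, e ∈ A') → ∃ e ∈ c, e ∈ A' ∧ u ∈ e := by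
    intro c
    by_cases h : ∃ e ∈ c, e ∈ A'
    · obtain ⟨e, hc, he⟩ := h
      induction e with | _ u v => exact ⟨u, fun _ => ⟨_, hc, he, by simp⟩⟩
    · by_cases hV : Nonempty V
      · exact ⟨Classical.arbitrary V, fun h' => absurd h' h⟩
      · induction c with | _ e f => induction e with | _ u v => exact absurd ⟨u⟩ hV
  choose rep hrep using hrep
  set f : V ⊕ Sym2 (Sym2 V) → Option (V ⊕ Sym2 (Sym2 V)) := fun w => match w with
    | .inl v => some (.inl v)
    | .inr c => if c ∈ C' then some (.inr c) else
        if c ∈ C ∧ ∃ e ∈ c, e ∈ A' then some (.inl (rep c)) else none with hf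
  have hf1 : ∀ c ∈ C', f (.inr c) = some (.inr c) := fun c hc => by simp [hf, hc]
  have hf2 : ∀ c, c ∉ C' → c ∈ C → (∃ e ∈ c, e ∈ A') → f (.inr c) = some (.inl (rep c)) := by
    intro c h1 h2 h3
    simp only [hf]
    rw [if_neg h1, if_pos ⟨h2, h3⟩]
  have hf3 : ∀ c w, f (.inr c) = some w → (c ∈ C' ∧ w = .inr c) ∨
      (c ∉ C' ∧ c ∈ C ∧ (∃ e ∈ c, e ∈ A') ∧ w = .inl (rep c)) := by
    intro c w h
    simp only [hf] at h
    split_ifs at h with h1 h2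
    · exact .inl ⟨h1, by simpa using h.symm⟩
    · exact .inr ⟨h1, h2.1, h2.2, by simpa using h.symm⟩
  refine ⟨C', hC.subset (fun c h => h.1) (fun c h => h.2), hp.minor f ?_ ?_⟩
  · intro w
    refine preconnected_induce_of_center w ?_ ?_
    · rintro ⟨y, hy⟩
      rcases w with v | c
      · rfl
      · rcases y with y | c'
        · simp [hf] at hy
        · rcases hf3 c' _ hy with h | h
          · obtain rfl := Sum.inr_injective h.2
            exact hf1 c h.1
          · exact absurd h.2.2.2 (by simp)
    · rintro (v | c) hy
      · obtain rfl : Sum.inl v = w := by simpa [hf] using hy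
        exact .rfl
      · rcases hf3 c _ hy with ⟨h, rfl⟩ | ⟨-, h, h2, rfl⟩
        · exact .rfl
        · refine SimpleGraph.Adj.reachable ?_
          obtain ⟨e, he, -, hu⟩ := hrep c h2
          exact (plan_inr_inl (A := A) (L := L)).2 ⟨h, e, he, hu⟩
  · rintro (u | c) (v | d) hab
    · obtain ⟨huv, h | ⟨h, h'⟩⟩ := plan_inl_inl.1 hab
      · exact ⟨.inl u, .inl v, ⟨huv, .inl (hL h)⟩, rfl, rfl⟩
      · by_cases hc : ∃ c ∈ C, s(u, v) ∈ c
        · obtain ⟨c, hc, hec⟩ := hc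
          have hcC : c ∉ C' := fun h1 => h' c h1 hec
          have hfc := hf2 c hcC hc ⟨_, hec, h⟩
          obtain ⟨e, he, heA, hr⟩ := hrep c ⟨_, hec, h⟩
          have hes : e = s(u, v) := by
            by_contra hne
            obtain rfl := (Sym2.mem_and_mem_iff hne).1 ⟨he, hec⟩
            refine hcC ⟨hc, fun g hg => ?_⟩
            rcases Sym2.mem_iff.1 hg with rfl | rfl
            exacts [heA, h]
          rw [hes, Sym2.mem_iff] at hr
          rcases hr with hr | hr
          · exact ⟨.inr c, .inl v, (plan_inr_inl (A := A) (L := L)).2 ⟨hc, _, hec, by simp⟩,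
              hr ▸ hfc, rfl⟩
          · exact ⟨.inl u, .inr c, (plan_inl_inr (A := A) (L := L)).2 ⟨hc, _, hec, by simp⟩, rfl,
              hr ▸ hfc⟩
        · push Not at hc
          exact ⟨.inl u, .inl v, ⟨huv, .inr ⟨hA h, hc⟩⟩, rfl, rfl⟩
    · have hd : d ∈ C' := hab.1
      exact ⟨.inl u, .inr d, ⟨hd.1, hab.2⟩, rfl, hf1 d hd⟩
    · have hd : c ∈ C' := hab.1
      exact ⟨.inr c, .inl v, ⟨hd.1, hab.2⟩, hf1 c hd, rfl⟩
    · exact hab.elim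

lemma Drawable.of_planar (h : Planar (plan A ∅ L)) : Drawable G S A L :=
  ⟨∅, ⟨by simp, by simp, by simp, by simp⟩, h⟩

lemma mem_vset_of_mem_support (hC : IsCrossingSet G S A C) {v : V}
    (h : .inl v ∈ (plan A C L).support) : v ∈ vset (A ∪ L) := by
  obtain ⟨w, hw⟩ := (SimpleGraph.mem_support _).1 h
  rcases w with w | c
  · obtain ⟨-, h | h⟩ := plan_inl_inl.1 hw
    exacts [⟨_, .inr h, by simp⟩, ⟨_, .inl h.1, by simp⟩]
  · obtain ⟨hc, e, he, hv⟩ := (plan_inl_inr (A := A) (L := L)).1 hw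
    exact ⟨e, .inl (hC.mem c hc e he), hv⟩

lemma inr_mem_support {c : Sym2 (Sym2 V)} (h : .inr c ∈ (plan A C L).support) : c ∈ C := by
  obtain ⟨w, hw⟩ := (SimpleGraph.mem_support _).1 h
  rcases w with w | c
  exacts [hw.1, hw.elim]

lemma IsCrossingSet.union (h₁ : IsCrossingSet G S A₁ C₁) (h₂ : IsCrossingSet G S A₂ C₂)
    (hd : Disjoint A₁ A₂) : IsCrossingSet G S (A₁ ∪ A₂) (C₁ ∪ C₂) := by
  have hx : ∀ c ∈ C₁, ∀ c' ∈ C₂, ∀ e ∈ c, e ∉ c' := fun c hc c' hc' e he he' =>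
    Set.disjoint_left.1 hd (h₁.mem c hc e he) (h₂.mem c' hc' e he')
  refine ⟨?_, ?_, ?_, ?_⟩
  · rintro c (hc | hc) e he
    exacts [.inl (h₁.mem c hc e he), .inr (h₂.mem c hc e he)]
  · rintro e f (h | h)
    exacts [h₁.disj e f h, h₂.disj e f h]
  · rintro a b c d (h | h)
    exacts [h₁.type a b c d h, h₂.type a b c d h]
  · rintro c (hc | hc) c' (hc' | hc') e he he'
    exacts [h₁.uniq c hc c' hc' e he he', absurd he' (hx c hc c' hc' e he),
      absurd he (hx c' hc' c hc e he'), h₂.uniq c hc c' hc' e he he']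

lemma support_inter_plan (h₁ : IsCrossingSet G S A₁ C₁) (h₂ : IsCrossingSet G S A₂ C₂)
    (hd : Disjoint A₁ A₂) {w : V ⊕ Sym2 (Sym2 V)} (hw : w ∈ (plan A₁ C₁ L₁).support)
    (hw' : w ∈ (plan A₂ C₂ L₂).support) : ∃ v, w = .inl v ∧
      v ∈ vset (A₁ ∪ L₁) ∩ vset (A₂ ∪ L₂) := by
  rcases w with v | c
  · exact ⟨v, rfl, mem_vset_of_mem_support h₁ hw, mem_vset_of_mem_support h₂ hw'⟩
  · induction c with | _ e f => ?_
    exact absurd (h₂.mem _ (inr_mem_support hw') e (by simp))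
      (Set.disjoint_left.1 hd (h₁.mem _ (inr_mem_support hw) e (by simp)))

/-- Gluing drawings along an uncrossed edge. -/
lemma Drawable.union_of_edge [Finite V] (h₁ : Drawable G S A₁ L₁) (h₂ : Drawable G S A₂ L₂)
    (hA₂ : A₂ ⊆ G.edgeSet) {u v : V} (huv : u ≠ v) (hu₁ : s(u, v) ∈ L₁)
    (hu₂ : s(u, v) ∈ L₂) (hd : vset (A₁ ∪ L₁) ∩ vset (A₂ ∪ L₂) ⊆ {u, v}) :
    Drawable G S (A₁ ∪ A₂) (L₁ ∪ L₂) := by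
  have h₃ := h₂.mono (A' := A₂ \ {s(u, v)}) Set.sdiff_subset le_rfl
  obtain ⟨C₁, hC₁, hp₁⟩ := h₁
  obtain ⟨C₂, hC₂, hp₂⟩ := h₃
  have hdis : Disjoint A₁ (A₂ \ {s(u, v)}) := by
    rw [Set.disjoint_left]
    rintro e he ⟨he', hne⟩
    refine hne ?_
    induction e with | _ x y => ?_
    have hx := hd ⟨⟨_, .inl he, Sym2.mem_mk_left x y⟩, ⟨_, .inl he', Sym2.mem_mk_left x y⟩⟩
    have hy := hd ⟨⟨_, .inl he, Sym2.mem_mk_right x y⟩, ⟨_, .inl he', Sym2.mem_mk_right x y⟩⟩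
    have hxy : x ≠ y := (show G.Adj x y from hA₂ he').ne
    rcases hx with rfl | rfl <;> rcases hy with rfl | rfl
    exacts [absurd rfl hxy, rfl, Sym2.eq_swap, absurd rfl hxy]
  refine ⟨C₁ ∪ C₂, ?_, ?_⟩
  · refine (hC₁.union hC₂ hdis).subset le_rfl fun c hc e he => ?_
    rcases (hC₁.union hC₂ hdis).mem c hc e he with h | h
    exacts [.inl h, .inr h.1]
  · refine (hp₁.sup_of_edge hp₂ (u := .inl u) (v := .inl v) ⟨huv, .inl hu₁⟩
      ⟨huv, .inl hu₂⟩ ?_).mono ?_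
    · intro w hw hw'
      obtain ⟨x, rfl, hx, hx'⟩ := support_inter_plan hC₁ hC₂ hdis hw hw'
      rcases hd ⟨hx, vset_mono (Set.union_subset_union_left _ Set.sdiff_subset) hx'⟩ with rfl | rfl
      exacts [.inl rfl, .inr rfl]
    · rintro (a | c) (b | d) hab
      · obtain ⟨hne, (h | h) | ⟨h | h, hc⟩⟩ := plan_inl_inl.1 hab
        · exact .inl ⟨hne, .inl h⟩
        · exact .inr ⟨hne, .inl h⟩
        · exact .inl ⟨hne, .inr ⟨h, fun c h => hc c (.inl h)⟩⟩
        · by_cases hs : s(a, b) = s(u, v)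
          · exact .inl ⟨hne, .inl (hs ▸ hu₁)⟩
          · exact .inr ⟨hne, .inr ⟨⟨h, hs⟩, fun c h => hc c (.inr h)⟩⟩
      · rcases hab with ⟨h | h, h'⟩
        exacts [.inl ⟨h, h'⟩, .inr ⟨h, h'⟩]
      · rcases hab with ⟨h | h, h'⟩
        exacts [.inl ⟨h, h'⟩, .inr ⟨h, h'⟩]
      · exact hab.elim

/-- Gluing drawings along at most one vertex. -/
lemma Drawable.union_of_vertex [Finite V] (h₁ : Drawable G S A₁ L₁) (h₂ : Drawable G S A₂ L₂)
    (hA₂ : A₂ ⊆ G.edgeSet) (hd : (vset (A₁ ∪ L₁) ∩ vset (A₂ ∪ L₂)).Subsingleton) :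
    Drawable G S (A₁ ∪ A₂) (L₁ ∪ L₂) := by
  obtain ⟨C₁, hC₁, hp₁⟩ := h₁
  obtain ⟨C₂, hC₂, hp₂⟩ := h₂
  have hdis : Disjoint A₁ A₂ := by
    rw [Set.disjoint_left]
    intro e he he'
    induction e with | _ x y => ?_
    exact (show G.Adj x y from hA₂ he').ne
      (hd ⟨⟨_, .inl he, Sym2.mem_mk_left x y⟩, ⟨_, .inl he', Sym2.mem_mk_left x y⟩⟩
        ⟨⟨_, .inl he, Sym2.mem_mk_right x y⟩, ⟨_, .inl he', Sym2.mem_mk_right x y⟩⟩)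
  refine ⟨C₁ ∪ C₂, hC₁.union hC₂ hdis, (hp₁.sup_of_vertex hp₂ ?_).mono ?_⟩
  · rintro w ⟨hw, hw'⟩ w₂ ⟨hw₂, hw₂'⟩
    obtain ⟨x, rfl, hx⟩ := support_inter_plan hC₁ hC₂ hdis hw hw'
    obtain ⟨y, rfl, hy⟩ := support_inter_plan hC₁ hC₂ hdis hw₂ hw₂'
    rw [hd hx hy]
  · rintro (a | c) (b | d) hab
    · obtain ⟨hne, (h | h) | ⟨h | h, hc⟩⟩ := plan_inl_inl.1 hab
      · exact .inl ⟨hne, .inl h⟩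
      · exact .inr ⟨hne, .inl h⟩
      · exact .inl ⟨hne, .inr ⟨h, fun c h => hc c (.inl h)⟩⟩
      · exact .inr ⟨hne, .inr ⟨h, fun c h => hc c (.inr h)⟩⟩
    · rcases hab with ⟨h | h, h'⟩
      exacts [.inl ⟨h, h'⟩, .inr ⟨h, h'⟩]
    · rcases hab with ⟨h | h, h'⟩
      exacts [.inl ⟨h, h'⟩, .inr ⟨h, h'⟩]
    · exact hab.elim

end

section
variable {V : Type*} {H : SimpleGraph V} {S : Set CrossingType} {C : Set (Sym2 (Sym2 V))}
  {U K : Set V} {sd : V → Sym2 V} {L : Set (Sym2 V)}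

lemma HasCrossingType.matching {a b c d : V} {t : CrossingType} (h : HasCrossingType H a b c d t)
    (ht : t ∈ goodTypes) : H.Adj a c ∧ H.Adj b d ∨ H.Adj a d ∧ H.Adj b c := by
  rcases ht with rfl | rfl | rfl <;> simp only [HasCrossingType] at h <;> tauto

/-- Edges of `H` at vertices outside `U` are consistent with the side assignment `sd`, which maps
vertices outside of `U` to the pair of vertices in `U` they are attached to. -/
def IsSide (H : SimpleGraph V) (U : Set V) (sd : V → Sym2 V) : Prop :=
  ∀ ⦃v w⦄, H.Adj v w → v ∉ U → (w ∈ U → w ∈ sd v) ∧ (w ∉ U → sd w = sd v)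

lemma IsSide.mixed (hsd : IsSide H U sd) (hS : S ⊆ goodTypes)
    (hC : IsCrossingSet H S H.edgeSet C) {f g : Sym2 V} (hc : s(f, g) ∈ C)
    (hf : ∀ v ∈ f, v ∈ U) (hg : ¬ ∀ v ∈ g, v ∈ U) :
    ∃ x ∈ f, ∃ y ∈ U, x ≠ y ∧ (y ∈ f ∨ y ∈ g) ∧ ∀ z ∈ g, z ∉ U → sd z = s(x, y) := by
  induction f with | _ a b => ?_
  induction g with | _ c d => ?_
  have hab : H.Adj a b := hC.mem _ hc _ (Sym2.mem_mk_left _ _)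
  have hcd : H.Adj c d := hC.mem _ hc _ (Sym2.mem_mk_right _ _)
  have hdis := hC.disj _ _ hc
  obtain ⟨t, ht, hty⟩ := hC.type a b c d hc
  replace hty := hty.matching (hS ht)
  have ha : a ∈ U := hf a (by simp)
  have hb : b ∈ U := hf b (by simp)
  have key : ∀ a b c d : V, H.Adj a b → H.Adj c d → a ∈ U → b ∈ U → c ∉ U → a ≠ d →
      H.Adj a c → H.Adj b d → ∃ y ∈ U, a ≠ y ∧ (y = b ∨ y = d) ∧ sd c = s(a, y) ∧
        (d ∉ U → sd d = s(a, y)) := by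
    intro a b c d hab hcd ha hb hc had hac hbd
    have h1 : a ∈ sd c := (hsd hac.symm hc).1 ha
    by_cases hd : d ∈ U
    · have h2 : d ∈ sd c := (hsd hcd hc).1 hd
      exact ⟨d, hd, had, .inr rfl, (Sym2.mem_and_mem_iff had).1 ⟨h1, h2⟩, fun h => absurd hd h⟩
    · have h3 := (hsd hcd hc).2 hd
      have h2 : b ∈ sd d := (hsd hbd.symm hd).1 hb
      have h4 := (Sym2.mem_and_mem_iff hab.ne).1 ⟨h1, h3 ▸ h2⟩
      exact ⟨b, hb, hab.ne, .inl rfl, h4, fun _ => h3.trans h4⟩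
  have hac : a ≠ c := fun h => hdis a (by simp) (by simp [h])
  have had : a ≠ d := fun h => hdis a (by simp) (by simp [h])
  have hbc : b ≠ c := fun h => hdis b (by simp) (by simp [h])
  have hbd : b ≠ d := fun h => hdis b (by simp) (by simp [h])
  by_cases hcU : c ∈ U
  · have hdU : d ∉ U := fun h => hg (by simp [hcU, h])
    rcases hty with ⟨h1, h2⟩ | ⟨h1, h2⟩
    · obtain ⟨y, hy, hne, hyy, h3, h4⟩ := key b a d c hab.symm hcd.symm hb ha hdU hbc h2 h1
      exact ⟨b, by simp, y, hy, hne, by rcases hyy with rfl | rfl <;> simp, by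
        intro z hz hzU; rcases Sym2.mem_iff.1 hz with rfl | rfl; exacts [h4 hzU, h3]⟩
    · obtain ⟨y, hy, hne, hyy, h3, h4⟩ := key a b d c hab hcd.symm ha hb hdU hac h1 h2
      exact ⟨a, by simp, y, hy, hne, by rcases hyy with rfl | rfl <;> simp, by
        intro z hz hzU; rcases Sym2.mem_iff.1 hz with rfl | rfl; exacts [h4 hzU, h3]⟩
  · rcases hty with ⟨h1, h2⟩ | ⟨h1, h2⟩
    · obtain ⟨y, hy, hne, hyy, h3, h4⟩ := key a b c d hab hcd ha hb hcU had h1 h2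
      exact ⟨a, by simp, y, hy, hne, by rcases hyy with rfl | rfl <;> simp, by
        intro z hz hzU; rcases Sym2.mem_iff.1 hz with rfl | rfl; exacts [h3, h4 hzU]⟩
    · obtain ⟨y, hy, hne, hyy, h3, h4⟩ := key b a c d hab.symm hcd hb ha hcU hbd h2 h1
      exact ⟨b, by simp, y, hy, hne, by rcases hyy with rfl | rfl <;> simp, by
        intro z hz hzU; rcases Sym2.mem_iff.1 hz with rfl | rfl; exacts [h3, h4 hzU]⟩

lemma IsSide.eq_of_crossing (hsd : IsSide H U sd) (hS : S ⊆ goodTypes)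
    (hC : IsCrossingSet H S H.edgeSet C) {f g : Sym2 V} (hc : s(f, g) ∈ C) {v w : V}
    (hv : v ∈ f) (hw : w ∈ g) (hvU : v ∉ U) (hwU : w ∉ U) : sd v = sd w := by
  obtain ⟨b, rfl⟩ := hv
  obtain ⟨d, rfl⟩ := hw
  have hab : H.Adj v b := hC.mem _ hc _ (Sym2.mem_mk_left _ _)
  have hcd : H.Adj w d := hC.mem _ hc _ (Sym2.mem_mk_right _ _)
  have hdis := hC.disj _ _ hc
  obtain ⟨t, ht, hty⟩ := hC.type _ _ _ _ hc
  rcases hty.matching (hS ht) with ⟨h1, h2⟩ | ⟨h1, h2⟩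
  · exact ((hsd h1 hvU).2 hwU).symm
  · by_cases hd : d ∈ U <;> by_cases hb : b ∈ U
    · have hbd : b ≠ d := fun h => hdis b (by simp) (by simp [h])
      rw [(Sym2.mem_and_mem_iff hbd).1 ⟨(hsd hab hvU).1 hb, (hsd h1 hvU).1 hd⟩,
        (Sym2.mem_and_mem_iff hbd).1 ⟨(hsd h2.symm hwU).1 hb, (hsd hcd hwU).1 hd⟩]
    · rw [← (hsd hab hvU).2 hb, (hsd h2.symm hwU).2 hb]
    all_goals rw [← (hsd h1 hvU).2 hd, (hsd hcd hwU).2 hd]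

lemma IsSide.eq_of_mem (hsd : IsSide H U sd) (hS : S ⊆ goodTypes)
    (hC : IsCrossingSet H S H.edgeSet C) {c : Sym2 (Sym2 V)} (hc : c ∈ C) {f g : Sym2 V}
    (hf : f ∈ c) (hg : g ∈ c) {v w : V}
    (hv : v ∈ f) (hw : w ∈ g) (hvU : v ∉ U) (hwU : w ∉ U) : sd v = sd w := by
  by_cases hfg : f = g
  · subst hfg
    by_cases hvw : v = w
    · rw [hvw]
    · have := (Sym2.mem_and_mem_iff hvw).1 ⟨hv, hw⟩
      subst this
      exact ((hsd (hC.mem c hc _ hf) hvU).2 hwU).symm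
  · obtain rfl := (Sym2.mem_and_mem_iff hfg).1 ⟨hf, hg⟩
    exact hsd.eq_of_crossing hS hC hc hv hw hvU hwU

/-- Restricting a drawing to the vertex set `U` while replacing connected pieces outside of `U`
by uncrossed edges. -/
lemma IsSide.drawable [Finite V] (hsd : IsSide H U sd) (hS : S ⊆ goodTypes)
    (h : Drawable H S H.edgeSet ∅) (hKU : ∀ z ∈ K, z ∉ U) (hLU : ∀ e ∈ L, ∀ v ∈ e, v ∈ U)
    (hK : ∀ e ∈ L, (H.induce {z | z ∈ K ∧ sd z = e}).Preconnected)
    (hKL : ∀ e ∈ L, ∀ u ∈ e, ∃ z ∈ K, sd z = e ∧ H.Adj u z) :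
    Drawable H S {e | e ∈ H.edgeSet ∧ ∀ v ∈ e, v ∈ U} L := by
  classical
  obtain ⟨C, hC, hp⟩ := h
  set A' : Set (Sym2 V) := {e | e ∈ H.edgeSet ∧ ∀ v ∈ e, v ∈ U} with hA'
  set C' : Set (Sym2 (Sym2 V)) := {c | c ∈ C ∧ ∀ e ∈ c, e ∈ A'} with hC'
  -- a crossing involving exactly one edge of `A'`
  let Mixed : Sym2 (Sym2 V) → Prop := fun c => c ∈ C ∧ (∃ f ∈ c, f ∈ A') ∧ ∃ g ∈ c, g ∉ A'
  have hmix : ∀ c, ∃ x : V, Mixed c → ∃ f g y, c = s(f, g) ∧ f ∈ A' ∧ g ∉ A' ∧ x ∈ f ∧ y ∈ U ∧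
      x ≠ y ∧ (y ∈ f ∨ y ∈ g) ∧ ∀ z ∈ g, z ∉ U → sd z = s(x, y) := by
    intro c
    by_cases hm : Mixed c
    · obtain ⟨hc, ⟨f, hf, hfA⟩, g, hg, hgA⟩ := hm
      have hfg : f ≠ g := fun h => hgA (h ▸ hfA)
      obtain rfl := (Sym2.mem_and_mem_iff hfg).1 ⟨hf, hg⟩
      obtain ⟨x, hx, y, hy, h1, h2, h3⟩ := hsd.mixed hS hC hc hfA.2
        (fun h => hgA ⟨hC.mem _ hc _ hg, h⟩)
      exact ⟨x, fun _ => ⟨f, g, y, rfl, hfA, hgA, hx, hy, h1, h2, h3⟩⟩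
    · by_cases hV : Nonempty V
      · exact ⟨Classical.arbitrary V, fun h' => absurd h' hm⟩
      · induction c with | _ e f => induction e with | _ u v => exact absurd ⟨u⟩ hV
  choose χ hχ using hmix
  have hA'g : ∀ g ∈ H.edgeSet, g ∉ A' → ∃ z ∈ g, z ∉ U := by
    intro g hg hgA
    by_contra! h
    exact hgA ⟨hg, h⟩
  -- the pieces which are not crossed by edges of `A'`
  let Free : Sym2 V → Prop := fun e => ∀ c, Mixed c → ∀ g ∈ c, ∀ z ∈ g, z ∉ U → sd z ≠ e
  let Good : V → Prop := fun z => z ∈ K ∧ sd z ∈ L ∧ Free (sd z)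
  let rep : Sym2 V → V := fun e => e.out.1
  have hrep : ∀ e, rep e ∈ e := Sym2.out_fst_mem
  let Out : Sym2 (Sym2 V) → V → Prop := fun c z => c ∈ C ∧ (∃ g ∈ c, z ∈ g) ∧ Good z
  set φ : V ⊕ Sym2 (Sym2 V) → Option (V ⊕ Sym2 (Sym2 V)) := fun w => match w with
    | .inl v => if v ∈ U then some (.inl v) else
        if Good v then some (.inl (rep (sd v))) else none
    | .inr c => if c ∈ C' then some (.inr c) else
        if Mixed c then some (.inl (χ c)) else
        if h : ∃ z, Out c z then some (.inl (rep (sd h.choose))) else none with hφ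
  have hφU : ∀ v ∈ U, φ (.inl v) = some (.inl v) := fun v hv => by simp [hφ, hv]
  have hφG : ∀ v, Good v → φ (.inl v) = some (.inl (rep (sd v))) := fun v hv => by
    simp only [hφ]
    rw [if_neg (hKU v hv.1), if_pos hv]
  have hφC : ∀ c ∈ C', φ (.inr c) = some (.inr c) := fun c hc => by simp [hφ, hc]
  have hCM : ∀ c, Mixed c → c ∉ C' := fun c hm hc => by
    obtain ⟨g, hg, hgA⟩ := hm.2.2
    exact hgA (hc.2 g hg)
  have hφM : ∀ c, Mixed c → φ (.inr c) = some (.inl (χ c)) := fun c hc => by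
    simp only [hφ]
    rw [if_neg (hCM c hc), if_pos hc]
  have hsame : ∀ c z z', Out c z → Out c z' → sd z = sd z' := by
    rintro c z z' ⟨hc, ⟨g, hg, hz⟩, hzG⟩ ⟨-, ⟨g', hg', hz'⟩, hzG'⟩
    exact hsd.eq_of_mem hS hC hc hg hg' hz hz' (hKU _ hzG.1) (hKU _ hzG'.1)
  have hOC : ∀ c z, Out c z → c ∉ C' := by
    rintro c z ⟨hc, ⟨g, hg, hz⟩, hzG⟩ hc'
    exact hKU z hzG.1 ((hc'.2 g hg).2 z hz)
  have hOM : ∀ c z, Out c z → ¬ Mixed c := by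
    rintro c z ⟨hc, ⟨g, hg, hz⟩, hzG⟩ hm
    exact hzG.2.2 c hm g hg z hz (hKU z hzG.1) rfl
  have hφO : ∀ c z, Out c z → φ (.inr c) = some (.inl (rep (sd z))) := fun c z hO => by
    simp only [hφ]
    have hex : ∃ z, Out c z := ⟨z, hO⟩
    rw [if_neg (hOC c z hO), if_neg (hOM c z hO), dif_pos hex,
      hsame c _ z hex.choose_spec hO]
  have hφl : ∀ v w, φ (.inl v) = some w → (v ∈ U ∧ w = .inl v) ∨
      (Good v ∧ w = .inl (rep (sd v))) := by
    intro v w h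
    simp only [hφ] at h
    split_ifs at h with h1 h2
    · exact .inl ⟨h1, by simpa using h.symm⟩
    · exact .inr ⟨h2, by simpa using h.symm⟩
  have hφr : ∀ c w, φ (.inr c) = some w → (c ∈ C' ∧ w = .inr c) ∨ (Mixed c ∧ w = .inl (χ c)) ∨
      ∃ z, Out c z ∧ w = .inl (rep (sd z)) := by
    intro c w h
    simp only [hφ] at h
    split_ifs at h with h1 h2 h3
    · exact .inl ⟨h1, by simpa using h.symm⟩
    · exact .inr (.inl ⟨h2, by simpa using h.symm⟩)
    · exact .inr (.inr ⟨_, h3.choose_spec, by simpa using h.symm⟩)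
  -- an edge of `H` at a good vertex
  have hedge : ∀ z v, H.Adj z v → Good z →
      (plan H.edgeSet C ∅).Adj (.inl z) (.inl v) ∨ ∃ c, Out c z ∧
        (plan H.edgeSet C ∅).Adj (.inl z) (.inr c) ∧
        (plan H.edgeSet C ∅).Adj (.inr c) (.inl v) := by
    intro z v hzv hz
    by_cases hc : ∃ c ∈ C, s(z, v) ∈ c
    · obtain ⟨c, hc, hec⟩ := hc
      exact .inr ⟨c, ⟨hc, ⟨_, hec, by simp⟩, hz⟩, ⟨hc, _, hec, by simp⟩, ⟨hc, _, hec, by simp⟩⟩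
    · push Not at hc
      exact .inl ⟨hzv.ne, .inr ⟨hzv, hc⟩⟩
  refine ⟨C', hC.subset (fun c h => h.1) (fun c h => h.2), hp.minor φ ?_ ?_⟩
  · rintro (u | c)
    · set F := {w | φ w = some (Sum.inl u)} with hF
      have hgood : ∀ z (hz : Good z) (hzu : rep (sd z) = u), ∃ hu : Sum.inl u ∈ F,
          ∃ hzF : Sum.inl z ∈ F,
          ((plan H.edgeSet C ∅).induce F).Reachable ⟨_, hzF⟩ ⟨_, hu⟩ := by
        intro z hz hzu
        have huU : u ∈ U := hLU _ hz.2.1 _ (hzu ▸ hrep _)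
        have hu : Sum.inl u ∈ F := hφU u huU
        have hstep : ∀ z' v, H.Adj z' v → Good z' → sd z' = sd z → ∀ hv : Sum.inl v ∈ F,
            ∃ hz' : Sum.inl z' ∈ F,
            ((plan H.edgeSet C ∅).induce F).Reachable ⟨_, hz'⟩ ⟨_, hv⟩ := by
          intro z' v hadj hz' hs hv
          have hz'F : Sum.inl z' ∈ F := by
            rw [hF, Set.mem_ofPred_eq, hφG z' hz', hs, hzu]
          refine ⟨hz'F, ?_⟩
          rcases hedge z' v hadj hz' with h | ⟨c, hO, h1, h2⟩
          · exact SimpleGraph.Adj.reachable (by exact h)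
          · have hcF : Sum.inr c ∈ F := by
              rw [hF, Set.mem_ofPred_eq, hφO c z' hO, hs, hzu]
            refine (SimpleGraph.Adj.reachable (v := ⟨_, hcF⟩) ?_).trans
              (SimpleGraph.Adj.reachable ?_)
            exacts [h1, h2]
        obtain ⟨z₀, hz₀, hs₀, hadj₀⟩ := hKL _ hz.2.1 u (hzu ▸ hrep _)
        have hGood : ∀ z', z' ∈ K → sd z' = sd z → Good z' := fun z' h1 h2 =>
          ⟨h1, h2 ▸ hz.2.1, h2 ▸ hz.2.2⟩
        refine ⟨hu, ?_⟩
        obtain ⟨p⟩ := hK _ hz.2.1 ⟨z, hz.1, rfl⟩ ⟨z₀, hz₀, hs₀⟩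
        have : ∀ (a b : {z' | z' ∈ K ∧ sd z' = sd z}) (p : (H.induce _).Walk a b),
            H.Adj b.1 u → ∃ hzF : Sum.inl a.1 ∈ F,
          ((plan H.edgeSet C ∅).induce F).Reachable ⟨_, hzF⟩ ⟨_, hu⟩ := by
          intro a b p
          induction p with
          | nil =>
            rename_i a
            intro hb
            exact hstep a.1 u hb (hGood _ a.2.1 a.2.2) a.2.2 hu
          | cons hadj p ih =>
            rename_i a b' b
            intro hb
            obtain ⟨hF', hr⟩ := ih hb
            obtain ⟨h1, h2⟩ := hstep a.1 _ hadj (hGood _ a.2.1 a.2.2) a.2.2 hF'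
            exact ⟨h1, h2.trans hr⟩
        exact this _ _ p hadj₀.symm
      refine preconnected_induce_of_center (.inl u) ?_ ?_
      · rintro ⟨v | c, hv⟩
        · rcases hφl v _ hv with ⟨h, h'⟩ | ⟨h, h'⟩
          · obtain rfl := Sum.inl_injective h'
            exact hv
          · exact (hgood v h (Sum.inl_injective h').symm).1
        · rcases hφr c _ hv with ⟨-, h⟩ | ⟨hm, h⟩ | ⟨z, hO, h⟩
          · exact absurd h (by simp)
          · obtain ⟨f, g, y, -, hf, -, hx, -⟩ := hχ c hm
            obtain rfl := Sum.inl_injective h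
            exact hφU _ (hf.2 _ hx)
          · exact (hgood z hO.2.2 (Sum.inl_injective h).symm).1
      · rintro (v | c) hv
        · rcases hφl v _ hv with ⟨h, h'⟩ | ⟨h, h'⟩
          · obtain rfl := Sum.inl_injective h'
            exact .rfl
          · exact (hgood v h (Sum.inl_injective h').symm).2.2
        · rcases hφr c _ hv with ⟨-, h⟩ | ⟨hm, h⟩ | ⟨z, hO, h⟩
          · exact absurd h (by simp)
          · obtain ⟨f, g, y, hcfg, hf, -, hx, -⟩ := hχ c hm
            obtain rfl := Sum.inl_injective h
            exact SimpleGraph.Adj.reachable ⟨hm.1, f, by simp [hcfg], hx⟩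
          · obtain ⟨hu, hzF, hr⟩ := hgood z hO.2.2 (Sum.inl_injective h).symm
            refine (SimpleGraph.Adj.reachable (v := ⟨_, hzF⟩) ?_).trans hr
            exact ⟨hO.1, hO.2.1⟩
    · refine preconnected_induce_of_center (.inr c) ?_ ?_
      · rintro ⟨v | d, hv⟩
        · rcases hφl v _ hv with ⟨-, h⟩ | ⟨-, h⟩ <;> exact absurd h (by simp)
        · rcases hφr d _ hv with ⟨hd, h⟩ | ⟨-, h⟩ | ⟨z, -, h⟩
          · obtain rfl := Sum.inr_injective h
            exact hv
          all_goals exact absurd h (by simp)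
      · rintro (v | d) hv
        · rcases hφl v _ hv with ⟨-, h⟩ | ⟨-, h⟩ <;> exact absurd h (by simp)
        · rcases hφr d _ hv with ⟨hd, h⟩ | ⟨-, h⟩ | ⟨z, -, h⟩
          · obtain rfl := Sum.inr_injective h
            exact .rfl
          all_goals exact absurd h (by simp)
  · have hlast : ∀ c a, a ∈ U → c ∈ C' → (∃ e ∈ c, a ∈ e) →
        (plan H.edgeSet C ∅).Adj (.inl a) (.inr c) := fun c a _ hc h => ⟨hc.1, h⟩
    have hL' : ∀ a b, s(a, b) ∈ L → rep s(a, b) = a → Free s(a, b) →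
        ∃ a' b', (plan H.edgeSet C ∅).Adj a' b' ∧ φ a' = some (.inl a) ∧ φ b' = some (.inl b) := by
      intro a b hab hra hfree
      obtain ⟨z, hz, hs, hadj⟩ := hKL _ hab b (by simp)
      have hzG : Good z := ⟨hz, hs ▸ hab, hs ▸ hfree⟩
      have hbU : φ (.inl b) = some (.inl b) := hφU b (hLU _ hab _ (by simp))
      rcases hedge z b hadj.symm hzG with h | ⟨c, hO, h1, h2⟩
      · exact ⟨_, _, h, by rw [hφG z hzG, hs, hra], hbU⟩
      · exact ⟨_, _, h2, by rw [hφO c z hO, hs, hra], hbU⟩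
    rintro (a | c) (b | d) hab
    · obtain ⟨hne, h | ⟨h, h'⟩⟩ := plan_inl_inl.1 hab
      · have haU := hLU _ h a (by simp)
        have hbU := hLU _ h b (by simp)
        by_cases hfree : Free s(a, b)
        · rcases Sym2.mem_iff.1 (hrep s(a, b)) with hr | hr
          · exact hL' a b h hr hfree
          · rw [Sym2.eq_swap] at h hfree hr
            obtain ⟨a', b', h1, h2, h3⟩ := hL' b a h hr hfree
            exact ⟨b', a', h1.symm, h3, h2⟩
        · simp only [Free] at hfree
          push Not at hfree
          obtain ⟨c, hm, g', hg', z, hz, hzU, hsz⟩ := hfree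
          obtain ⟨f, g, y, rfl, hf, hg, hx, hy, hxy, hyfg, hgz⟩ := hχ c hm
          have : g' = g := by
            rcases Sym2.mem_iff.1 hg' with rfl | rfl
            · exact absurd (hf.2 z hz) hzU
            · rfl
          subst this
          have hyc : (plan H.edgeSet C ∅).Adj (.inr s(f, g')) (.inl y) := by
            rcases hyfg with h | h
            exacts [⟨hm.1, f, by simp, h⟩, ⟨hm.1, g', by simp, h⟩]
          have h1 := hgz z hz hzU
          rw [hsz, Sym2.eq_iff] at h1
          rcases h1 with ⟨ha', hb'⟩ | ⟨ha', hb'⟩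
          · exact ⟨_, _, hyc, by rw [hφM _ hm, ha'], by rw [hφU y hy, hb']⟩
          · exact ⟨_, _, hyc.symm, by rw [hφU y hy, ha'], by rw [hφM _ hm, hb']⟩
      · by_cases hc : ∃ c ∈ C, s(a, b) ∈ c
        · obtain ⟨c, hc, hec⟩ := hc
          have hm : Mixed c := by
            refine ⟨hc, ⟨_, hec, h⟩, ?_⟩
            by_contra! hall
            exact h' c ⟨hc, hall⟩ hec
          obtain ⟨f, g, y, rfl, hf, hg, hx, -⟩ := hχ c hm
          have : s(a, b) = f := by
            rcases Sym2.mem_iff.1 hec with h' | h'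
            exacts [h', absurd (h' ▸ h) hg]
          subst this
          rcases Sym2.mem_iff.1 hx with hx | hx
          · exact ⟨.inr s(s(a, b), g), .inl b, ⟨hc, _, hec, by simp⟩, by rw [hφM _ hm, hx],
              hφU b (h.2 b (by simp))⟩
          · exact ⟨.inl a, .inr s(s(a, b), g), ⟨hc, _, hec, by simp⟩,
              hφU a (h.2 a (by simp)), by rw [hφM _ hm, hx]⟩
        · push Not at hc
          exact ⟨.inl a, .inl b, ⟨hne, .inr ⟨h.1, hc⟩⟩, hφU a (h.2 a (by simp)),
            hφU b (h.2 b (by simp))⟩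
    · obtain ⟨hd, e, he, ha⟩ := (plan_inl_inr (A := A') (L := L)).1 hab
      have haU : a ∈ U := (hd.2 e he).2 a ha
      exact ⟨.inl a, .inr d, hlast d a haU hd ⟨e, he, ha⟩, hφU a haU, hφC d hd⟩
    · obtain ⟨hd, e, he, ha⟩ := (plan_inr_inl (A := A') (L := L)).1 hab
      have haU : b ∈ U := (hd.2 e he).2 b ha
      exact ⟨.inr c, .inl b, (hlast c b haU hd ⟨e, he, ha⟩).symm, hφC c hd, hφU b haU⟩
    · exact hab.elim

end

section
variable {V V' : Type*} {A L : Set (Sym2 V)} {G : SimpleGraph V} {G' : SimpleGraph V'}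
  {S : Set CrossingType}

lemma Planar.transfer {W W' : Type*} [Finite W] {H : SimpleGraph W} {H' : SimpleGraph W'}
    (h : Planar H) (f : W → Option W') (hf : ∀ a b c, f a = some c → f b = some c → a = b)
    (hadj : ∀ ⦃a b⦄, H'.Adj a b → ∃ a' b', H.Adj a' b' ∧ f a' = some a ∧ f b' = some b) :
    Planar H' := by
  refine h.minor f (fun c a b => ?_) hadj
  obtain rfl : a = b := Subtype.ext (hf _ _ c a.2 b.2)
  exact .rfl

lemma HasCrossingType.congr {a b c d : V} {a' b' c' d' : V'} {t : CrossingType}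
    (h : HasCrossingType G a b c d t) (hac : G'.Adj a' c' ↔ G.Adj a c)
    (had : G'.Adj a' d' ↔ G.Adj a d) (hbc : G'.Adj b' c' ↔ G.Adj b c)
    (hbd : G'.Adj b' d' ↔ G.Adj b d) : HasCrossingType G' a' b' c' d' t := by
  cases t <;> simpa only [HasCrossingType, hac, had, hbc, hbd] using h

lemma Drawable.map [Finite V] (h : Drawable G S A L) {f : V → V'} (hf : Function.Injective f)
    (hG : ∀ u ∈ vset A, ∀ v ∈ vset A, G'.Adj (f u) (f v) ↔ G.Adj u v) :
    Drawable G' S (Sym2.map f '' A) (Sym2.map f '' L) := by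
  obtain ⟨C, hC, hp⟩ := h
  have hff : Function.Injective (Sym2.map (Sym2.map f)) :=
    Sym2.map.injective (Sym2.map.injective hf)
  refine ⟨Sym2.map (Sym2.map f) '' C, ⟨?_, ?_, ?_, ?_⟩, ?_⟩
  · rintro _ ⟨c, hc, rfl⟩ e he
    obtain ⟨e, he₀, rfl⟩ := Sym2.mem_map.1 he
    exact ⟨e, hC.mem c hc e he₀, rfl⟩
  · rintro e g ⟨c, hc, hcc⟩ v hv hv'
    obtain ⟨e, he, rfl⟩ := Sym2.mem_map.1 (hcc ▸ Sym2.mem_mk_left e g)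
    obtain ⟨g, hg, rfl⟩ := Sym2.mem_map.1 (hcc ▸ Sym2.mem_mk_right (Sym2.map f e) g)
    rw [← Sym2.map_mk] at hcc
    obtain rfl := hff hcc
    obtain ⟨v, hv₀, rfl⟩ := Sym2.mem_map.1 hv
    obtain ⟨w, hw, h⟩ := Sym2.mem_map.1 hv'
    exact hC.disj e g hc v hv₀ (hf h ▸ hw)
  · rintro a b c d ⟨x, hx, hxx⟩
    obtain ⟨e, he, hab⟩ := Sym2.mem_map.1 (hxx ▸ Sym2.mem_mk_left s(a, b) s(c, d))
    obtain ⟨g, hg, hcd⟩ := Sym2.mem_map.1 (hxx ▸ Sym2.mem_mk_right s(a, b) s(c, d))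
    obtain ⟨a, -, rfl⟩ := Sym2.mem_map.1 (hab ▸ Sym2.mem_mk_left a b)
    obtain ⟨b, -, rfl⟩ := Sym2.mem_map.1 (hab ▸ Sym2.mem_mk_right _ b)
    obtain ⟨c, -, rfl⟩ := Sym2.mem_map.1 (hcd ▸ Sym2.mem_mk_left c d)
    obtain ⟨d, -, rfl⟩ := Sym2.mem_map.1 (hcd ▸ Sym2.mem_mk_right _ d)
    rw [← Sym2.map_mk, ← Sym2.map_mk, ← Sym2.map_mk] at hxx
    obtain rfl := hff hxx
    obtain ⟨t, ht, hty⟩ := hC.type a b c d hx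
    have h1 := hC.mem _ hx _ (Sym2.mem_mk_left _ _)
    have h2 := hC.mem _ hx _ (Sym2.mem_mk_right _ _)
    have ha : a ∈ vset A := ⟨_, h1, by simp⟩
    have hb : b ∈ vset A := ⟨_, h1, by simp⟩
    have hc : c ∈ vset A := ⟨_, h2, by simp⟩
    have hd : d ∈ vset A := ⟨_, h2, by simp⟩
    exact ⟨t, ht, hty.congr (hG a ha c hc) (hG a ha d hd) (hG b hb c hc) (hG b hb d hd)⟩
  · rintro _ ⟨c, hc, rfl⟩ _ ⟨c', hc', rfl⟩ e he he'
    obtain ⟨e, he₀, rfl⟩ := Sym2.mem_map.1 he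
    obtain ⟨e', he₁, h⟩ := Sym2.mem_map.1 he'
    obtain rfl := Sym2.map.injective hf h
    rw [hC.uniq c hc c' hc' _ he₀ he₁]
  · refine hp.transfer (fun w => some (Sum.map f (Sym2.map (Sym2.map f)) w)) ?_ ?_
    · intro a b c ha hb
      exact (Sum.map_injective.2 ⟨hf, hff⟩) (Option.some_injective _ (ha.trans hb.symm))
    · have hlr : ∀ (u : V') (c : Sym2 (Sym2 V')), c ∈ Sym2.map (Sym2.map f) '' C →
        (∃ e ∈ c, u ∈ e) →
          ∃ u' c', u = f u' ∧ c = Sym2.map (Sym2.map f) c' ∧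
            (plan A C L).Adj (.inl u') (.inr c') := by
        rintro u _ ⟨c, hc, rfl⟩ ⟨e, he, hu⟩
        obtain ⟨e, he₀, rfl⟩ := Sym2.mem_map.1 he
        obtain ⟨u, hu₀, rfl⟩ := Sym2.mem_map.1 hu
        exact ⟨u, c, rfl, rfl, hc, e, he₀, hu₀⟩
      rintro (u | c) (v | d) hab
      · obtain ⟨hne, h | ⟨h, h'⟩⟩ := plan_inl_inl.1 hab
        · obtain ⟨e, he, hee⟩ := h
          obtain ⟨u, -, rfl⟩ := Sym2.mem_map.1 (hee ▸ Sym2.mem_mk_left u v)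
          obtain ⟨v, -, rfl⟩ := Sym2.mem_map.1 (hee ▸ Sym2.mem_mk_right _ v)
          obtain rfl := Sym2.map.injective hf (hee.trans (Sym2.map_mk f _ _).symm)
          exact ⟨.inl u, .inl v, ⟨fun h => hne (congrArg f h), .inl he⟩, rfl, rfl⟩
        · obtain ⟨e, he, hee⟩ := h
          obtain ⟨u, -, rfl⟩ := Sym2.mem_map.1 (hee ▸ Sym2.mem_mk_left u v)
          obtain ⟨v, -, rfl⟩ := Sym2.mem_map.1 (hee ▸ Sym2.mem_mk_right _ v)
          obtain rfl := Sym2.map.injective hf (hee.trans (Sym2.map_mk f _ _).symm)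
          exact ⟨.inl u, .inl v, ⟨fun h => hne (congrArg f h), .inr ⟨he, fun c hc hec =>
            h' _ ⟨c, hc, rfl⟩ (Sym2.mem_map.2 ⟨_, hec, rfl⟩)⟩⟩, rfl, rfl⟩
      · obtain ⟨u', c', rfl, rfl, h⟩ := hlr _ _ hab.1 hab.2
        exact ⟨_, _, h, rfl, rfl⟩
      · obtain ⟨u', c', rfl, rfl, h⟩ := hlr _ _ hab.1 hab.2
        exact ⟨_, _, h.symm, rfl, rfl⟩
      · exact hab.elim

lemma Drawable.comap [Finite V'] {f : V → V'}
    (h : Drawable G' S (Sym2.map f '' A) (Sym2.map f '' L)) (hf : Function.Injective f)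
    (hG : ∀ u ∈ vset A, ∀ v ∈ vset A, G'.Adj (f u) (f v) ↔ G.Adj u v) :
    Drawable G S A L := by
  classical
  obtain ⟨C, hC, hp⟩ := h
  have hf' := Sym2.map.injective hf
  have hff := Sym2.map.injective hf'
  have hmem : ∀ {e}, Sym2.map f e ∈ Sym2.map f '' A → e ∈ A := fun ⟨e', he', h⟩ => hf' h ▸ he'
  have hm : ∀ c, Sym2.map (Sym2.map f) c ∈ C → ∀ e ∈ c, e ∈ A := fun c hc e he =>
    hmem (hC.mem _ hc _ (Sym2.mem_map.2 ⟨e, he, rfl⟩))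
  refine ⟨{c | Sym2.map (Sym2.map f) c ∈ C}, ⟨hm, ?_, ?_, ?_⟩, ?_⟩
  · intro e g h v hv hv'
    exact hC.disj _ _ h (f v) (Sym2.mem_map.2 ⟨v, hv, rfl⟩) (Sym2.mem_map.2 ⟨v, hv', rfl⟩)
  · intro a b c d hx
    obtain ⟨t, ht, hty⟩ := hC.type (f a) (f b) (f c) (f d) hx
    have h1 := hm _ hx _ (Sym2.mem_mk_left _ _)
    have h2 := hm _ hx _ (Sym2.mem_mk_right _ _)
    have ha : a ∈ vset A := ⟨_, h1, by simp⟩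
    have hb : b ∈ vset A := ⟨_, h1, by simp⟩
    have hc : c ∈ vset A := ⟨_, h2, by simp⟩
    have hd : d ∈ vset A := ⟨_, h2, by simp⟩
    exact ⟨t, ht, hty.congr (hG a ha c hc).symm (hG a ha d hd).symm (hG b hb c hc).symm
      (hG b hb d hd).symm⟩
  · intro c hc c' hc' e he he'
    exact hff (hC.uniq _ hc _ hc' _ (Sym2.mem_map.2 ⟨e, he, rfl⟩) (Sym2.mem_map.2 ⟨e, he', rfl⟩))
  · have hF : Function.Injective (Sum.map f (Sym2.map (Sym2.map f))) :=
      Sum.map_injective.2 ⟨hf, hff⟩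
    refine hp.transfer (Function.partialInv (Sum.map f (Sym2.map (Sym2.map f)))) ?_ ?_
    · intro a b c ha hb
      rw [← (hF.isPartialInv c a).1 ha, ← (hF.isPartialInv c b).1 hb]
    · suffices hs : ∀ a b, (plan A {c | Sym2.map (Sym2.map f) c ∈ C} L).Adj a b →
          (plan (Sym2.map f '' A) C (Sym2.map f '' L)).Adj
            (Sum.map f (Sym2.map (Sym2.map f)) a) (Sum.map f (Sym2.map (Sym2.map f)) b) from
        fun a b hab => ⟨_, _, hs a b hab, (hF.isPartialInv _ _).2 rfl,
          (hF.isPartialInv _ _).2 rfl⟩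
      rintro (u | c) (v | d) hab
      · obtain ⟨hne, h | ⟨h, h'⟩⟩ := plan_inl_inl.1 hab
        · exact ⟨fun h => hne (hf h), .inl ⟨_, h, rfl⟩⟩
        · refine ⟨fun h => hne (hf h), .inr ⟨⟨_, h, rfl⟩, fun c hc hec => ?_⟩⟩
          obtain ⟨g, rfl⟩ := exists_other hec
          obtain ⟨g, hg, rfl⟩ := hC.mem _ hc g (by simp)
          exact h' s(s(u, v), g) hc (by simp)
      · obtain ⟨hd, e, he, hu⟩ := hab
        exact ⟨hd, _, Sym2.mem_map.2 ⟨e, he, rfl⟩, Sym2.mem_map.2 ⟨u, hu, rfl⟩⟩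
      · obtain ⟨hd, e, he, hu⟩ := hab
        exact ⟨hd, _, Sym2.mem_map.2 ⟨e, he, rfl⟩, Sym2.mem_map.2 ⟨v, hu, rfl⟩⟩
      · exact hab.elim

lemma Drawable.add_path [Finite V] (h : Drawable G S A L) {u v t : V} (huv : u ≠ v)
    (hL : s(u, v) ∈ L) (ht : t ∉ vset (A ∪ L)) : Drawable G S (A ∪ {s(u, t), s(v, t)}) L := by
  obtain ⟨C, hC, hp⟩ := h
  have htA : ∀ e ∈ A, t ∉ e := fun e he h => ht ⟨e, .inl he, h⟩
  refine ⟨C, ⟨fun c hc e he => .inl (hC.mem c hc e he), hC.disj, hC.type, hC.uniq⟩,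
    (hp.sup_path (u := .inl u) (v := .inl v) (t := .inl t) ⟨huv, .inl hL⟩
      fun h => ht (mem_vset_of_mem_support hC h)).mono ?_⟩
  rintro (a | c) (b | d) hab
  · obtain ⟨hne, h | ⟨h | h, h'⟩⟩ := plan_inl_inl.1 hab
    · exact .inl ⟨hne, .inl h⟩
    · exact .inl ⟨hne, .inr ⟨h, h'⟩⟩
    · refine .inr ?_
      simp only [SimpleGraph.sup_adj, SimpleGraph.edge_adj, Sum.inl.injEq, ne_eq, hne,
        not_false_eq_true, and_true]
      rcases h with h | h <;> rcases Sym2.eq_iff.1 h with h | h <;> tauto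
  · exact .inl hab
  · exact .inl hab
  · exact hab.elim

end

section
variable {ι : Type*} {t : SimpleGraph ι} {x y y' z : ι}

lemma exists_adj_reachable_deleteEdges (ht : t.Connected) (h : z ≠ x) :
    ∃ y, t.Adj x y ∧ (t.deleteEdges {s(x, y)}).Reachable z y := by
  obtain ⟨p, hp⟩ := (ht.preconnected x z).exists_isPath
  cases p with
  | nil => exact absurd rfl h
  | cons hxy p =>
    rename_i y
    rw [SimpleGraph.Walk.cons_isPath_iff] at hp
    refine ⟨y, hxy, SimpleGraph.Reachable.symm ⟨p.toDeleteEdges _ ?_⟩⟩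
    rintro e he rfl
    exact hp.2 (p.fst_mem_support_of_mem_edges he)

lemma reachable_deleteEdges_of_ne (ht : t.IsAcyclic) (hy' : t.Adj x y')
    (hne : y ≠ y') (hz : (t.deleteEdges {s(x, y')}).Reachable z y') :
    (t.deleteEdges {s(x, y)}).Reachable z x := by
  classical
  obtain ⟨p⟩ := hz
  have hx : x ∉ p.support := fun h => SimpleGraph.isBridge_iff.1
    (SimpleGraph.isAcyclic_iff_forall_adj_isBridge.1 ht hy') ⟨p.dropUntil x h⟩
  have hp : (t.deleteEdges {s(x, y)}).Reachable z y' := by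
    refine ⟨(p.mapLe (SimpleGraph.deleteEdges_le _)).toDeleteEdges _ ?_⟩
    rintro e he rfl
    have := SimpleGraph.Walk.fst_mem_support_of_mem_edges _ he
    rw [SimpleGraph.Walk.support_mapLe_eq_support] at this
    exact hx this
  refine hp.trans (SimpleGraph.Adj.reachable ?_)
  rw [SimpleGraph.deleteEdges_adj]
  refine ⟨hy'.symm, fun h => hne ?_⟩
  rcases Sym2.eq_iff.1 (Set.mem_singleton_iff.1 h) with h | h
  exacts [absurd h.1 hy'.ne', h.1.symm]

end

section
variable {V : Type*} {H : SimpleGraph V} {U : Set V} {sd : V → Sym2 V} {L : Set (Sym2 V)}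

/-- In a graph without cutvertices every side is attached to both of its attachment vertices
by a connected piece. -/
lemma IsSide.exists_pieces (hsd : IsSide H U sd) (hcon : ∀ v : V, (H.induce {v}ᶜ).Preconnected)
    (hL : ∀ e ∈ L, ¬ e.IsDiag) (hLU : ∀ e ∈ L, ∀ v ∈ e, v ∈ U)
    (hz : ∀ e ∈ L, ∃ z, z ∉ U ∧ sd z = e) :
    ∃ K : Set V, (∀ z ∈ K, z ∉ U) ∧
      (∀ e ∈ L, (H.induce {z | z ∈ K ∧ sd z = e}).Preconnected) ∧
      ∀ e ∈ L, ∀ u ∈ e, ∃ z ∈ K, sd z = e ∧ H.Adj u z := by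
  classical
  have hz' : ∀ e, ∃ z, e ∈ L → z ∉ U ∧ sd z = e := fun e => by
    by_cases he : e ∈ L
    · obtain ⟨z, hz⟩ := hz e he
      exact ⟨z, fun _ => hz⟩
    · exact ⟨e.out.1, fun h => absurd h he⟩
  choose c hcc using hz'
  have hcU := fun e he => (hcc e he).1
  have hc := fun e he => (hcc e he).2
  let K : Set V := {v | sd v ∈ L ∧ ∃ p : H.Walk v (c (sd v)), ∀ w ∈ p.support, w ∉ U}
  have hKU : ∀ z ∈ K, z ∉ U := fun z hz => by
    obtain ⟨-, p, hp⟩ := hz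
    exact hp z p.start_mem_support
  have hcK : ∀ e ∈ L, c e ∈ K := fun e he => by
    have := hc e he
    refine ⟨this.symm ▸ he, ?_⟩
    rw [this]
    exact ⟨.nil, by simpa using hcU e he⟩
  have hstep : ∀ z ∈ K, ∀ w, H.Adj z w → w ∉ U → w ∈ K ∧ sd w = sd z := by
    intro z hz w hzw hw
    have hs := (hsd hzw (hKU z hz)).2 hw
    obtain ⟨hzL, p, hp⟩ := hz
    refine ⟨⟨hs ▸ hzL, ?_⟩, hs⟩
    rw [hs]
    refine ⟨.cons hzw.symm p, fun y hy => ?_⟩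
    rw [SimpleGraph.Walk.support_cons, List.mem_cons] at hy
    rcases hy with rfl | hy
    exacts [hw, hp y hy]
  refine ⟨K, hKU, fun e he => ?_, fun e he u hu => ?_⟩
  · refine preconnected_induce_of_center (c e) (fun _ => ⟨hcK e he, hc e he⟩) ?_
    rintro y ⟨hyK, hye⟩
    have : ∀ a b (p : H.Walk a b) (ha : a ∈ K) (hae : sd a = e), (∀ w ∈ p.support, w ∉ U) →
        ∃ hb : b ∈ K ∧ sd b = e, (H.induce {z | z ∈ K ∧ sd z = e}).Reachable ⟨a, ha, hae⟩
          ⟨b, hb⟩ := by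
      intro a b p
      induction p with
      | nil => exact fun ha hae _ => ⟨⟨ha, hae⟩, .rfl⟩
      | cons hab p ih =>
        rename_i a b' b
        intro ha hae hp
        rw [SimpleGraph.Walk.support_cons] at hp
        obtain ⟨h1, h2⟩ := hstep a ha b' hab (hp b' (by simp))
        obtain ⟨hb, hr⟩ := ih h1 (h2.trans hae) (fun w hw => hp w (by simp [hw]))
        refine ⟨hb, (SimpleGraph.Adj.reachable (v := ⟨b', h1, h2.trans hae⟩) ?_).trans hr⟩
        exact hab
    obtain ⟨p, hp⟩ := hyK.2
    subst hye
    exact (this _ _ p hyK rfl hp).2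
  · obtain ⟨v, rfl⟩ := hu
    have huv : u ≠ v := fun h => hL _ he (by simpa using h)
    have hv := hLU _ he v (by simp)
    have huU := hLU _ he u (by simp)
    have hne : c s(u, v) ≠ v := fun h => hcU _ he (by rwa [h])
    obtain ⟨p⟩ := hcon v ⟨c s(u, v), hne⟩ ⟨u, huv⟩
    have : ∀ (a b : ({v}ᶜ : Set V)) (p : (H.induce _).Walk a b), a.1 ∈ K → sd a.1 = s(u, v) →
        b.1 = u → ∃ z ∈ K, sd z = s(u, v) ∧ H.Adj u z := by
      intro a b p
      induction p with
      | nil => exact fun ha _ hau => absurd (hau ▸ huU) (hKU _ ha)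
      | cons hab p ih =>
        rename_i a b' b
        intro ha hae hbu
        have hab' : H.Adj a.1 b'.1 := hab
        by_cases hb' : b'.1 ∈ U
        · have := (hsd hab' (hKU _ ha)).1 hb'
          rw [hae, Sym2.mem_iff] at this
          rcases this with h | h
          · exact ⟨a.1, ha, hae, h ▸ hab'.symm⟩
          · exact absurd h b'.2
        · obtain ⟨h1, h2⟩ := hstep _ ha _ hab' hb'
          exact ih h1 (h2.trans hae) hbu
    exact this _ _ p (hcK _ he) (hc _ he) rfl

namespace SPRTree

variable (T : SPRTree H) {x : T.ι}

/-- The vertex `v` lies in the part of the graph represented by the virtual edge `e`. -/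
def InSide {x : T.ι} (e : T.E x) (v : V) : Prop :=
  ∃ q, T.paired ⟨x, e⟩ q ∧ ∃ z, (T.tree.deleteEdges {s(x, q.1)}).Reachable z q.1 ∧
    v ∈ skSupport (T.ends z)

lemma exists_inSide {z : T.ι} (hz : z ≠ x) :
    ∃ e : T.E x, T.IsVirt x e ∧ ∀ v ∈ skSupport (T.ends z), T.InSide e v := by
  obtain ⟨y, hy, hr⟩ := exists_adj_reachable_deleteEdges T.tree_conn hz
  obtain ⟨⟨e, e'⟩, hp, -⟩ := T.tree_edge_pair x y hy
  exact ⟨e, T.paired_virt _ _ hp, fun v hv => ⟨_, hp, z, hr, hv⟩⟩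

variable {T}

lemma InSide.mem_ends {e : T.E x} {v : V} (h : T.InSide e v) (hv : v ∈ skSupport (T.ends x)) :
    v ∈ T.ends x e := by
  obtain ⟨q, hq, z, hz, hvz⟩ := h
  refine T.side_condition ⟨x, e⟩ q hq ⟨?_, ?_⟩
  · simp only [Set.mem_iUnion]
    exact ⟨x, .rfl, hv⟩
  · simp only [Set.mem_iUnion]
    exact ⟨z, hz, hvz⟩

lemma InSide.unique {e e' : T.E x} {v : V} (h : T.InSide e v) (h' : T.InSide e' v)
    (hv : v ∉ skSupport (T.ends x)) : e = e' := by
  obtain ⟨q, hq, z, hz, hvz⟩ := h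
  obtain ⟨q', hq', z', hz', hvz'⟩ := h'
  have ha := T.paired_tree _ _ hq
  have ha' := T.paired_tree _ _ hq'
  by_cases hqq : q.1 = q'.1
  · obtain ⟨y, f⟩ := q
    obtain ⟨y', f'⟩ := q'
    obtain rfl : y = y' := hqq
    have := (T.tree_edge_pair x y ha).unique (y₁ := (e, f)) (y₂ := (e', f')) hq hq'
    exact (Prod.ext_iff.1 this).1
  · refine absurd ⟨e, T.side_condition ⟨x, e⟩ q hq ⟨?_, ?_⟩⟩ hv
    · simp only [Set.mem_iUnion]
      exact ⟨z', reachable_deleteEdges_of_ne T.tree_acyclic ha' hqq hz', hvz'⟩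
    · simp only [Set.mem_iUnion]
      exact ⟨z, hz, hvz⟩

lemma exists_mem_skSupport_of_ne_P {y : T.ι} (hy : T.label y ≠ SPRLabel.P) (e : Sym2 V) :
    ∃ v ∈ skSupport (T.ends y), v ∉ e := by
  have h3 : 3 ≤ (skSupport (T.ends y)).ncard := by
    cases hl : T.label y with
    | S => exact (T.skel_S y hl).2.2.2
    | P => exact absurd hl hy
    | R =>
      have := (T.skel_R y hl).2.1
      rw [Nat.card_coe_set_eq] at this
      exact this.le
  by_contra! h
  have hle : (skSupport (T.ends y)).ncard ≤ 2 := by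
    refine (Set.ncard_le_ncard (t := (e : Set V)) h ?_).trans ?_
    all_goals induction e with | _ a b => ?_
    · rw [Sym2.coe_mk]; exact Set.toFinite _
    · rw [Sym2.coe_mk]; exact (Set.ncard_insert_le _ _).trans (by simp)
  omega

lemma exists_inSide_notMem (hx : T.label x ≠ SPRLabel.P) {e : T.E x} (he : T.IsVirt x e) :
    ∃ v, v ∉ skSupport (T.ends x) ∧ T.InSide e v := by
  obtain ⟨⟨y, f⟩, hq, -⟩ := T.virt_paired ⟨x, e⟩ he
  suffices h : ∃ v, v ∉ T.ends x e ∧ T.InSide e v by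
    obtain ⟨v, hv, hs⟩ := h
    exact ⟨v, fun h => hv (hs.mem_ends h), hs⟩
  by_cases hy : T.label y = SPRLabel.P
  · obtain ⟨⟨u, v, huv, hend⟩, hcard⟩ := T.skel_P y hy
    have : ∃ g : T.E y, g ≠ f ∧ T.IsVirt y g := by
      by_contra! hall
      have hfin : Finite (T.E y) := Nat.finite_of_card_ne_zero (by omega)
      have hle : ({f}ᶜ : Set (T.E y)).ncard ≤ 1 := by
        rw [Set.ncard_le_one_iff]
        intro a b ha hb
        obtain ⟨p, -, hp⟩ := T.real_cover s(u, v) (hend a ▸ T.real_edge y a (hall a ha))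
        have := (hp ⟨y, a⟩ ⟨hall a ha, hend a⟩).trans (hp ⟨y, b⟩ ⟨hall b hb, hend b⟩).symm
        simpa using this
      have := Set.ncard_add_ncard_compl ({f} : Set (T.E y))
      rw [Set.ncard_singleton] at this
      omega
    obtain ⟨g, hgf, hg⟩ := this
    obtain ⟨⟨z, g'⟩, hgp, -⟩ := T.virt_paired ⟨y, g⟩ hg
    have hyx := T.paired_tree _ _ hq
    have hyz := T.paired_tree _ _ hgp
    have hzP : T.label z ≠ SPRLabel.P := fun h => T.no_PP _ _ hyz ⟨hy, h⟩
    obtain ⟨v, hv, hve⟩ := exists_mem_skSupport_of_ne_P hzP (T.ends x e)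
    refine ⟨v, hve, _, hq, z, SimpleGraph.Adj.reachable ?_, hv⟩
    rw [SimpleGraph.deleteEdges_adj]
    refine ⟨hyz.symm, fun h => ?_⟩
    have hzx : z = x := by
      rcases Sym2.eq_iff.1 (Set.mem_singleton_iff.1 h) with h | h
      exacts [h.1, absurd h.1.symm hyz.ne]
    subst hzx
    have := (T.tree_edge_pair y z hyz).unique (y₁ := (g, g')) (y₂ := (f, e)) hgp
      (T.paired_symm _ _ hq)
    exact hgf (Prod.ext_iff.1 this).1
  · obtain ⟨v, hv, hve⟩ := exists_mem_skSupport_of_ne_P hy (T.ends x e)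
    exact ⟨v, hve, _, hq, y, .rfl, hv⟩

/-- The endpoints of the virtual edge of `x` representing the part containing a vertex. -/
noncomputable def side (T : SPRTree H) (x : T.ι) (v : V) : Sym2 V :=
  open Classical in if h : ∃ e : T.E x, T.InSide e v then T.ends x h.choose else s(v, v)

lemma InSide.side_eq {e : T.E x} {v : V} (h : T.InSide e v) (hv : v ∉ skSupport (T.ends x)) :
    T.side x v = T.ends x e := by
  have hex : ∃ e : T.E x, T.InSide e v := ⟨e, h⟩
  rw [side, dif_pos hex, hex.choose_spec.unique h hv]

lemma mem_skSupport_of_real {z : T.ι} {e : T.E z} {u v : V} (h : T.ends z e = s(u, v)) :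
    u ∈ skSupport (T.ends z) ∧ v ∈ skSupport (T.ends z) :=
  ⟨⟨e, h ▸ Sym2.mem_mk_left u v⟩, ⟨e, h ▸ Sym2.mem_mk_right u v⟩⟩

lemma isSide (T : SPRTree H) (x : T.ι) : IsSide H (skSupport (T.ends x)) (T.side x) := by
  intro v w hvw hv
  obtain ⟨⟨z, e⟩, ⟨-, he⟩, -⟩ := T.real_cover s(v, w) hvw
  have hz := mem_skSupport_of_real he
  obtain ⟨g, -, hs⟩ := T.exists_inSide (x := x) (z := z) (fun h => hv (h ▸ hz.1))
  rw [(hs v hz.1).side_eq hv]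
  exact ⟨fun hw => (hs w hz.2).mem_ends hw, fun hw => (hs w hz.2).side_eq hw⟩

/-- The endpoints of the virtual edges of `x`. -/
def virtEnds (T : SPRTree H) (x : T.ι) : Set (Sym2 V) :=
  {f | ∃ e : T.E x, T.IsVirt x e ∧ T.ends x e = f}

/-- The edges of `H` represented by the edges of `x`. -/
def skEdges (T : SPRTree H) (x : T.ι) : Set (Sym2 V) :=
  {f | f ∈ H.edgeSet ∧ ∃ e : T.E x, T.ends x e = f}

lemma skEdges_eq (T : SPRTree H) (x : T.ι) :
    T.skEdges x = {e | e ∈ H.edgeSet ∧ ∀ v ∈ e, v ∈ skSupport (T.ends x)} := by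
  ext f
  refine and_congr_right fun hf => ⟨?_, fun hfx => ?_⟩
  · rintro ⟨e, rfl⟩ v hv
    exact ⟨e, hv⟩
  · obtain ⟨⟨z, e⟩, ⟨-, he⟩, -⟩ := T.real_cover f hf
    by_cases hz : z = x
    · subst hz; exact ⟨e, he⟩
    · induction f with | _ u v => ?_
      have hs := mem_skSupport_of_real he
      obtain ⟨g, -, hin⟩ := T.exists_inSide hz
      have huv : u ≠ v := H.ne_of_adj hf
      exact ⟨g, (Sym2.mem_and_mem_iff huv).1 ⟨(hin u hs.1).mem_ends (hfx u (by simp)),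
        (hin v hs.2).mem_ends (hfx v (by simp))⟩⟩

lemma drawable_skEdges [Finite V] {S : Set CrossingType} (hS : S ⊆ goodTypes)
    (hcon : ∀ v : V, (H.induce {v}ᶜ).Preconnected) (h : Drawable H S H.edgeSet ∅)
    (hx : T.label x ≠ SPRLabel.P) : Drawable H S (T.skEdges x) (T.virtEnds x) := by
  obtain ⟨K, h1, h2, h3⟩ := (T.isSide x).exists_pieces (L := T.virtEnds x) hcon
    (by rintro _ ⟨e, -, rfl⟩; exact T.ends_not_diag x e)
    (by rintro _ ⟨e, -, rfl⟩ v hv; exact ⟨e, hv⟩)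
    (by
      rintro _ ⟨e, he, rfl⟩
      obtain ⟨v, hv, hs⟩ := exists_inSide_notMem hx he
      exact ⟨v, hv, hs.side_eq hv⟩)
  rw [skEdges_eq]
  exact (T.isSide x).drawable hS h h1 (by rintro _ ⟨e, -, rfl⟩ v hv; exact ⟨e, hv⟩) h2 h3

end SPRTree
end

namespace SPRTree
variable {V : Type*} {H : SimpleGraph V} {S : Set CrossingType} {T : SPRTree H} {x : T.ι}

lemma skeletonPlus_inl_inl {u v : V} :
    (T.skeletonPlus x).Adj (.inl u) (.inl v) ↔ s(u, v) ∈ T.skEdges x := by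
  simp only [skeletonPlus, SimpleGraph.fromRel_adj, skEdges, Set.mem_ofPred_eq]
  constructor
  · rintro ⟨-, (⟨a, b, ha, hb, h⟩ | ⟨a, e, -, h, -⟩) | (⟨a, b, ha, hb, h⟩ | ⟨a, e, -, h, -⟩)⟩
    · cases ha; cases hb
      rcases h with ⟨e, he, h⟩ | ⟨e, he, h, h'⟩
      exacts [⟨h ▸ T.real_edge x e he, e, h⟩, ⟨h', e, h⟩]
    · cases h
    · cases ha; cases hb
      rw [Sym2.eq_swap]
      rcases h with ⟨e, he, h⟩ | ⟨e, he, h, h'⟩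
      exacts [⟨h ▸ T.real_edge x e he, e, h⟩, ⟨h', e, h⟩]
    · cases h
  · rintro ⟨hH, e, he⟩
    refine ⟨fun h => ?_, .inl (.inl ⟨u, v, rfl, rfl, ?_⟩)⟩
    · cases h
      exact T.ends_not_diag x e (he ▸ rfl)
    · by_cases hv : T.IsVirt x e
      exacts [.inr ⟨e, hv, he, hH⟩, .inl ⟨e, hv, he⟩]

lemma skeletonPlus_inl_inr {u : V} {e : T.E x} :
    (T.skeletonPlus x).Adj (.inl u) (.inr e) ↔ T.IsVirt x e ∧ u ∈ T.ends x e := by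
  simp only [skeletonPlus, SimpleGraph.fromRel_adj]
  constructor
  · rintro ⟨-, (⟨a, b, ha, hb, h⟩ | ⟨a, e, ha, h, h'⟩) | (⟨a, b, ha, hb, h⟩ | ⟨a, e, ha, h, -⟩)⟩
    · cases hb
    · cases h; cases ha; exact h'
    · cases ha
    · cases h
  · rintro h
    exact ⟨by simp, .inl (.inr ⟨u, e, rfl, rfl, h⟩)⟩

lemma not_skeletonPlus_inr_inr {e f : T.E x} : ¬ (T.skeletonPlus x).Adj (.inr e) (.inr f) := by
  simp [skeletonPlus, SimpleGraph.fromRel_adj]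

lemma vset_skEdges_adj {u v : V} (hu : u ∈ vset (T.skEdges x)) (hv : v ∈ vset (T.skEdges x)) :
    (T.skeletonPlus x).Adj (.inl u) (.inl v) ↔ H.Adj u v := by
  rw [skeletonPlus_inl_inl, skEdges_eq]
  refine ⟨fun h => h.1, fun h => ⟨h, fun w hw => ?_⟩⟩
  rcases Sym2.mem_iff.1 hw with rfl | rfl
  · obtain ⟨_, ⟨-, e, rfl⟩, he⟩ := hu
    exact ⟨e, he⟩
  · obtain ⟨_, ⟨-, e, rfl⟩, he⟩ := hv
    exact ⟨e, he⟩

lemma sRestricted_skeletonPlus [Finite V] [Finite (T.E x)]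
    (h : Drawable H S (T.skEdges x) (T.virtEnds x)) : SRestricted (T.skeletonPlus x) S := by
  classical
  have := Fintype.ofFinite (T.E x)
  have h0 := h.map (f := (Sum.inl : V → V ⊕ T.E x)) Sum.inl_injective
    (G' := T.skeletonPlus x) fun u hu v hv => vset_skEdges_adj hu hv
  have key : ∀ s : Finset (T.E x), Drawable (T.skeletonPlus x) S
      (Sym2.map Sum.inl '' T.skEdges x ∪
        {f | ∃ e ∈ s, T.IsVirt x e ∧ ∃ u ∈ T.ends x e, f = s(.inl u, .inr e)})
      (Sym2.map Sum.inl '' T.virtEnds x) := by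
    intro s
    induction s using Finset.induction_on with
    | empty => convert h0 using 1; ext f; simp
    | insert e s hes ih =>
      by_cases he : T.IsVirt x e
      · obtain ⟨⟨u, v⟩, huv⟩ : ∃ p : V × V, T.ends x e = s(p.1, p.2) :=
          ⟨(T.ends x e).out, by rw [← Prod.mk.eta (p := (T.ends x e).out)]; exact
            (Quot.out_eq _).symm⟩
        have hne : u ≠ v := fun h => T.ends_not_diag x e (by rw [huv, h]; rfl)
        have := ih.add_path (u := Sum.inl u) (v := .inl v) (t := .inr e) (by simpa using hne)
          ⟨_, ⟨e, he, rfl⟩, by rw [huv, Sym2.map_mk]⟩ ?_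
        · convert this using 1
          rw [Set.union_assoc]
          congr 1
          ext f
          simp only [Finset.mem_insert, exists_eq_or_imp, Set.mem_ofPred_eq, he, true_and,
            Set.mem_union, Set.mem_insert_iff, Set.mem_singleton_iff, huv, Sym2.mem_iff,
            exists_eq_left]
          exact or_comm
        · rintro ⟨f, (⟨f, -, rfl⟩ | ⟨e', he', -, w, -, rfl⟩) | ⟨f, -, rfl⟩, hf⟩
          · obtain ⟨w, -, hw⟩ := Sym2.mem_map.1 hf
            cases hw
          · rcases Sym2.mem_iff.1 hf with h | h
            · cases h
            · cases h; exact hes he'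
          · obtain ⟨w, -, hw⟩ := Sym2.mem_map.1 hf
            cases hw
      · convert ih using 3
        ext f
        simp [he]
  refine Drawable.sRestricted (L := Sym2.map Sum.inl '' T.virtEnds x) ?_
  convert key Finset.univ using 1
  ext f
  induction f with | _ a b => ?_
  rw [SimpleGraph.mem_edgeSet]
  constructor
  · intro hab
    rcases a with u | e <;> rcases b with v | g
    · exact .inl ⟨_, skeletonPlus_inl_inl.1 hab, rfl⟩
    · exact .inr ⟨g, by simp, (skeletonPlus_inl_inr.1 hab).1, u,
        (skeletonPlus_inl_inr.1 hab).2, rfl⟩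
    · exact .inr ⟨e, by simp, (skeletonPlus_inl_inr.1 hab.symm).1, v,
        (skeletonPlus_inl_inr.1 hab.symm).2, Sym2.eq_swap⟩
    · exact absurd hab not_skeletonPlus_inr_inr
  · rintro (⟨f, hf, hff⟩ | ⟨e, -, he, u, hu, hf⟩)
    · induction f with | _ u v => ?_
      have := skeletonPlus_inl_inl.2 hf
      rw [Sym2.map_mk] at hff
      rwa [← SimpleGraph.mem_edgeSet, hff] at this
    · have := skeletonPlus_inl_inr.2 ⟨he, hu⟩
      rwa [← SimpleGraph.mem_edgeSet, ← hf] at this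

lemma drawable_of_skeletonPlus [Finite V] [Finite (T.E x)] (hS : S ⊆ goodTypes)
    (hinj : Function.Injective (T.ends x)) (h : SRestricted (T.skeletonPlus x) S) :
    Drawable H S (T.skEdges x) (T.virtEnds x) := by
  classical
  let sd : V ⊕ T.E x → Sym2 (V ⊕ T.E x) := Sum.elim (fun v => s(.inl v, .inl v))
    fun e => Sym2.map .inl (T.ends x e)
  have hsd : IsSide (T.skeletonPlus x) (Set.range Sum.inl) sd := by
    rintro (v | e) (w | f) hvw hv
    · exact absurd ⟨v, rfl⟩ hv
    · exact absurd ⟨v, rfl⟩ hv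
    · exact ⟨fun _ => Sym2.mem_map.2 ⟨w, (skeletonPlus_inl_inr.1 hvw.symm).2, rfl⟩,
        fun h => absurd ⟨w, rfl⟩ h⟩
    · exact absurd hvw not_skeletonPlus_inr_inr
  have := hsd.drawable (K := Sum.inr '' {e | T.IsVirt x e})
    (L := Sym2.map Sum.inl '' T.virtEnds x) hS h.drawable ?_ ?_ ?_ ?_
  · refine Drawable.comap (f := Sum.inl) (G' := T.skeletonPlus x) ?_ Sum.inl_injective
      fun u hu v hv => vset_skEdges_adj hu hv
    convert this using 1
    ext f
    constructor
    · rintro ⟨f, hf, rfl⟩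
      induction f with | _ u v => ?_
      refine ⟨skeletonPlus_inl_inl.2 hf, fun w hw => ?_⟩
      obtain ⟨w, -, rfl⟩ := Sym2.mem_map.1 hw
      exact ⟨w, rfl⟩
    · rintro ⟨hf, hf'⟩
      induction f with | _ u v => ?_
      obtain ⟨u, rfl⟩ := hf' u (by simp)
      obtain ⟨v, rfl⟩ := hf' v (by simp)
      exact ⟨_, skeletonPlus_inl_inl.1 hf, rfl⟩
  · rintro _ ⟨e, -, rfl⟩ ⟨v, hv⟩
    cases hv
  · rintro _ ⟨f, -, rfl⟩ v hv
    obtain ⟨w, -, rfl⟩ := Sym2.mem_map.1 hv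
    exact ⟨w, rfl⟩
  · rintro _ ⟨f, -, rfl⟩ ⟨_, ⟨a, -, rfl⟩, ha⟩ ⟨_, ⟨b, -, rfl⟩, hb⟩
    have hab : T.ends x a = T.ends x b := Sym2.map.injective Sum.inl_injective (ha.trans hb.symm)
    obtain rfl := hinj hab
    exact .rfl
  · rintro _ ⟨_, ⟨e, he, rfl⟩, rfl⟩ u hu
    obtain ⟨u, hu', rfl⟩ := Sym2.mem_map.1 hu
    exact ⟨.inr e, ⟨e, he, rfl⟩, rfl, skeletonPlus_inl_inr.2 ⟨he, hu'⟩⟩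

end SPRTree

section
variable {V : Type*} {G : SimpleGraph V} {S : Set CrossingType}

lemma drawable_induce [Finite V] (h : Drawable G S G.edgeSet ∅) (B : Set V) :
    Drawable (G.induce B) S (G.induce B).edgeSet ∅ := by
  refine Drawable.comap (f := ((↑) : B → V)) (G' := G) ?_ Subtype.val_injective
    fun u _ v _ => Iff.rfl
  refine h.mono ?_ (by simp)
  rintro _ ⟨e, he, rfl⟩
  induction e with | _ u v => exact he

lemma induce_induce_preconnected {B : Set V}
    (h : ∀ v : V, (G.induce (B \ {v})).Preconnected) (v : B) :
    ((G.induce B).induce {v}ᶜ).Preconnected := by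
  rintro ⟨⟨a, ha⟩, hav⟩ ⟨⟨b, hb⟩, hbv⟩
  have h1 : a ∈ B \ {v.1} := ⟨ha, fun h => hav (Subtype.ext h)⟩
  have h2 : b ∈ B \ {v.1} := ⟨hb, fun h => hbv (Subtype.ext h)⟩
  let φ : G.induce (B \ {v.1}) →g (G.induce B).induce {v}ᶜ :=
    ⟨fun w => ⟨⟨w.1, w.2.1⟩, fun h => w.2.2 (congrArg Subtype.val h)⟩, fun h => h⟩
  exact (h v.1 ⟨a, h1⟩ ⟨b, h2⟩).map φ

lemma IsBlock.sRestricted_skeletonPlus [Finite V] (hS : S ⊆ goodTypes) (h : SRestricted G S)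
    {B : Set V} (hB : IsBlock G B) (T : SPRTree (G.induce B)) (x : T.ι)
    (hx : T.label x = SPRLabel.R) : SRestricted (T.skeletonPlus x) S := by
  have : Finite (T.E x) := Finite.of_injective _ (T.skel_R x hx).1
  exact SPRTree.sRestricted_skeletonPlus (SPRTree.drawable_skEdges hS
    (induce_induce_preconnected hB.2.2.1) (drawable_induce h.drawable B) (by simp [hx]))

end

section Torso

variable {V : Type*} {A E : Type*} {en : A → Sym2 V} {ends : E → Sym2 V}

/-- The vertices shared by the edges in `X` and the other edges. -/
def bdry (en : A → Sym2 V) (X : Set A) : Set V :=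
  {v | (∃ a ∈ X, v ∈ en a) ∧ ∃ a ∈ Xᶜ, v ∈ en a}

lemma bdry_compl (X : Set A) : bdry en Xᶜ = bdry en X := by
  ext v
  simp only [bdry, Set.mem_ofPred_eq, compl_compl]
  exact and_comm

/-- Any two complementary nonempty sets of edges share at least two vertices. -/
structure Linked (en : A → Sym2 V) : Prop where
  not_isDiag : ∀ a, ¬ (en a).IsDiag
  not_subset : ∀ X : Set A, X.Nonempty → Xᶜ.Nonempty → ∀ v, ¬ bdry en X ⊆ {v}

/-- Any two complementary nontrivial sets of edges share at least three vertices. -/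
def NoTwoSep (en : A → Sym2 V) : Prop :=
  ∀ X : Set A, X.Nontrivial → Xᶜ.Nontrivial → ∀ e : Sym2 V, ¬ bdry en X ⊆ {v | v ∈ e}

lemma Linked.eq_of_subset (h : Linked en) {X : Set A} (hX : X.Nonempty) (hX' : Xᶜ.Nonempty)
    {e : Sym2 V} (he : bdry en X ⊆ {v | v ∈ e}) (v : V) : v ∈ bdry en X ↔ v ∈ e := by
  refine ⟨fun hv => he hv, fun hv => by_contra fun hv' => ?_⟩
  obtain ⟨w, rfl⟩ := Sym2.mem_iff_exists.1 hv
  refine h.not_subset X hX hX' w fun u hu => ?_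
  rcases Sym2.mem_iff.1 (he hu) with rfl | rfl
  · exact absurd hu hv'
  · rfl

lemma Linked.mem_bdry_singleton (h : Linked en) (hA : ∀ a : A, ∃ b, b ≠ a) (a : A) (v : V) :
    v ∈ bdry en {a} ↔ v ∈ en a := by
  obtain ⟨b, hb⟩ := hA a
  refine h.eq_of_subset (X := {a}) ⟨a, rfl⟩ ⟨b, hb⟩ ?_ v
  rintro w ⟨⟨_, rfl, hw⟩, -⟩
  exact hw

/-- Each edge of `ends` represents a part of a partition of the edges of `en`. -/
structure IsTorso (en : A → Sym2 V) (ends : E → Sym2 V) (π : A → E) : Prop where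
  surj : Function.Surjective π
  mem_ends : ∀ e v, v ∈ ends e ↔ v ∈ bdry en (π ⁻¹' {e})

lemma IsTorso.bdry_eq {π : A → E} (h : IsTorso en ends π) (Y : Set E) :
    bdry ends Y = bdry en (π ⁻¹' Y) := by
  ext v
  constructor
  · rintro ⟨⟨e, he, hv⟩, ⟨e', he', hv'⟩⟩
    obtain ⟨⟨a, rfl, ha⟩, -⟩ := (h.mem_ends e v).1 hv
    obtain ⟨⟨b, rfl, hb⟩, -⟩ := (h.mem_ends e' v).1 hv'
    exact ⟨⟨a, he, ha⟩, ⟨b, he', hb⟩⟩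
  · rintro ⟨⟨a, ha, hva⟩, ⟨b, hb, hvb⟩⟩
    refine ⟨⟨π a, ha, (h.mem_ends _ _).2 ⟨⟨a, rfl, hva⟩, ⟨b, ?_, hvb⟩⟩⟩,
      ⟨π b, hb, (h.mem_ends _ _).2 ⟨⟨b, rfl, hvb⟩, ⟨a, ?_, hva⟩⟩⟩⟩
    · exact fun hab => hb (show π b ∈ Y from (show π b = π a from hab) ▸ ha)
    · exact fun hab => hb (show π b ∈ Y from (show π a = π b from hab) ▸ ha)

lemma IsTorso.linked {π : A → E} (h : IsTorso en ends π) (hen : Linked en) (hE : Nontrivial E) :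
    Linked ends := by
  have key : ∀ X : Set E, X.Nonempty → Xᶜ.Nonempty → ∀ v, ¬ bdry ends X ⊆ {v} := by
    intro X hX hX' v
    rw [h.bdry_eq]
    exact hen.not_subset _ (hX.preimage h.surj) (hX'.preimage h.surj) v
  refine ⟨fun e he => ?_, key⟩
  obtain ⟨f, hf⟩ := exists_ne e
  obtain ⟨v, hv⟩ : ∃ v, ends e = s(v, v) := by
    induction hx : ends e with | _ u w => exact ⟨u, by rw [hx] at he; rw [Sym2.mk_isDiag_iff.1 he]⟩
  refine key {e} ⟨e, rfl⟩ ⟨f, hf⟩ v ?_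
  rintro w ⟨⟨_, rfl, hw⟩, -⟩
  rw [hv] at hw
  simpa using hw

lemma skGraph_adj {u v : V} : (skGraph en).Adj u v ↔ u ≠ v ∧ ∃ a, en a = s(u, v) := by
  simp only [skGraph, SimpleGraph.fromRel_adj, Sym2.eq_swap (a := v), or_self]

/-- Removing `T` from the graph of `en` leaves a connected graph as soon as the edges cannot be
split along `T`. -/
lemma preconnected_induce_sdiff {T : Set V}
    (h : ∀ X : Set A, (∃ a ∈ X, ∃ v ∈ en a, v ∉ T ∧ ∀ b, v ∈ en b → b ∈ X) →
      (∃ a ∈ Xᶜ, ∃ v ∈ en a, v ∉ T ∧ ∀ b, v ∈ en b → b ∈ Xᶜ) → ¬ bdry en X ⊆ T) :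
    ((skGraph en).induce (skSupport en \ T)).Preconnected := by
  rintro ⟨x, ⟨a, ha⟩, hxT⟩ ⟨y, hy, hyT⟩
  let R : Set V := {w | ∃ hw : w ∈ skSupport en \ T,
    ((skGraph en).induce (skSupport en \ T)).Reachable ⟨x, ⟨a, ha⟩, hxT⟩ ⟨w, hw⟩}
  have hxR : x ∈ R := ⟨⟨⟨a, ha⟩, hxT⟩, .rfl⟩
  have hstep : ∀ b u w, u ∈ R → u ∈ en b → w ∈ en b → w ∉ T → w ∈ R := by
    intro b u w hu hub hwb hw
    by_cases huw : u = w
    · exact huw ▸ hu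
    · obtain ⟨hu', hr⟩ := hu
      refine ⟨⟨⟨b, hwb⟩, hw⟩, hr.trans (SimpleGraph.Adj.reachable ?_)⟩
      exact skGraph_adj.2 ⟨huw, b, (Sym2.mem_and_mem_iff huw).1 ⟨hub, hwb⟩⟩
  by_contra hxy
  have hyR : y ∉ R := fun ⟨_, hr⟩ => hxy hr
  obtain ⟨b, hb⟩ := hy
  refine h {c | ∃ u ∈ en c, u ∈ R} ⟨a, ⟨x, ha, hxR⟩, x, ha, hxT, fun c hc => ⟨x, hc, hxR⟩⟩
    ⟨b, ?_, y, hb, hyT, ?_⟩ ?_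
  · rintro ⟨u, hu, huR⟩
    exact hyR (hstep b u y huR hu hb hyT)
  · rintro c hc ⟨u, hu, huR⟩
    exact hyR (hstep c u y huR hu hc hyT)
  · rintro v ⟨⟨c, ⟨u, hu, huR⟩, hv⟩, ⟨d, hd, hv'⟩⟩
    by_contra hvT
    exact hd ⟨v, hv', hstep c u v huR hu hv hvT⟩

lemma Linked.preconnected (h : Linked en) :
    ((skGraph en).induce (skSupport en)).Preconnected := by
  have := preconnected_induce_sdiff (T := ∅) fun X ⟨a, ha, v, _⟩ ⟨b, hb, _⟩ hX =>
    h.not_subset X ⟨a, ha⟩ ⟨b, hb⟩ v (hX.trans (Set.empty_subset _))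
  rwa [Set.sdiff_empty] at this

lemma bdry_pair_subset {a b : A} {e : Sym2 V} (h : ∀ c, c = a ∨ c = b → ∀ v ∈ en c, v ∉ e →
      ∀ d, v ∈ en d → d = a ∨ d = b) : bdry en {a, b} ⊆ {v | v ∈ e} := by
  rintro v ⟨⟨c, hc, hv⟩, ⟨d, hd, hv'⟩⟩
  by_contra hve
  exact hd (h c hc v hv hve d hv')

lemma exists_ne_ne [Finite A] (hA : 3 ≤ Nat.card A) (a b : A) : ∃ c, c ≠ a ∧ c ≠ b := by
  by_contra! h
  have : (Set.univ : Set A) ⊆ {a, b} := fun c _ => by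
    by_cases hc : c = a
    · exact .inl hc
    · exact .inr (h c hc)
  have := Set.ncard_le_ncard this
  have h2 := Set.ncard_insert_le a {b}
  rw [Set.ncard_singleton] at h2
  rw [Set.ncard_univ] at this
  omega

lemma Linked.exists_mem_ne [Finite A] (h : Linked en) (hA : 3 ≤ Nat.card A) {a : A} {v : V}
    (hv : v ∈ en a) :
    ∃ b, b ≠ a ∧ v ∈ en b := by
  have := (h.mem_bdry_singleton (fun a => by
    obtain ⟨b, hb, -⟩ := exists_ne_ne hA a a; exact ⟨b, hb⟩) a v).2 hv
  obtain ⟨-, b, hb, hv⟩ := this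
  exact ⟨b, hb, hv⟩

/-- A linked family of at least three edges in which all vertices have degree two is a cycle. -/
lemma Linked.isCycleSkeleton [Finite A] (h : Linked en) (hA : 3 ≤ Nat.card A)
    (hdeg : ∀ v ∈ skSupport en, {a | v ∈ en a}.ncard = 2) : IsCycleSkeleton en := by
  have hne : Nonempty A := (Nat.card_pos_iff.1 (by omega)).1
  have hinj : Function.Injective en := by
    intro a b hab
    by_contra hne
    obtain ⟨c, hca, hcb⟩ := exists_ne_ne hA a b
    obtain ⟨w, hw⟩ : ∃ w, w ∈ en a := by
      induction en a with | _ u w => exact ⟨u, Sym2.mem_mk_left _ _⟩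
    refine h.not_subset {a, b} ⟨a, .inl rfl⟩ ⟨c, by simp [hca, hcb]⟩ w ?_
    rintro v ⟨⟨d, hd, hv⟩, ⟨f, hf, hv'⟩⟩
    exfalso
    have hva : v ∈ en a := by
      rcases hd with rfl | rfl
      · exact hv
      · rwa [hab]
    have h2 := hdeg v ⟨a, hva⟩
    have : ({a, b, f} : Set A) ⊆ {a | v ∈ en a} := by
      rintro _ (rfl | rfl | rfl)
      · exact hva
      · exact (hab ▸ hva : v ∈ en _)
      · exact hv'
    have hle := Set.ncard_le_ncard this
    simp only [Set.mem_compl_iff, Set.mem_insert_iff, Set.mem_singleton_iff, not_or] at hf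
    rw [Set.ncard_eq_three.2 ⟨a, b, f, hne, Ne.symm hf.1, Ne.symm hf.2, rfl⟩] at hle
    omega
  refine ⟨hinj, ?_, hdeg, ?_⟩
  · obtain ⟨a⟩ := hne
    have : Nonempty (skSupport en) := by
      induction ha : en a with | _ u w => exact ⟨u, a, ha ▸ Sym2.mem_mk_left _ _⟩
    exact ⟨h.preconnected⟩
  · obtain ⟨a⟩ := hne
    obtain ⟨b, hb, -⟩ := exists_ne_ne hA a a
    obtain ⟨w, hw, hwa⟩ : ∃ w ∈ en b, w ∉ en a := by
      by_contra! hcon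
      apply hb
      apply hinj
      have hd := h.not_isDiag b
      induction hx : en b with | _ u w =>
      rw [hx] at hcon hd
      exact ((Sym2.mem_and_mem_iff (fun h => hd (Sym2.mk_isDiag_iff.2 h))).1
        ⟨hcon u (Sym2.mem_mk_left _ _), hcon w (Sym2.mem_mk_right _ _)⟩).symm
    have hd := h.not_isDiag a
    induction hx : en a with | _ u v =>
    rw [hx] at hd hwa
    simp only [Sym2.mem_iff, not_or] at hwa
    have hfin : (skSupport en).Finite := by
      have : skSupport en = ⋃ a, {v | v ∈ en a} := by ext; simp [skSupport]
      rw [this]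
      refine Set.finite_iUnion fun a => ?_
      induction en a with | _ u w =>
      simp only [Sym2.mem_iff]
      exact Set.toFinite {u, w}
    rw [← Set.ncard_eq_three.2 ⟨u, v, w, fun h => hd (Sym2.mk_isDiag_iff.2 h),
      Ne.symm hwa.1, Ne.symm hwa.2, rfl⟩]
    refine Set.ncard_le_ncard ?_ hfin
    rintro _ (rfl | rfl | rfl)
    · exact ⟨a, hx ▸ Sym2.mem_mk_left _ _⟩
    · exact ⟨a, hx ▸ Sym2.mem_mk_right _ _⟩
    · exact ⟨b, hw⟩

end Torso

section Torso

variable {V : Type*} {A E : Type*} {en : A → Sym2 V} {ends : E → Sym2 V}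

lemma eq_of_forall_mem {e f : Sym2 V} (he : ¬ e.IsDiag) (h : ∀ v ∈ e, v ∈ f) : e = f := by
  induction e with | _ u w =>
  exact ((Sym2.mem_and_mem_iff (fun h => he (Sym2.mk_isDiag_iff.2 h))).1
    ⟨h u (Sym2.mem_mk_left _ _), h w (Sym2.mem_mk_right _ _)⟩).symm

lemma finite_skSupport [Finite A] (en : A → Sym2 V) : (skSupport en).Finite := by
  have : skSupport en = ⋃ a, {v | v ∈ en a} := by ext; simp [skSupport]
  rw [this]
  refine Set.finite_iUnion fun a => ?_
  induction en a with | _ u w =>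
  simp only [Sym2.mem_iff]
  exact Set.toFinite {u, w}

lemma exists_subset_sym2 {T : Set V} (hT : T.Finite) (h : T.ncard < 3) (hV : Nonempty V) :
    ∃ e : Sym2 V, T ⊆ {v | v ∈ e} := by
  obtain ⟨v⟩ := hV
  have h3 : T.ncard = 0 ∨ T.ncard = 1 ∨ T.ncard = 2 := by omega
  rcases h3 with h | h | h
  · exact ⟨s(v, v), by rw [(Set.ncard_eq_zero hT).1 h]; exact Set.empty_subset _⟩
  · obtain ⟨a, rfl⟩ := Set.ncard_eq_one.1 h
    exact ⟨s(a, a), by rintro _ rfl; exact Sym2.mem_mk_left _ _⟩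
  · obtain ⟨a, b, -, rfl⟩ := Set.ncard_eq_two.1 h
    exact ⟨s(a, b), by rintro _ (rfl | rfl) <;> simp⟩

lemma Linked.isRSkeleton [Finite A] (h : Linked en) (hsep : NoTwoSep en)
    (hA : 3 ≤ Nat.card A) (hinj : Function.Injective en)
    (hdeg : ∀ v ∈ skSupport en, ∀ a b, ∃ c, c ≠ a ∧ c ≠ b ∧ v ∈ en c) : IsRSkeleton en := by
  have hne : Nonempty A := (Nat.card_pos_iff.1 (by omega)).1
  have hcard : 3 < Nat.card (skSupport en) := by
    obtain ⟨a⟩ := hne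
    obtain ⟨v, hv⟩ : ∃ v, v ∈ en a := by
      induction en a with | _ u w => exact ⟨u, Sym2.mem_mk_left _ _⟩
    obtain ⟨b, hba, -, hb⟩ := hdeg v ⟨a, hv⟩ a a
    obtain ⟨c, hca, hcb, hc⟩ := hdeg v ⟨a, hv⟩ a b
    obtain ⟨x, hx⟩ := Sym2.mem_iff_exists.1 hv
    obtain ⟨y, hy⟩ := Sym2.mem_iff_exists.1 hb
    obtain ⟨z, hz⟩ := Sym2.mem_iff_exists.1 hc
    have hd := h.not_isDiag
    have hvx : v ≠ x := fun h => hd a (by rw [hx, h]; simp)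
    have hvy : v ≠ y := fun h => hd b (by rw [hy, h]; simp)
    have hvz : v ≠ z := fun h => hd c (by rw [hz, h]; simp)
    have hxy : x ≠ y := fun h => hba (hinj (by rw [hx, hy, h]))
    have hxz : x ≠ z := fun h => hca (hinj (by rw [hx, hz, h]))
    have hyz : y ≠ z := fun h => hcb (hinj (by rw [hy, hz, h]))
    rw [Nat.card_coe_set_eq]
    have hs : ({v, x, y, z} : Set V) ⊆ skSupport en := by
      rintro _ (rfl | rfl | rfl | rfl)
      · exact ⟨a, hv⟩
      · exact ⟨a, by simp [hx]⟩
      · exact ⟨b, by simp [hy]⟩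
      · exact ⟨c, by simp [hz]⟩
    have := Set.ncard_le_ncard hs (finite_skSupport en)
    rw [Set.ncard_insert_of_notMem (by simp [hvx, hvy, hvz]),
      Set.ncard_eq_three.2 ⟨x, y, z, hxy, hxz, hyz, rfl⟩] at this
    omega
  refine ⟨hinj, hcard, fun T hT => ?_⟩
  have hfin := finite_skSupport en
  have : Finite (skSupport en) := hfin
  have : Nonempty (Tᶜ : Set (skSupport en)) := by
    by_contra hcon
    rw [Set.nonempty_coe_sort, Set.not_nonempty_iff_eq_empty, Set.compl_empty_iff] at hcon
    rw [hcon, Set.ncard_univ] at hT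
    omega
  have hpre : ((skGraph en).induce (skSupport en \ ((↑) '' T))).Preconnected := by
    refine preconnected_induce_sdiff ?_
    have aux : ∀ X : Set A, (∃ a ∈ X, ∃ v ∈ en a, v ∉ ((↑) '' T : Set V) ∧ ∀ b, v ∈ en b → b ∈ X) →
        X.Nontrivial := by
      rintro X ⟨a, ha, v, hv, -, hX⟩
      obtain ⟨b, hb, -, hvb⟩ := hdeg v ⟨a, hv⟩ a a
      exact ⟨a, ha, b, hX b hvb, hb.symm⟩
    intro X hX hX' hcon
    obtain ⟨e, he⟩ := exists_subset_sym2 (T := ((↑) '' T : Set V)) (T.toFinite.image _)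
      (by rwa [Set.ncard_image_of_injective _ Subtype.val_injective]) (by
        obtain ⟨a, -, v, -⟩ := hX; exact ⟨v⟩)
    exact hsep X (aux X hX) (aux _ hX') e (hcon.trans he)
  refine ⟨?_⟩
  rintro ⟨⟨a, ha⟩, haT⟩ ⟨⟨b, hb⟩, hbT⟩
  let φ : (skGraph en).induce (skSupport en \ ((↑) '' T)) →g
      ((skGraph en).induce (skSupport en)).induce Tᶜ :=
    ⟨fun v => ⟨⟨v.1, v.2.1⟩, fun h => v.2.2 ⟨_, h, rfl⟩⟩, fun h => h⟩
  have mem : ∀ x (hx : x ∈ skSupport en), (⟨x, hx⟩ : skSupport en) ∈ Tᶜ →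
      x ∈ skSupport en \ ((↑) '' T) := by
    rintro x hx hxT
    refine ⟨hx, ?_⟩
    rintro ⟨y, hy, rfl⟩
    exact hxT hy
  exact (hpre ⟨a, mem a ha haT⟩ ⟨b, mem b hb hbT⟩).map φ

lemma subsingleton_compl_pair (hsep : NoTwoSep en) {a b : A} (hab : a ≠ b) {e : Sym2 V}
    (h : bdry en {a, b} ⊆ {v | v ∈ e}) : ({a, b}ᶜ : Set A).Subsingleton := by
  by_contra hcon
  exact hsep {a, b} ⟨a, .inl rfl, b, .inr rfl, hab⟩ (Set.not_subsingleton_iff.1 hcon) e h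

/-- Tutte's trichotomy: a linked family of edges without 2-separations is a dipole, a cycle or
a simple 3-connected graph. -/
theorem Linked.trichotomy [Finite A] (h : Linked en) (hsep : NoTwoSep en) (hA : 3 ≤ Nat.card A) :
    (∃ e, ∀ a, en a = e) ∨ (∀ v ∈ skSupport en, {a | v ∈ en a}.ncard = 2) ∨ IsRSkeleton en := by
  by_cases hinj : Function.Injective en
  swap
  · left
    simp only [Function.Injective, not_forall] at hinj
    obtain ⟨a, b, hab, hne⟩ := hinj
    have hs := subsingleton_compl_pair hsep hne (e := en a) (bdry_pair_subset (by
      rintro c (rfl | rfl) v hv hve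
      · exact absurd hv hve
      · exact absurd (hab ▸ hv) hve))
    refine ⟨en a, fun c => eq_of_forall_mem (h.not_isDiag c) fun v hv => ?_⟩
    by_cases hc : c ∈ ({a, b} : Set A)
    · rcases hc with rfl | rfl
      · exact hv
      · exact hab ▸ hv
    · obtain ⟨d, hdc, hd⟩ := h.exists_mem_ne hA hv
      have : d ∈ ({a, b} : Set A) := by
        by_contra hd'
        exact hdc (hs hd' hc)
      rcases this with rfl | rfl
      · exact hd
      · exact hab ▸ hd
  right
  by_cases hdeg : ∀ v ∈ skSupport en, ∀ a b, ∃ c, c ≠ a ∧ c ≠ b ∧ v ∈ en c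
  · exact .inr (h.isRSkeleton hsep hA hinj hdeg)
  left
  push Not at hdeg
  obtain ⟨v, ⟨a', ha'⟩, a, b, hv⟩ := hdeg
  obtain ⟨b', hb'a', hb'⟩ := h.exists_mem_ne hA ha'
  obtain ⟨a, b, hab, ha, hb, hv⟩ : ∃ a b, a ≠ b ∧ v ∈ en a ∧ v ∈ en b ∧
      ∀ c, v ∈ en c → c = a ∨ c = b := by
    refine ⟨a', b', hb'a'.symm, ha', hb', fun c hc => ?_⟩
    have h1 := fun c (hc : v ∈ en c) => show c = a ∨ c = b by
      by_contra! hcon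
      exact hv c hcon.1 hcon.2 hc
    have := h1 c hc
    have := h1 _ ha'
    have := h1 _ hb'
    grind
  obtain ⟨x, hx⟩ := Sym2.mem_iff_exists.1 ha
  obtain ⟨y, hy⟩ := Sym2.mem_iff_exists.1 hb
  have hxy : x ≠ y := fun h => hab (hinj (by rw [hx, hy, h]))
  have hs := subsingleton_compl_pair hsep hab (e := s(x, y)) (bdry_pair_subset (by
    rintro c hc w hw hwe d hd
    have : w = v := by
      simp only [Sym2.mem_iff, not_or] at hwe
      rcases hc with rfl | rfl
      · rw [hx] at hw
        exact (Sym2.mem_iff.1 hw).resolve_right hwe.1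
      · rw [hy] at hw
        exact (Sym2.mem_iff.1 hw).resolve_right hwe.2
    exact hv d (this ▸ hd)))
  obtain ⟨c, hca, hcb⟩ := exists_ne_ne hA a b
  have huniv : (Set.univ : Set A) ⊆ {a, b, c} := fun d _ => by
    by_cases hd : d ∈ ({a, b} : Set A)
    · rcases hd with rfl | rfl <;> simp
    · rw [hs hd (by simp [hca, hcb] : c ∈ ({a, b}ᶜ : Set A))]
      simp
  intro w ⟨d, hd⟩
  obtain ⟨d', hd'd, hd'⟩ := h.exists_mem_ne hA hd
  refine le_antisymm ?_ ((Set.one_lt_ncard (Set.toFinite _)).2 ⟨d, hd, d', hd', hd'd.symm⟩)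
  have hlt : {a | w ∈ en a}.ncard < (Set.univ : Set A).ncard := by
    refine Set.ncard_lt_ncard (Set.ssubset_univ_iff.2 fun hall => ?_)
    have hwa : w ∈ en a := by rw [Set.eq_univ_iff_forall] at hall; exact hall a
    have hwb : w ∈ en b := by rw [Set.eq_univ_iff_forall] at hall; exact hall b
    have hwc : w ∈ en c := by rw [Set.eq_univ_iff_forall] at hall; exact hall c
    rw [hx, Sym2.mem_iff] at hwa
    rw [hy, Sym2.mem_iff] at hwb
    have : w = v := by
      rcases hwa with h | rfl
      · exact h
      · exact hwb.resolve_right hxy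
    subst this
    rcases hv c hwc with h | h
    · exact hca h
    · exact hcb h
  have hle := Set.ncard_le_ncard huniv
  have h1 := Set.ncard_insert_le a {b, c}
  have h2 := Set.ncard_insert_le b {c}
  rw [Set.ncard_singleton] at h2
  omega

end Torso

section Laminar

variable {V : Type*} {A : Type} {en : A → Sym2 V} {r : A} {F : Set (Set A)} {C D X Y : Set A}

/-- A laminar family of 2-separations, rooted at the edge `r`. -/
structure IsSepFamily (en : A → Sym2 V) (r : A) (F : Set (Set A)) : Prop where
  root : {r}ᶜ ∈ F
  single : ∀ a, a ≠ r → {a} ∈ F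
  notMem : ∀ X ∈ F, r ∉ X
  nonempty : ∀ X ∈ F, X.Nonempty
  bdry_subset : ∀ X ∈ F, ∃ e : Sym2 V, bdry en X ⊆ {v | v ∈ e}
  laminar : ∀ X ∈ F, ∀ Y ∈ F, ∀ a ∈ X, a ∈ Y → X ⊆ Y ∨ Y ⊂ X

/-- `D` is the smallest member of `F` above `X`. -/
def IsChild (F : Set (Set A)) (X D : Set A) : Prop :=
  X ∈ F ∧ D ∈ F ∧ X ⊂ D ∧ ∀ Y ∈ F, X ⊂ Y → D ⊆ Y

/-- The edges of the node `D`, each given as the set of edges it represents. -/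
def slots (F : Set (Set A)) (D : Set A) : Set (Set A) := {X | IsChild F X D ∨ X = Dᶜ}

/-- The endpoints of the virtual edge representing `X`. -/
noncomputable def ends (en : A → Sym2 V) (r : A) (X : Set A) : Sym2 V :=
  open Classical in if h : ∃ e : Sym2 V, ∀ v, v ∈ bdry en X ↔ v ∈ e then h.choose else en r

lemma mem_ends (h : ∃ e : Sym2 V, ∀ v, v ∈ bdry en X ↔ v ∈ e) (v : V) :
    v ∈ ends en r X ↔ v ∈ bdry en X := by
  rw [ends, dif_pos h]
  exact (h.choose_spec v).symm

lemma ends_compl (X : Set A) : ends en r Xᶜ = ends en r X := by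
  unfold ends
  rw [bdry_compl]

lemma IsChild.unique (h : IsChild F X C) (h' : IsChild F X D) : C = D :=
  (h.2.2.2 D h'.2.1 h'.2.2.1).antisymm (h'.2.2.2 C h.2.1 h.2.2.1)

namespace IsSepFamily

lemma mem_ends (hF : IsSepFamily en r F) (hen : Linked en) (hX : X ∈ F) (v : V) :
    v ∈ ends en r X ↔ v ∈ bdry en X := by
  obtain ⟨e, he⟩ := hF.bdry_subset X hX
  exact OnePlanarity.mem_ends ⟨e, hen.eq_of_subset (hF.nonempty X hX) ⟨r, hF.notMem X hX⟩ he⟩ v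

lemma subset_root (hF : IsSepFamily en r F) (hX : X ∈ F) : X ⊆ {r}ᶜ :=
  fun _ ha har => hF.notMem X hX (har ▸ ha)

lemma exists_parent (hF : IsSepFamily en r F) [Finite A] (hX : X ∈ F) (hXr : X ≠ {r}ᶜ) :
    ∃ D, IsChild F X D := by
  obtain ⟨D, ⟨hD, hXD⟩, hmin⟩ := (Set.toFinite {D | D ∈ F ∧ X ⊂ D}).exists_minimal
    ⟨_, hF.root, (hF.subset_root hX).ssubset_of_ne hXr⟩
  refine ⟨D, hX, hD, hXD, fun Y hY hXY => ?_⟩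
  obtain ⟨a, ha⟩ := hF.nonempty X hX
  rcases hF.laminar D hD Y hY a (hXD.1 ha) (hXY.1 ha) with h | h
  · exact h
  · exact hmin ⟨hY, hXY⟩ h.1

lemma nontrivial_of_isChild (hF : IsSepFamily en r F) (h : IsChild F X D) : D.Nontrivial := by
  obtain ⟨a, ha⟩ := hF.nonempty X h.1
  obtain ⟨b, hb, hbX⟩ := Set.exists_of_ssubset h.2.2.1
  exact ⟨a, h.2.2.1.1 ha, b, hb, fun h => hbX (h ▸ ha)⟩

lemma exists_child (hF : IsSepFamily en r F) [Finite A] (hD : D ∈ F) (hD' : D.Nontrivial) {a : A}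
    (ha : a ∈ D) :
    ∃ X, IsChild F X D ∧ a ∈ X := by
  have har : a ≠ r := fun h => hF.notMem D hD (h ▸ ha)
  obtain ⟨X, ⟨hX, haX, hXD⟩, hmax⟩ := (Set.toFinite {X | X ∈ F ∧ a ∈ X ∧ X ⊂ D}).exists_maximal
    ⟨{a}, hF.single a har, rfl, by
      obtain ⟨b, hb, hba⟩ := hD'.exists_ne a
      exact ⟨Set.singleton_subset_iff.2 ha, fun h => hba (h hb)⟩⟩
  refine ⟨X, ⟨hX, hD, hXD, fun Y hY hXY => ?_⟩, haX⟩
  rcases hF.laminar D hD Y hY a ha (hXY.1 haX) with h | h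
  · exact h
  · exact absurd (hmax ⟨hY, hXY.1 haX, h⟩ hXY.1) hXY.2

lemma slot_unique (hF : IsSepFamily en r F) (hX : X ∈ slots F D) (hY : Y ∈ slots F D) {a : A}
    (ha : a ∈ X)
    (ha' : a ∈ Y) : X = Y := by
  rcases hX with hX | rfl <;> rcases hY with hY | rfl
  · rcases hF.laminar X hX.1 Y hY.1 a ha ha' with h | h
    · rcases h.eq_or_ssubset with h | h
      · exact h
      · exact absurd (hX.2.2.2 Y hY.1 h) hY.2.2.1.2
    · exact absurd (hY.2.2.2 X hX.1 h) hX.2.2.1.2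
  · exact absurd (hX.2.2.1.1 ha) ha'
  · exact absurd (hY.2.2.1.1 ha') ha
  · rfl

lemma exists_slot (hF : IsSepFamily en r F) [Finite A] (hD : D ∈ F) (hD' : D.Nontrivial) (a : A) :
    ∃ X ∈ slots F D, a ∈ X := by
  by_cases ha : a ∈ D
  · obtain ⟨X, hX, haX⟩ := hF.exists_child hD hD' ha
    exact ⟨X, .inl hX, haX⟩
  · exact ⟨_, .inr rfl, ha⟩

lemma nonempty_of_slot (hF : IsSepFamily en r F) (hD : D ∈ F) (hX : X ∈ slots F D) :
    X.Nonempty := by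
  rcases hX with hX | rfl
  · exact hF.nonempty X hX.1
  · exact ⟨r, hF.notMem D hD⟩

lemma mem_ends_slot (hF : IsSepFamily en r F) (hen : Linked en) (hD : D ∈ F) (hX : X ∈ slots F D)
    (v : V) :
    v ∈ ends en r X ↔ v ∈ bdry en X := by
  rcases hX with hX | rfl
  · exact hF.mem_ends hen hX.1 v
  · rw [ends_compl, bdry_compl, hF.mem_ends hen hD]

/-- The slot of `D` containing a given edge. -/
lemma exists_isTorso (hF : IsSepFamily en r F) [Finite A] (hen : Linked en) (hD : D ∈ F)
    (hD' : D.Nontrivial) :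
    ∃ π : A → slots F D, (∀ a, a ∈ (π a : Set A)) ∧ (∀ X, π ⁻¹' {X} = X) ∧
      IsTorso en (fun X : slots F D => ends en r X) π := by
  choose f hf hf' using hF.exists_slot hD hD'
  have h1 : ∀ X : slots F D, (fun a => (⟨f a, hf a⟩ : slots F D)) ⁻¹' {X} = X := by
    intro X
    ext a
    simp only [Set.mem_preimage, Set.mem_singleton_iff]
    refine ⟨fun h => ?_, fun h => Subtype.ext (hF.slot_unique (hf a) X.2 (hf' a) h)⟩
    rw [← h]
    exact hf' a
  refine ⟨fun a => ⟨f a, hf a⟩, hf', h1, fun X => ?_, fun X v => ?_⟩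
  · obtain ⟨a, ha⟩ := hF.nonempty_of_slot hD X.2
    exact ⟨a, by have := h1 X; rw [Set.ext_iff] at this; exact (this a).2 ha⟩
  · rw [h1, hF.mem_ends_slot hen hD X.2]

lemma three_le_card_slots (hF : IsSepFamily en r F) [Finite A] (hD : D ∈ F) (hD' : D.Nontrivial) :
    3 ≤ Nat.card (slots F D) := by
  obtain ⟨a, ha⟩ := hF.nonempty D hD
  obtain ⟨X, hX, haX⟩ := hF.exists_child hD hD' ha
  obtain ⟨b, hb, hbX⟩ := Set.exists_of_ssubset hX.2.2.1
  obtain ⟨Y, hY, hbY⟩ := hF.exists_child hD hD' hb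
  rw [Nat.card_coe_set_eq, ← Set.ncard_eq_three.2 ⟨X, Y, Dᶜ, ?_, ?_, ?_, rfl⟩]
  · refine Set.ncard_le_ncard ?_
    rintro _ (rfl | rfl | rfl)
    · exact .inl hX
    · exact .inl hY
    · exact .inr rfl
  · rintro rfl
    exact hbX hbY
  · rintro rfl
    exact absurd ha haX
  · rintro rfl
    exact absurd hb hbY

lemma linked_slots (hF : IsSepFamily en r F) [Finite A] (hen : Linked en) (hD : D ∈ F)
    (hD' : D.Nontrivial) :
    Linked (fun X : slots F D => ends en r X) := by
  obtain ⟨π, -, -, hπ⟩ := hF.exists_isTorso hen hD hD'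
  have := hF.three_le_card_slots hD hD'
  exact hπ.linked hen (Finite.one_lt_card_iff_nontrivial.1 (by omega))

/-- The nodes of a maximal family have no further 2-separation. -/
lemma noTwoSep_of_maximal (hF : IsSepFamily en r F) [Finite A] (hen : Linked en)
    (hmax : ∀ F', IsSepFamily en r F' → F ⊆ F' → F' ⊆ F) (hD : D ∈ F) (hD' : D.Nontrivial) :
    NoTwoSep (fun X : slots F D => ends en r X) := by
  obtain ⟨π, hπ, hπ', hT⟩ := hF.exists_isTorso hen hD hD'
  suffices H : ∀ Y : Set (slots F D), (⟨Dᶜ, .inr rfl⟩ : slots F D) ∉ Y → Y.Nontrivial →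
      Yᶜ.Nontrivial → ∀ e : Sym2 V,
        ¬ bdry (fun X : slots F D => ends en r X) Y ⊆ {v | v ∈ e} by
    intro Y hY hY' e
    by_cases hup : (⟨Dᶜ, .inr rfl⟩ : slots F D) ∈ Y
    · rw [← bdry_compl]
      exact H Yᶜ (fun h => h hup) hY' (by rwa [compl_compl]) e
    · exact H Y hup hY hY' e
  intro Y hup hY hY' e he
  rw [hT.bdry_eq] at he
  have hsub : ∀ X : slots F D, X ∈ Y → (X : Set A) ⊆ π ⁻¹' Y := by
    intro X hX a ha
    rw [← hπ' X] at ha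
    rw [Set.mem_preimage, show π a = X from ha]
    exact hX
  have hdisj : ∀ X : slots F D, X ∉ Y → ∀ a ∈ (X : Set A), a ∉ π ⁻¹' Y := by
    intro X hX a ha haY
    rw [← hπ' X] at ha
    rw [Set.mem_preimage, show π a = X from ha] at haY
    exact hX haY
  have hYD : π ⁻¹' Y ⊂ D := by
    constructor
    · intro a ha
      by_contra haD
      exact hdisj _ hup a haD ha
    · obtain ⟨X, hX, hne⟩ := hY'.exists_ne ⟨Dᶜ, .inr rfl⟩
      obtain ⟨a, ha⟩ := hF.nonempty_of_slot hD X.2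
      intro h
      refine hdisj X hX a ha (h ?_)
      rcases X.2 with hX' | hX'
      · exact hX'.2.2.1.1 ha
      · exact absurd (Subtype.ext hX') hne
  have hne : (π ⁻¹' Y).Nonempty := hY.nonempty.preimage hT.surj
  have hlam : ∀ Z ∈ F, (∃ a ∈ Z, a ∈ π ⁻¹' Y) → Z ⊆ π ⁻¹' Y ∨ D ⊆ Z := by
    rintro Z hZ ⟨a, haZ, ha⟩
    rcases hF.laminar D hD Z hZ a (hYD.1 ha) haZ with h | h
    · exact .inr h
    left
    rcases (π a).2 with hX | hX
    · rcases hF.laminar _ hZ _ hX.1 a haZ (hπ a) with h' | h'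
      · exact h'.trans (hsub _ ha)
      · exact absurd (hX.2.2.2 Z hZ h') h.2
    · exact absurd (show π a ∈ Y from ha) (by rwa [show π a = ⟨Dᶜ, .inr rfl⟩ from Subtype.ext hX])
  have hfam : IsSepFamily en r (insert (π ⁻¹' Y) F) := by
    refine ⟨.inr hF.root, fun a ha => .inr (hF.single a ha), ?_, ?_, ?_, ?_⟩
    · rintro X (rfl | hX)
      · exact fun h => hF.notMem D hD (hYD.1 h)
      · exact hF.notMem X hX
    · rintro X (rfl | hX)
      · exact hne
      · exact hF.nonempty X hX
    · rintro X (rfl | hX)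
      · exact ⟨e, he⟩
      · exact hF.bdry_subset X hX
    · rintro X (rfl | hX) Z (rfl | hZ) a haX haZ
      · exact .inl subset_rfl
      · rcases hlam Z hZ ⟨a, haZ, haX⟩ with h | h
        · rcases h.eq_or_ssubset with h | h
          · exact .inl h.ge
          · exact .inr h
        · exact .inl (hYD.1.trans h)
      · rcases hlam X hX ⟨a, haX, haZ⟩ with h | h
        · exact .inl h
        · exact .inr (hYD.trans_subset h)
      · exact hF.laminar X hX Z hZ a haX haZ
  have hYF := hmax _ hfam (Set.subset_insert _ _) (Set.mem_insert _ _)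
  obtain ⟨X, hX, X', hX', hXX⟩ := hY
  rcases X.2 with hXc | hXc
  · refine hYD.2 (hXc.2.2.2 _ hYF ⟨hsub X hX, fun h => ?_⟩)
    obtain ⟨a, ha⟩ := hF.nonempty_of_slot hD X'.2
    exact hXX (Subtype.ext (hF.slot_unique X.2 X'.2 (h (hsub X' hX' ha)) ha))
  · exact hup ((show X = ⟨Dᶜ, .inr rfl⟩ from Subtype.ext hXc) ▸ hX)

end IsSepFamily

end Laminar

section Laminar

variable {V : Type*} {A : Type} {en : A → Sym2 V} {r : A} {F : Set (Set A)} {C D X Y : Set A}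

/-- All edges of the node with the given slots are parallel. -/
def IsDipoleNode (en : A → Sym2 V) (r : A) (s : Set (Set A)) : Prop :=
  ∃ e, ∀ X ∈ s, ends en r X = e

/-- All vertices of the node with the given slots have degree two. -/
def IsCycleNode (en : A → Sym2 V) (r : A) (s : Set (Set A)) : Prop :=
  ∀ v, (∃ X ∈ s, v ∈ ends en r X) → {X | X ∈ s ∧ v ∈ ends en r X}.ncard = 2

/-- A family of 2-separations whose nodes are dipoles, cycles or 3-connected. -/
structure IsDecomposition (en : A → Sym2 V) (r : A) (F : Set (Set A)) : Prop extends
    IsSepFamily en r F where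
  node : ∀ D ∈ F, D.Nontrivial → IsDipoleNode en r (slots F D) ∨ IsCycleNode en r (slots F D) ∨
    IsRSkeleton (fun X : slots F D => ends en r X)

lemma bdry_singleton_subset (a : A) : bdry en {a} ⊆ {v | v ∈ en a} := by
  rintro v ⟨⟨_, rfl, hv⟩, -⟩
  exact hv

lemma isSepFamily_singletons [Finite A] (hA : 3 ≤ Nat.card A) (r : A) :
    IsSepFamily en r {X | X = {r}ᶜ ∨ ∃ a, a ≠ r ∧ X = {a}} := by
  refine ⟨.inl rfl, fun a ha => .inr ⟨a, ha, rfl⟩, ?_, ?_, ?_, ?_⟩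
  · rintro _ (rfl | ⟨a, ha, rfl⟩) h
    · exact h rfl
    · exact ha h.symm
  · rintro _ (rfl | ⟨a, ha, rfl⟩)
    · obtain ⟨b, hb, -⟩ := exists_ne_ne hA r r
      exact ⟨b, hb⟩
    · exact ⟨a, rfl⟩
  · rintro _ (rfl | ⟨a, ha, rfl⟩)
    · exact ⟨en r, bdry_compl (en := en) {r} ▸ bdry_singleton_subset r⟩
    · exact ⟨en a, bdry_singleton_subset a⟩
  · rintro _ (rfl | ⟨a, ha, rfl⟩) _ (rfl | ⟨b, hb, rfl⟩) c hc hc'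
    · exact .inl subset_rfl
    · refine .inr ⟨Set.singleton_subset_iff.2 hb, fun h => ?_⟩
      obtain ⟨d, hdr, hdb⟩ := exists_ne_ne hA r b
      exact hdb (h hdr)
    · exact .inl (Set.singleton_subset_iff.2 ha)
    · rw [Set.mem_singleton_iff] at hc hc'
      rw [← hc, hc']
      exact .inl subset_rfl

lemma isCycleNode_iff {s : Set (Set A)} : IsCycleNode en r s ↔
    ∀ v ∈ skSupport (fun X : s => ends en r X), {X : s | v ∈ ends en r X}.ncard = 2 := by
  refine forall_congr' fun v => ?_
  have h1 : v ∈ skSupport (fun X : s => ends en r X) ↔ ∃ X ∈ s, v ∈ ends en r X := by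
    simp [skSupport]
  have h2 : {X | X ∈ s ∧ v ∈ ends en r X}.ncard = {X : s | v ∈ ends en r X}.ncard := by
    rw [← Set.ncard_image_of_injective _ Subtype.val_injective]
    congr 1
    ext X
    simp [and_comm]
  rw [h1, h2]

lemma exists_isDecomposition [Finite A] (hen : Linked en) (hA : 3 ≤ Nat.card A) (r : A) :
    ∃ F, IsDecomposition en r F := by
  obtain ⟨F, hF, hmax⟩ := (Set.toFinite {F | IsSepFamily en r F}).exists_maximal
    ⟨_, isSepFamily_singletons hA r⟩
  refine ⟨F, hF, fun D hD hD' => ?_⟩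
  have := (hF.linked_slots hen hD hD').trichotomy
    (hF.noTwoSep_of_maximal hen (fun F' h h' => hmax h h') hD hD') (hF.three_le_card_slots hD hD')
  rcases this with ⟨e, he⟩ | h | h
  · exact .inl ⟨e, fun X hX => he ⟨X, hX⟩⟩
  · exact .inr (.inl (isCycleNode_iff.2 h))
  · exact .inr (.inr h)

lemma isChild_erase_iff (hCD : IsChild F C D) :
    IsChild (F \ {C}) X D ↔ (IsChild F X D ∧ X ≠ C) ∨ IsChild F X C := by
  constructor
  · rintro ⟨hX, hD, hXD, h⟩
    by_cases hXC : X ⊂ C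
    · refine .inr ⟨hX.1, hCD.1, hXC, fun Z hZ hXZ => ?_⟩
      by_cases hZC : Z = C
      · exact hZC.ge
      · exact hCD.2.2.1.1.trans (h Z ⟨hZ, hZC⟩ hXZ)
    · refine .inl ⟨⟨hX.1, hD.1, hXD, fun Z hZ hXZ => ?_⟩, hX.2⟩
      exact h Z ⟨hZ, fun hZC => hXC ((Set.mem_singleton_iff.1 hZC) ▸ hXZ)⟩ hXZ
  · have hDC : D ∈ F \ {C} := ⟨hCD.2.1, fun h => hCD.2.2.1.ne (Set.mem_singleton_iff.1 h).symm⟩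
    rintro (⟨⟨hX, hD, hXD, h⟩, hXC⟩ | ⟨hX, hC, hXC, h⟩)
    · exact ⟨⟨hX, hXC⟩, hDC, hXD, fun Z hZ => h Z hZ.1⟩
    · refine ⟨⟨hX, hXC.ne⟩, hDC, hXC.trans hCD.2.2.1, fun Z hZ hXZ => ?_⟩
      exact hCD.2.2.2 Z hZ.1 ((h Z hZ.1 hXZ).ssubset_of_ne (Ne.symm hZ.2))

namespace IsSepFamily

lemma not_isChild_compl (hF : IsSepFamily en r F) (h : IsChild F X C) : X ≠ Dᶜ ∨ D ∉ F := by
  by_cases hD : D ∈ F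
  · exact .inl fun hX => hF.notMem X h.1 (hX ▸ hF.notMem D hD)
  · exact .inr hD

lemma erase (hF : IsSepFamily en r F) (hCD : IsChild F C D) (hC : C.Nontrivial) :
    IsSepFamily en r (F \ {C}) := by
  refine ⟨⟨hF.root, fun h => ?_⟩, fun a ha => ⟨hF.single a ha, fun h => ?_⟩,
    fun X hX => hF.notMem X hX.1, fun X hX => hF.nonempty X hX.1,
    fun X hX => hF.bdry_subset X hX.1, fun X hX Y hY => hF.laminar X hX.1 Y hY.1⟩
  · exact hCD.2.2.1.2 ((hF.subset_root hCD.2.1).trans (Set.mem_singleton_iff.1 h).le)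
  · rw [← Set.mem_singleton_iff.1 h] at hC
    exact Set.not_nontrivial_singleton hC

lemma isChild_erase_of_ne (hF : IsSepFamily en r F) (hCD : IsChild F C D) (hY : Y ≠ C)
    (hYD : Y ≠ D) :
    IsChild (F \ {C}) X Y ↔ IsChild F X Y := by
  constructor
  · rintro ⟨hX, hYF, hXY, h⟩
    refine ⟨hX.1, hYF.1, hXY, fun Z hZ hXZ => ?_⟩
    by_cases hZC : Z = C
    · subst hZC
      obtain ⟨a, ha⟩ := hF.nonempty X hX.1
      rcases hF.laminar Y hYF.1 Z hZ a (hXY.1 ha) (hXZ.1 ha) with h' | h'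
      · exact h'
      · have hDY := hCD.2.2.2 Y hYF.1 h'
        refine absurd ((h D ⟨hCD.2.1, fun h => ?_⟩ (hXZ.trans hCD.2.2.1)).antisymm hDY) hYD
        exact hCD.2.2.1.ne (Set.mem_singleton_iff.1 h).symm
    · exact h Z ⟨hZ, hZC⟩ hXZ
  · rintro ⟨hX, hYF, hXY, h⟩
    refine ⟨⟨hX, fun hXC => ?_⟩, ⟨hYF, hY⟩, hXY, fun Z hZ => h Z hZ.1⟩
    rw [Set.mem_singleton_iff] at hXC
    subst hXC
    exact hYD (IsChild.unique ⟨hX, hYF, hXY, h⟩ hCD)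

lemma slots_erase_of_ne (hF : IsSepFamily en r F) (hCD : IsChild F C D) (hY : Y ≠ C) (hYD : Y ≠ D) :
    slots (F \ {C}) Y = slots F Y := by
  ext X
  simp only [slots, Set.mem_ofPred_eq, hF.isChild_erase_of_ne hCD hY hYD]

lemma slots_erase (hF : IsSepFamily en r F) (hCD : IsChild F C D) :
    slots (F \ {C}) D = (slots F D \ {C}) ∪ (slots F C \ {Cᶜ}) := by
  ext X
  simp only [slots, Set.mem_ofPred_eq, isChild_erase_iff hCD, Set.mem_union, Set.mem_sdiff,
    Set.mem_singleton_iff]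
  have h1 : IsChild F X C → X ≠ Cᶜ := fun h =>
    (hF.not_isChild_compl h).resolve_right fun h => h hCD.1
  have h2 : X = Dᶜ → X ≠ C := fun h hC => (hF.not_isChild_compl hCD).elim
    (fun h' => h' (hC ▸ h)) fun h => h hCD.2.1
  tauto

/-- A vertex on both sides of a separation is one of its two vertices. -/
lemma mem_ends_of_mem_of_mem (hF : IsSepFamily en r F) [Finite A] (hen : Linked en)
    (hCD : IsChild F C D)
    (hX : X ∈ slots F D \ {C}) (hY : Y ∈ slots F C \ {Cᶜ}) {v : V} (hv : v ∈ ends en r X)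
    (hv' : v ∈ ends en r Y) : v ∈ ends en r C := by
  rw [hF.mem_ends_slot hen hCD.2.1 hX.1] at hv
  rw [hF.mem_ends_slot hen hCD.1 hY.1] at hv'
  rw [hF.mem_ends hen hCD.1]
  obtain ⟨⟨a, ha, hva⟩, -⟩ := hv
  obtain ⟨⟨b, hb, hvb⟩, -⟩ := hv'
  refine ⟨⟨b, ?_, hvb⟩, ⟨a, fun haC => hX.2 (hF.slot_unique hX.1 (.inl hCD) ha haC), hva⟩⟩
  exact (hY.1.resolve_right hY.2).2.2.1.1 hb

end IsSepFamily

lemma IsDecomposition.erase [Finite A] (hen : Linked en) (hF : IsDecomposition en r F)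
    (hCD : IsChild F C D)
    (hC : C.Nontrivial) (h : (IsDipoleNode en r (slots F C) ∧ IsDipoleNode en r (slots F D)) ∨
      (IsCycleNode en r (slots F C) ∧ IsCycleNode en r (slots F D))) :
    IsDecomposition en r (F \ {C}) := by
  refine ⟨hF.toIsSepFamily.erase hCD hC, fun Y hY hY' => ?_⟩
  by_cases hYD : Y = D
  swap
  · rw [hF.toIsSepFamily.slots_erase_of_ne hCD hY.2 hYD]
    exact hF.node Y hY.1 hY'
  subst hYD
  rw [hF.toIsSepFamily.slots_erase hCD]
  have hCY : C ∈ slots F Y := .inl hCD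
  have hCC : Cᶜ ∈ slots F C := .inr rfl
  rcases h with ⟨⟨e, he⟩, ⟨f, hf⟩⟩ | ⟨h1, h2⟩
  · refine .inl ⟨e, ?_⟩
    have hef : e = f := by rw [← he _ hCC, ← hf _ hCY, ends_compl]
    rintro X (hX | hX)
    · rw [hf X hX.1, hef]
    · exact he X hX.1
  · refine .inr (.inl fun v hv => ?_)
    have hsplit : {X | X ∈ slots F Y \ {C} ∪ slots F C \ {Cᶜ} ∧ v ∈ ends en r X} =
        ({X | X ∈ slots F Y ∧ v ∈ ends en r X} \ {C}) ∪
          ({X | X ∈ slots F C ∧ v ∈ ends en r X} \ {Cᶜ}) := by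
      ext X
      simp only [Set.mem_ofPred_eq, Set.mem_union, Set.mem_sdiff]
      tauto
    rw [hsplit]
    by_cases hvC : v ∈ ends en r C
    · have hvC' : v ∈ ends en r Cᶜ := by rwa [ends_compl]
      have hC₁ : C ∈ {X | X ∈ slots F Y ∧ v ∈ ends en r X} := ⟨hCY, hvC⟩
      have hC₂ : Cᶜ ∈ {X | X ∈ slots F C ∧ v ∈ ends en r X} := ⟨hCC, hvC'⟩
      rw [Set.ncard_union_eq ?_, Set.ncard_sdiff_singleton_of_mem hC₁,
        Set.ncard_sdiff_singleton_of_mem hC₂, h1 v ⟨_, hCC, hvC'⟩, h2 v ⟨_, hCY, hvC⟩]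
      rw [Set.disjoint_left]
      rintro X ⟨⟨hX, -⟩, hXC⟩ ⟨⟨hX', -⟩, hXC'⟩
      obtain ⟨a, ha⟩ := hF.toIsSepFamily.nonempty_of_slot hCD.1 hX'
      have := (hX'.resolve_right hXC').2.2.1.1 ha
      exact hXC (hF.toIsSepFamily.slot_unique hX hCY ha this)
    · have hvC' : v ∉ ends en r Cᶜ := by rwa [ends_compl]
      obtain ⟨X, hX | hX, hvX⟩ := hv
      · have : {X | X ∈ slots F C ∧ v ∈ ends en r X} \ {Cᶜ} = ∅ := by
          rw [Set.eq_empty_iff_forall_notMem]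
          rintro Z ⟨⟨hZ, hvZ⟩, hZC⟩
          exact hvC (hF.toIsSepFamily.mem_ends_of_mem_of_mem hen hCD hX ⟨hZ, hZC⟩ hvX hvZ)
        rw [this, Set.union_empty, Set.sdiff_singleton_eq_self fun h => hvC h.2]
        exact h2 v ⟨X, hX.1, hvX⟩
      · have : {X | X ∈ slots F Y ∧ v ∈ ends en r X} \ {C} = ∅ := by
          rw [Set.eq_empty_iff_forall_notMem]
          rintro Z ⟨⟨hZ, hvZ⟩, hZC⟩
          exact hvC (hF.toIsSepFamily.mem_ends_of_mem_of_mem hen hCD ⟨hZ, hZC⟩ hX hvZ hvX)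
        rw [this, Set.empty_union, Set.sdiff_singleton_eq_self fun h => hvC' h.2]
        exact h1 v ⟨X, hX.1, hvX⟩

/-- A decomposition in which adjacent nodes are not both dipoles or both cycles. -/
structure IsReduced (en : A → Sym2 V) (r : A) (F : Set (Set A)) : Prop extends
    IsDecomposition en r F where
  not_dipole : ∀ C D, IsChild F C D → C.Nontrivial →
    ¬ (IsDipoleNode en r (slots F C) ∧ IsDipoleNode en r (slots F D))
  not_cycle : ∀ C D, IsChild F C D → C.Nontrivial →
    ¬ (IsCycleNode en r (slots F C) ∧ IsCycleNode en r (slots F D))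

lemma exists_isReduced [Finite A] (hen : Linked en) (hA : 3 ≤ Nat.card A) (r : A) :
    ∃ F, IsReduced en r F := by
  obtain ⟨F, hF, hmin⟩ := (Set.toFinite {F | IsDecomposition en r F}).exists_minimal
    (exists_isDecomposition hen hA r)
  have key : ∀ C D, IsChild F C D → C.Nontrivial → ¬ IsDecomposition en r (F \ {C}) :=
    fun C D hCD hC h => (hmin h Set.sdiff_subset hCD.1).2 rfl
  exact ⟨F, hF, fun C D hCD hC h => key C D hCD hC (hF.erase hen hCD hC (.inl h)),
    fun C D hCD hC h => key C D hCD hC (hF.erase hen hCD hC (.inr h))⟩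

end Laminar

section Laminar

variable {V : Type*} {A : Type} {en : A → Sym2 V} {r : A} {F : Set (Set A)} {C D X Y : Set A}

/-- The tree of the nontrivial members of `F`. -/
def sepTree (F : Set (Set A)) : SimpleGraph {D // D ∈ F ∧ D.Nontrivial} where
  Adj x y := IsChild F x y ∨ IsChild F y x
  symm := ⟨fun _ _ h => h.symm⟩
  loopless := ⟨fun _ h => h.elim (fun h => h.2.2.1.ne rfl) fun h => h.2.2.1.ne rfl⟩

/-- The edges `p` and `q` represent complementary nontrivial sets of edges. -/
def SlotPaired (F : Set (Set A)) (p q : Σ x : {D // D ∈ F ∧ D.Nontrivial}, slots F x.1) : Prop :=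
  (p.2 : Set A) = (q.2 : Set A)ᶜ ∧ (p.2 : Set A).Nontrivial ∧ (q.2 : Set A).Nontrivial

lemma slot_sigma_ext {p q : Σ x : {D // D ∈ F ∧ D.Nontrivial}, slots F x.1}
    (h₁ : (p.1 : Set A) = q.1) (h₂ : (p.2 : Set A) = q.2) : p = q := by
  obtain ⟨⟨D, hD⟩, X, hX⟩ := p
  obtain ⟨⟨D', hD'⟩, X', hX'⟩ := q
  obtain rfl : D = D' := h₁
  obtain rfl : X = X' := h₂
  rfl

lemma sepTree_deleteEdges_subset {x y z w : {D // D ∈ F ∧ D.Nontrivial}} (hxy : IsChild F x y)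
    (hzw : ((sepTree F).deleteEdges {s(x, y)}).Adj z w) (hz : (z : Set A) ⊆ x) :
    (w : Set A) ⊆ x := by
  rw [SimpleGraph.deleteEdges_adj] at hzw
  obtain ⟨h | h, hne⟩ := hzw
  · by_cases hzx : (z : Set A) = x
    · have hwy : w = y := Subtype.ext (h.unique (hzx ▸ hxy))
      exact absurd (by rw [hwy, Subtype.ext hzx]; rfl) hne
    · exact h.2.2.2 _ hxy.1 (hz.ssubset_of_ne hzx)
  · exact h.2.2.1.1.trans hz

lemma sepTree_reachable_iff {x y z w : {D // D ∈ F ∧ D.Nontrivial}} (hxy : IsChild F x y)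
    (hzw : ((sepTree F).deleteEdges {s(x, y)}).Reachable z w) :
    (z : Set A) ⊆ x ↔ (w : Set A) ⊆ x := by
  obtain ⟨p⟩ := hzw
  induction p with
  | nil => rfl
  | cons h _ ih =>
    exact Iff.trans ⟨sepTree_deleteEdges_subset hxy h, sepTree_deleteEdges_subset hxy h.symm⟩ ih

lemma sepTree_isAcyclic (F : Set (Set A)) : (sepTree F).IsAcyclic := by
  have key : ∀ x y : {D // D ∈ F ∧ D.Nontrivial}, IsChild F x y →
      ¬ ((sepTree F).deleteEdges {s(x, y)}).Reachable x y := fun x y h hr =>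
    h.2.2.1.2 ((sepTree_reachable_iff h hr).1 subset_rfl)
  rw [SimpleGraph.isAcyclic_iff_forall_adj_isBridge]
  intro x y h
  rw [SimpleGraph.isBridge_iff]
  rcases h with h | h
  · exact key x y h
  · rw [Sym2.eq_swap]
    exact fun hr => key y x h hr.symm

lemma SlotPaired.symm {p q : Σ x : {D // D ∈ F ∧ D.Nontrivial}, slots F x.1}
    (h : SlotPaired F p q) : SlotPaired F q p := by
  refine ⟨?_, h.2.2, h.2.1⟩
  rw [h.1, compl_compl]

lemma Linked.ends_singleton [Finite A] (hen : Linked en) (hA : 3 ≤ Nat.card A) (a : A) :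
    ends en r {a} = en a := by
  have h := hen.mem_bdry_singleton (fun a => by
    obtain ⟨b, hb, -⟩ := exists_ne_ne hA a a; exact ⟨b, hb⟩) a
  ext v
  rw [mem_ends ⟨en a, h⟩, h]

namespace IsSepFamily

lemma sepTree_connected (hF : IsSepFamily en r F) [Finite A] (hA : 3 ≤ Nat.card A) :
    (sepTree F).Connected := by
  have hroot : ({r}ᶜ : Set A).Nontrivial := by
    obtain ⟨a, ha, -⟩ := exists_ne_ne hA r r
    obtain ⟨b, hb, hba⟩ := exists_ne_ne hA r a
    exact ⟨a, ha, b, hb, hba.symm⟩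
  have key : ∀ (D : Set A) (hD : D ∈ F ∧ D.Nontrivial),
      (sepTree F).Reachable ⟨D, hD⟩ ⟨{r}ᶜ, hF.root, hroot⟩ := by
    intro D
    induction D using WellFoundedGT.induction with | _ D ih =>
    intro hD
    by_cases h : D = {r}ᶜ
    · subst h
      exact .rfl
    · obtain ⟨D', h'⟩ := hF.exists_parent hD.1 h
      refine SimpleGraph.Reachable.trans (SimpleGraph.Adj.reachable ?_)
        (ih D' h'.2.2.1 ⟨h'.2.1, hF.nontrivial_of_isChild h'⟩)
      exact .inl h'
  have : Nonempty {D // D ∈ F ∧ D.Nontrivial} := ⟨⟨_, hF.root, hroot⟩⟩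
  exact ⟨fun x y => (key x x.2).trans (key y y.2).symm⟩

lemma slotPaired_cases (hF : IsSepFamily en r F)
    {p q : Σ x : {D // D ∈ F ∧ D.Nontrivial}, slots F x.1}
    (h : SlotPaired F p q) :
    (IsChild F p.1 q.1 ∧ (p.2 : Set A) = (p.1 : Set A)ᶜ ∧ (q.2 : Set A) = p.1) ∨
      (IsChild F q.1 p.1 ∧ (q.2 : Set A) = (q.1 : Set A)ᶜ ∧ (p.2 : Set A) = q.1) := by
  obtain ⟨⟨D, hD⟩, X, hX⟩ := p
  obtain ⟨⟨D', hD'⟩, X', hX'⟩ := q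
  obtain rfl : X = X'ᶜ := h.1
  simp only
  have hr := hF.notMem
  rcases hX with hX | hX <;> rcases hX' with hX' | hX'
  · exact absurd (not_not.1 (hr _ hX.1)) (hr _ hX'.1)
  · subst hX'
    rw [compl_compl] at hX ⊢
    exact .inr ⟨hX, rfl, rfl⟩
  · rw [compl_inj_iff] at hX
    subst hX
    exact .inl ⟨hX', rfl, rfl⟩
  · rw [compl_inj_iff] at hX
    subst hX
    exact absurd (not_not.1 (hX' ▸ hr _ hD.1 : r ∉ (D'ᶜ : Set A))) (hr _ hD'.1)

lemma slotPaired_of_isChild (hF : IsSepFamily en r F) [Finite A] {x y : {D // D ∈ F ∧ D.Nontrivial}}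
    (h : IsChild F x y) :
    SlotPaired F ⟨x, (x : Set A)ᶜ, .inr rfl⟩ ⟨y, x, .inl h⟩ := by
  refine ⟨rfl, ?_, x.2.2⟩
  obtain ⟨a, ha, hax⟩ := Set.exists_of_ssubset h.2.2.1
  exact ⟨a, hax, r, hF.notMem _ x.2.1, fun har => hF.notMem _ y.2.1 (har ▸ ha)⟩

lemma existsUnique_slotPaired (hF : IsSepFamily en r F) [Finite A]
    (p : Σ x : {D // D ∈ F ∧ D.Nontrivial}, slots F x.1)
    (hp : (p.2 : Set A).Nontrivial) : ∃! q, SlotPaired F p q := by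
  have huniq : ∀ q q', SlotPaired F p q → SlotPaired F p q' → q = q' := by
    intro q q' h h'
    have h₂ : (q.2 : Set A) = q'.2 := compl_injective (h.1.symm.trans h'.1)
    refine slot_sigma_ext ?_ h₂
    rcases hF.slotPaired_cases h with ⟨h1, h2, h3⟩ | ⟨h1, h2, h3⟩ <;>
      rcases hF.slotPaired_cases h' with ⟨h1', h2', h3'⟩ | ⟨h1', h2', h3'⟩
    · exact h1.unique h1'
    · exact absurd (h3' ▸ h2 ▸ hF.notMem _ p.1.2.1 : r ∈ (q'.1 : Set A)) (hF.notMem _ q'.1.2.1)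
    · exact absurd (h3 ▸ h2' ▸ hF.notMem _ p.1.2.1 : r ∈ (q.1 : Set A)) (hF.notMem _ q.1.2.1)
    · exact h3.symm.trans h3'
  suffices h : ∃ q, SlotPaired F p q by
    obtain ⟨q, hq⟩ := h
    exact ⟨q, hq, fun q' hq' => huniq q' q hq' hq⟩
  obtain ⟨⟨D, hD⟩, X, hX | rfl⟩ := p
  · exact ⟨⟨⟨X, hX.1, hp⟩, Xᶜ, .inr rfl⟩, (hF.slotPaired_of_isChild
      (x := ⟨X, hX.1, hp⟩) (y := ⟨D, hD⟩) hX).symm⟩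
  · have hDr : D ≠ {r}ᶜ := by
      rintro rfl
      have hp' : (({r}ᶜ : Set A)ᶜ).Nontrivial := hp
      rw [compl_compl] at hp'
      exact Set.not_nontrivial_singleton hp'
    obtain ⟨D', h⟩ := hF.exists_parent hD.1 hDr
    exact ⟨⟨⟨D', h.2.1, hF.nontrivial_of_isChild h⟩, D, .inl h⟩,
      hF.slotPaired_of_isChild (x := ⟨D, hD⟩) (y := ⟨D', _⟩) h⟩

lemma existsUnique_slot_pair (hF : IsSepFamily en r F) [Finite A]
    {x y : {D // D ∈ F ∧ D.Nontrivial}} (h : (sepTree F).Adj x y) :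
    ∃! pq : slots F x.1 × slots F y.1, SlotPaired F ⟨x, pq.1⟩ ⟨y, pq.2⟩ := by
  have hasymm : ∀ x y : Set A, IsChild F x y → ¬ IsChild F y x :=
    fun x y h h' => h.2.2.1.2 h'.2.2.1.1
  rcases h with h | h
  · refine ⟨(⟨_, .inr rfl⟩, ⟨_, .inl h⟩), hF.slotPaired_of_isChild h, fun pq hpq => ?_⟩
    rcases hF.slotPaired_cases hpq with ⟨-, h2, h3⟩ | ⟨h1, -⟩
    · exact Prod.ext (Subtype.ext h2) (Subtype.ext h3)
    · exact absurd h1 (hasymm _ _ h)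
  · refine ⟨(⟨_, .inl h⟩, ⟨_, .inr rfl⟩), (hF.slotPaired_of_isChild h).symm, fun pq hpq => ?_⟩
    rcases hF.slotPaired_cases hpq with ⟨h1, -⟩ | ⟨-, h2, h3⟩
    · exact absurd h1 (hasymm _ _ h)
    · exact Prod.ext (Subtype.ext h3) (Subtype.ext h2)

lemma eq_singleton_of_slot (hF : IsSepFamily en r F) (hD : D ∈ F) (hX : X ∈ slots F D)
    (hX' : ¬ X.Nontrivial) :
    ∃ a, X = {a} := by
  obtain ⟨a, ha⟩ := hF.nonempty_of_slot hD hX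
  exact ⟨a, (Set.not_nontrivial_iff.1 hX').eq_singleton_of_mem ha⟩

lemma existsUnique_real_slot (hF : IsSepFamily en r F) [Finite A] (hen : Linked en)
    (hA : 3 ≤ Nat.card A)
    (hinj : Function.Injective en) (a : A) :
    ∃! p : Σ x : {D // D ∈ F ∧ D.Nontrivial}, slots F x.1,
      ¬ (p.2 : Set A).Nontrivial ∧ ends en r p.2 = en a := by
  suffices h : ∃ D, ∃ hD : D ∈ F ∧ D.Nontrivial, ∃ ha : {a} ∈ slots F D,
      ∀ D', D' ∈ F → {a} ∈ slots F D' → D' = D by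
    obtain ⟨D, hD, ha, huniq⟩ := h
    refine ⟨⟨⟨D, hD⟩, {a}, ha⟩, ⟨Set.not_nontrivial_singleton, hen.ends_singleton hA a⟩, ?_⟩
    rintro ⟨⟨D', hD'⟩, X, hX⟩ ⟨hX', he⟩
    obtain ⟨b, rfl⟩ := hF.eq_singleton_of_slot hD'.1 hX hX'
    obtain rfl : b = a := hinj ((hen.ends_singleton hA b).symm.trans he)
    exact slot_sigma_ext (huniq D' hD'.1 hX) rfl
  by_cases har : a = r
  · subst har
    refine ⟨{a}ᶜ, ⟨hF.root, ?_⟩, .inr (compl_compl _).symm, fun D' hD' h => ?_⟩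
    · obtain ⟨b, hb, -⟩ := exists_ne_ne hA a a
      obtain ⟨c, hc, hcb⟩ := exists_ne_ne hA a b
      exact ⟨b, hb, c, hc, hcb.symm⟩
    · rcases h with h | h
      · exact (hF.notMem _ h.1 (Set.mem_singleton _)).elim
      · rw [h, compl_compl]
  · obtain ⟨D, hD⟩ := hF.exists_parent (hF.single a har) (fun h => by
      obtain ⟨b, hbr, hba⟩ := exists_ne_ne hA r a
      exact hba (show b ∈ ({a} : Set A) from h ▸ hbr))
    refine ⟨D, ⟨hD.2.1, hF.nontrivial_of_isChild hD⟩, .inl hD, fun D' hD' h => ?_⟩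
    rcases h with h | h
    · exact h.unique hD
    · exact absurd (h ▸ hF.notMem _ hD' : r ∈ ({a} : Set A)) (Ne.symm har)

lemma exists_mem_of_subset (hF : IsSepFamily en r F) (hen : Linked en) (hD : D ∈ F)
    (hDC : D ⊆ C) (hX : X ∈ slots F D) {v : V} (hv : v ∈ ends en r X) : ∃ a ∈ C, v ∈ en a := by
  rw [hF.mem_ends_slot hen hD hX] at hv
  rcases hX with hX | rfl
  · obtain ⟨⟨a, ha, hva⟩, -⟩ := hv
    exact ⟨a, hDC (hX.2.2.1.1 ha), hva⟩
  · rw [bdry_compl] at hv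
    obtain ⟨⟨a, ha, hva⟩, -⟩ := hv
    exact ⟨a, hDC ha, hva⟩

lemma exists_notMem_of_not_subset (hF : IsSepFamily en r F) (hen : Linked en) (hC : C ∈ F)
    (hD : D ∈ F) (hDC : ¬ D ⊆ C)
    (hX : X ∈ slots F D) {v : V} (hv : v ∈ ends en r X) : ∃ a ∈ Cᶜ, v ∈ en a := by
  rw [hF.mem_ends_slot hen hD hX] at hv
  have aux : ∀ Z ∈ F, (Z ⊆ C → v ∈ bdry en C) → v ∈ bdry en Z → ∃ a ∈ Cᶜ, v ∈ en a := by
    rintro Z hZ hZC ⟨⟨a, ha, hva⟩, ⟨b, hb, hvb⟩⟩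
    by_cases haC : a ∈ C
    · rcases hF.laminar Z hZ C hC a ha haC with h | h
      · exact (hZC h).2
      · exact ⟨b, fun h' => hb (h.1 h'), hvb⟩
    · exact ⟨a, haC, hva⟩
  rcases hX with hX | rfl
  · refine aux X hX.1 (fun h => ?_) hv
    rcases h.eq_or_ssubset with rfl | h
    · exact hv
    · exact absurd (hX.2.2.2 C hC h) hDC
  · rw [bdry_compl] at hv
    exact aux D hD (fun h => absurd h hDC) hv

lemma side_condition (hF : IsSepFamily en r F) (hen : Linked en) {x y : {D // D ∈ F ∧ D.Nontrivial}}
    (h : IsChild F x y) :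
    (⋃ z ∈ {z | ((sepTree F).deleteEdges {s(x, y)}).Reachable z x},
      skSupport (fun X : slots F z.1 => ends en r X)) ∩
    (⋃ z ∈ {z | ((sepTree F).deleteEdges {s(x, y)}).Reachable z y},
      skSupport (fun X : slots F z.1 => ends en r X)) ⊆ {v | v ∈ ends en r x} := by
  rintro v ⟨hv, hv'⟩
  simp only [Set.mem_iUnion, Set.mem_ofPred_eq] at hv hv' ⊢
  obtain ⟨z, hz, X, hvX⟩ := hv
  obtain ⟨w, hw, Y, hvY⟩ := hv'
  rw [hF.mem_ends hen x.2.1]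
  have hz' := (sepTree_reachable_iff h hz).2 subset_rfl
  have hw' : ¬ (w : Set A) ⊆ x := fun h' => h.2.2.1.2 ((sepTree_reachable_iff h hw).1 h')
  exact ⟨hF.exists_mem_of_subset hen z.2.1 hz' X.2 hvX,
    hF.exists_notMem_of_not_subset hen x.2.1 w.2.1 hw' Y.2 hvY⟩

end IsSepFamily

/-- The SPR-tree of a reduced decomposition of the edges of a graph. -/
noncomputable def IsReduced.sprTree [Finite A] {H : SimpleGraph V} (hF : IsReduced en r F)
    (hen : Linked en) (hA : 3 ≤ Nat.card A) (hinj : Function.Injective en)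
    (hH : H.edgeSet = Set.range en) (hcov : ∀ v, ∃ a, v ∈ en a) : SPRTree H where
  ι := {D // D ∈ F ∧ D.Nontrivial}
  tree := sepTree F
  tree_conn := hF.sepTree_connected hA
  tree_acyclic := sepTree_isAcyclic F
  label x := open Classical in if IsDipoleNode en r (slots F x.1) then SPRLabel.P else
    if IsCycleNode en r (slots F x.1) then SPRLabel.S else SPRLabel.R
  E x := slots F x.1
  ends x X := ends en r X
  ends_not_diag x X := (hF.linked_slots hen x.2.1 x.2.2).not_isDiag X
  IsVirt x X := (X : Set A).Nontrivial
  skel_S x h := by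
    split_ifs at h with h1 h2
    exact (hF.linked_slots hen x.2.1 x.2.2).isCycleSkeleton
      (hF.three_le_card_slots x.2.1 x.2.2) (isCycleNode_iff.1 h2)
  skel_P x h := by
    split_ifs at h with h1 h2
    have hl := hF.linked_slots hen x.2.1 x.2.2
    have h3 := hF.three_le_card_slots x.2.1 x.2.2
    obtain ⟨e, he⟩ := h1
    refine ⟨?_, h3⟩
    obtain ⟨X⟩ := (Nat.card_pos_iff.1 (by omega : 0 < Nat.card (slots F x.1))).1
    have hd := hl.not_isDiag X
    rw [he X X.2] at hd
    induction e with | _ u v =>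
    exact ⟨u, v, fun h => hd (Sym2.mk_isDiag_iff.2 h), fun Y => he Y Y.2⟩
  skel_R x h := by
    split_ifs at h with h1 h2
    exact ((hF.node x.1 x.2.1 x.2.2).resolve_left h1).resolve_left h2
  no_SS x y h := by
    rintro ⟨hx, hy⟩
    split_ifs at hx hy
    rcases h with h | h
    · exact hF.not_cycle _ _ h x.2.2 ⟨‹_›, ‹_›⟩
    · exact hF.not_cycle _ _ h y.2.2 ⟨‹_›, ‹_›⟩
  no_PP x y h := by
    rintro ⟨hx, hy⟩
    split_ifs at hx hy
    rcases h with h | h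
    · exact hF.not_dipole _ _ h x.2.2 ⟨‹_›, ‹_›⟩
    · exact hF.not_dipole _ _ h y.2.2 ⟨‹_›, ‹_›⟩
  real_edge x X hX := by
    obtain ⟨a, ha⟩ := hF.eq_singleton_of_slot x.2.1 X.2 hX
    rw [ha, hen.ends_singleton hA, hH]
    exact ⟨a, rfl⟩
  real_cover f hf := by
    rw [hH] at hf
    obtain ⟨a, rfl⟩ := hf
    exact hF.existsUnique_real_slot hen hA hinj a
  paired := SlotPaired F
  paired_symm _ _ h := h.symm
  paired_virt p q h := h.2.1
  paired_tree p q h := (hF.slotPaired_cases h).imp And.left And.left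
  paired_ends p q h := by rw [h.1, ends_compl]
  virt_paired p hp := hF.existsUnique_slotPaired p hp
  tree_edge_pair x y h := hF.existsUnique_slot_pair h
  support_cover := by
    refine Set.eq_univ_of_forall fun v => ?_
    obtain ⟨a, ha⟩ := hcov v
    obtain ⟨⟨x, X⟩, ⟨-, hX⟩, -⟩ := hF.existsUnique_real_slot hen hA hinj a
    rw [Set.mem_iUnion]
    refine ⟨x, X, ?_⟩
    change v ∈ ends en r X
    rwa [show ends en r X = en a from hX]
  side_condition p q h := by
    rcases hF.slotPaired_cases h with ⟨h1, h2, -⟩ | ⟨h1, -, h2⟩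
    · rw [h2, ends_compl]
      exact hF.side_condition hen h1
    · rw [h2, Sym2.eq_swap, Set.inter_comm]
      exact hF.side_condition hen h1

end Laminar

section Gluing

variable {V : Type*} {A : Type} {en : A → Sym2 V} {r : A} {F : Set (Set A)}
  {D : Set A} {H : SimpleGraph V} {S : Set CrossingType}

lemma drawable_of_degree_le_two [Finite V] {B L : Set (Sym2 V)}
    (h : ∀ v, ∃ e : Sym2 V, ∀ w, w ≠ v → s(v, w) ∈ B ∪ L → w ∈ e) : Drawable H S B L := by
  refine .of_planar (planar_of_degree_le_two fun w => ?_)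
  rcases w with v | c
  · obtain ⟨e, he⟩ := h v
    induction e with | _ x y =>
    have hsub : (plan B ∅ L).neighborSet (.inl v) ⊆ {.inl x, .inl y} := by
      rintro (w | c) hw
      · obtain ⟨hne, hw⟩ := plan_inl_inl.1 hw
        have := he w hne.symm (hw.elim .inr fun h => .inl h.1)
        simpa using this
      · exact absurd ((plan_inl_inr (A := B) (L := L)).1 hw).1 (Set.notMem_empty _)
    refine (Set.ncard_le_ncard hsub).trans ((Set.ncard_insert_le _ _).trans ?_)
    rw [Set.ncard_singleton]
  · have : (plan B ∅ L).neighborSet (.inr c) = ∅ := by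
      rw [Set.eq_empty_iff_forall_notMem]
      rintro (w | d) hw
      · exact absurd ((plan_inr_inl (A := B) (L := L)).1 hw).1 (Set.notMem_empty _)
      · exact not_plan_inr_inr (A := B) (C := ∅) (L := L) (c := c) (d := d) hw
    simp [this]

/-- The edges of `H` that are parallel to an edge of the node `D`. -/
def nodeEdges (H : SimpleGraph V) (en : A → Sym2 V) (r : A) (F : Set (Set A)) (D : Set A) :
    Set (Sym2 V) := {f | f ∈ H.edgeSet ∧ ∃ X : slots F D, ends en r X = f}

/-- The virtual edges of the node `D`. -/
def nodeVirt (en : A → Sym2 V) (r : A) (F : Set (Set A)) (D : Set A) :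
    Set (Sym2 V) := {f | ∃ X : slots F D, (X : Set A).Nontrivial ∧ ends en r X = f}

lemma mem_of_mem_nodeEdges_union {f : Sym2 V} (h : f ∈ nodeEdges H en r F D ∪ nodeVirt en r F D) :
    ∃ X ∈ slots F D, ends en r X = f := by
  rcases h with ⟨-, X, hX⟩ | ⟨X, -, hX⟩ <;> exact ⟨X, X.2, hX⟩

variable [Finite V]

lemma IsDipoleNode.drawable (h : IsDipoleNode en r (slots F D)) :
    Drawable H S (nodeEdges H en r F D) (nodeVirt en r F D) := by
  obtain ⟨e, he⟩ := h
  refine drawable_of_degree_le_two fun v => ⟨e, fun w _ hw => ?_⟩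
  obtain ⟨X, hX, hf⟩ := mem_of_mem_nodeEdges_union hw
  rw [← he X hX, hf]
  exact Sym2.mem_mk_right v w

lemma IsCycleNode.drawable (h : IsCycleNode en r (slots F D)) :
    Drawable H S (nodeEdges H en r F D) (nodeVirt en r F D) := by
  refine drawable_of_degree_le_two fun v => ?_
  by_cases hv : ∃ X ∈ slots F D, v ∈ ends en r X
  · obtain ⟨X, Y, -, hXY⟩ := Set.ncard_eq_two.1 (h v hv)
    have hmem : ∀ Z, Z ∈ slots F D ∧ v ∈ ends en r Z ↔ Z = X ∨ Z = Y := by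
      rw [Set.ext_iff] at hXY
      exact hXY
    obtain ⟨x, hx⟩ := Sym2.mem_iff_exists.1 ((hmem X).2 (.inl rfl)).2
    obtain ⟨y, hy⟩ := Sym2.mem_iff_exists.1 ((hmem Y).2 (.inr rfl)).2
    refine ⟨s(x, y), fun w hwv hw => ?_⟩
    obtain ⟨Z, hZ, hf⟩ := mem_of_mem_nodeEdges_union hw
    rcases (hmem Z).1 ⟨hZ, hf ▸ Sym2.mem_mk_left v w⟩ with rfl | rfl
    · rw [hx, Sym2.congr_right] at hf
      simp [hf]
    · rw [hy, Sym2.congr_right] at hf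
      simp [hf]
  · refine ⟨s(v, v), fun w _ hw => absurd ?_ hv⟩
    obtain ⟨X, hX, hf⟩ := mem_of_mem_nodeEdges_union hw
    exact ⟨X, hX, hf ▸ Sym2.mem_mk_left v w⟩

lemma IsSepFamily.drawable_node [Finite A] (hF : IsSepFamily en r F) (hen : Linked en)
    (hA : 3 ≤ Nat.card A) (hH : H.edgeSet = Set.range en)
    (hnode : ∀ D ∈ F, D.Nontrivial →
      Drawable H S (nodeEdges H en r F D) (nodeVirt en r F D)) (hD : D ∈ F) (hD' : D.Nontrivial) :
    Drawable H S (nodeEdges H en r F D ∪ en '' D) (nodeVirt en r F D) := by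
  induction D using WellFoundedLT.induction with | _ D ih =>
  have hsub : ∀ X : Set A, en '' X ⊆ H.edgeSet := fun X => hH ▸ Set.image_subset_range _ _
  have hnodeE : nodeEdges H en r F D ⊆ H.edgeSet := fun _ h => h.1
  have key : ∀ K : Set (Set A), K ⊆ {X | IsChild F X D} →
      Drawable H S (nodeEdges H en r F D ∪ ⋃ X ∈ K, en '' X) (nodeVirt en r F D) := by
    intro K
    induction K, Set.toFinite K using Set.Finite.induction_on with
    | empty =>
      intro _
      simpa using hnode D hD hD'
    | @insert X K hXK _ ih' =>
      intro hK
      have hX : IsChild F X D := hK (Set.mem_insert _ _)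
      have h₁ := ih' ((Set.subset_insert _ _).trans hK)
      rw [Set.biUnion_insert]
      by_cases hXn : X.Nontrivial
      · have hvirt : ends en r X ∈ nodeVirt en r F X := by
          refine ⟨⟨Xᶜ, .inr rfl⟩, ?_, ends_compl X⟩
          exact (hF.slotPaired_of_isChild (x := ⟨X, hX.1, hXn⟩) (y := ⟨D, hD, hD'⟩) hX).2.1
        have h₂ := (ih X hX.2.2.1 hX.1 hXn).mono (A' := en '' X) (L' := {ends en r X})
          Set.subset_union_right (Set.singleton_subset_iff.2 hvirt)
        have hmem : ends en r X ∈ nodeVirt en r F D := ⟨⟨X, .inl hX⟩, hXn, rfl⟩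
        have hdiag := (hF.linked_slots hen hD hD').not_isDiag ⟨X, .inl hX⟩
        have hinter : vset ((nodeEdges H en r F D ∪ ⋃ Y ∈ K, en '' Y) ∪ nodeVirt en r F D) ∩
            vset (en '' X ∪ {ends en r X}) ⊆ {v | v ∈ ends en r X} := by
          rintro v ⟨⟨f, hf, hvf⟩, ⟨g, hg, hvg⟩⟩
          rcases hg with ⟨b, hb, rfl⟩ | rfl
          swap
          · exact hvg
          have aux : (∃ a ∈ Xᶜ, v ∈ en a) → v ∈ ends en r X := fun ha =>
            (hF.mem_ends hen hX.1 v).2 ⟨⟨b, hb, hvg⟩, ha⟩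
          have hf' : (∃ Y ∈ slots F D, ends en r Y = f) ∨ ∃ Y ∈ K, ∃ a ∈ Y, en a = f := by
            rcases hf with (hf | hf) | hf
            · exact .inl (mem_of_mem_nodeEdges_union (.inl hf))
            · right
              simpa using hf
            · exact .inl (mem_of_mem_nodeEdges_union (H := H) (.inr hf))
          rcases hf' with ⟨Y, hY, rfl⟩ | ⟨Y, hY, a, ha, rfl⟩
          · by_cases hYX : Y = X
            · exact hYX ▸ hvf
            · obtain ⟨⟨a, ha, hva⟩, -⟩ := (hF.mem_ends_slot hen hD hY v).1 hvf
              exact aux ⟨a, fun haX => hYX (hF.slot_unique hY (.inl hX) ha haX), hva⟩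
          · refine aux ⟨a, fun haX => hXK ?_, hvf⟩
            rwa [← hF.slot_unique (.inl (hK (.inr hY))) (.inl hX) ha haX]
        have h₃ : Drawable H S ((nodeEdges H en r F D ∪ ⋃ Y ∈ K, en '' Y) ∪ en '' X)
            (nodeVirt en r F D ∪ {ends en r X}) := by
          revert hmem hdiag hinter h₂
          generalize ends en r X = e
          intro h₂ hmem hdiag hinter
          induction e with | _ u v =>
          refine h₁.union_of_edge h₂ (hsub X) (fun h => hdiag (Sym2.mk_isDiag_iff.2 h)) hmem rfl
            (hinter.trans ?_)
          intro w hw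
          simpa using hw
        rw [Set.union_eq_self_of_subset_right (Set.singleton_subset_iff.2 hmem)] at h₃
        rwa [Set.union_comm (en '' X), ← Set.union_assoc]
      · obtain ⟨a, rfl⟩ := hF.eq_singleton_of_slot hD (.inl hX) hXn
        have : en '' {a} ⊆ nodeEdges H en r F D := by
          rintro _ ⟨_, rfl, rfl⟩
          exact ⟨hH ▸ ⟨_, rfl⟩, ⟨{_}, .inl hX⟩, hen.ends_singleton hA _⟩
        rwa [← Set.union_assoc, Set.union_eq_self_of_subset_right this]
  have h := key {X | IsChild F X D} subset_rfl
  convert h using 2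
  ext f
  simp only [Set.mem_image, Set.mem_iUnion, Set.mem_ofPred_eq]
  constructor
  · rintro ⟨a, ha, rfl⟩
    obtain ⟨X, hX, haX⟩ := hF.exists_child hD hD' ha
    exact ⟨X, hX, a, haX, rfl⟩
  · rintro ⟨X, hX, a, ha, rfl⟩
    exact ⟨a, hX.2.2.1.1 ha, rfl⟩

/-- A linked graph is drawable if the skeleton+ of each R-node of its SPR-trees is. -/
lemma drawable_of_forall_sprTree [Finite A] (hS : S ⊆ goodTypes) (hen : Linked en)
    (hA : 3 ≤ Nat.card A) (hinj : Function.Injective en) (hH : H.edgeSet = Set.range en)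
    (hcov : ∀ v, ∃ a, v ∈ en a)
    (hR : ∀ (T : SPRTree H) (x : T.ι), T.label x = SPRLabel.R → SRestricted (T.skeletonPlus x) S) :
    Drawable H S H.edgeSet ∅ := by
  obtain ⟨r⟩ := (Nat.card_pos_iff.1 (by omega : 0 < Nat.card A)).1
  obtain ⟨F, hF⟩ := exists_isReduced hen hA r
  let T : SPRTree H := hF.sprTree hen hA hinj hH hcov
  have hnode : ∀ D ∈ F, D.Nontrivial →
      Drawable H S (nodeEdges H en r F D) (nodeVirt en r F D) := by
    intro D hD hD'
    by_cases h1 : IsDipoleNode en r (slots F D)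
    · exact h1.drawable
    by_cases h2 : IsCycleNode en r (slots F D)
    · exact h2.drawable
    have hlabel : T.label ⟨D, hD, hD'⟩ = SPRLabel.R := by
      simp [T, IsReduced.sprTree, h1, h2]
    have : Finite (T.E ⟨D, hD, hD'⟩) := inferInstanceAs (Finite (slots F D))
    exact T.drawable_of_skeletonPlus hS (T.skel_R _ hlabel).1 (hR T _ hlabel)
  have hroot : ({r}ᶜ : Set A).Nontrivial := by
    obtain ⟨a, ha, -⟩ := exists_ne_ne hA r r
    obtain ⟨b, hb, hba⟩ := exists_ne_ne hA r a
    exact ⟨a, ha, b, hb, hba.symm⟩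
  refine (hF.drawable_node hen hA hH hnode hF.root hroot).mono ?_ (Set.empty_subset _)
  rw [hH]
  rintro _ ⟨a, rfl⟩
  by_cases har : a = r
  · subst har
    refine .inl ⟨hH ▸ ⟨a, rfl⟩, ⟨{a}, .inr (compl_compl _).symm⟩, hen.ends_singleton hA a⟩
  · exact .inr ⟨a, har, rfl⟩

end Gluing

section Blocks

variable {V : Type*} {G : SimpleGraph V} {S : Set CrossingType} {F : Set (Sym2 V)}

lemma Linked.of_preconnected {A : Type*} {en : A → Sym2 V} (hG : G.edgeSet = Set.range en)
    (h : ∀ v, (G.induce {v}ᶜ).Preconnected) : Linked en where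
  not_isDiag a := G.not_isDiag_of_mem_edgeSet (hG ▸ Set.mem_range_self a)
  not_subset := by
    rintro X ⟨a, ha⟩ ⟨b, hb⟩ v hv
    have key : ∀ c, ∃ x ∈ en c, x ≠ v := fun c => by
      have hc : en c ∈ G.edgeSet := hG ▸ Set.mem_range_self c
      induction h : en c with | _ x y =>
      rw [h] at hc
      by_cases hx : x = v
      · exact ⟨y, by simp, fun hy => G.ne_of_adj hc (hx.trans hy.symm)⟩
      · exact ⟨x, by simp, hx⟩
    obtain ⟨x, hxa, hxv⟩ := key a
    obtain ⟨y, hyb, hyv⟩ := key b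
    have hcov : ∀ z, (G.induce {v}ᶜ).Reachable ⟨x, hxv⟩ z → ∃ c ∈ X, z.1 ∈ en c := by
      intro z hz
      rw [SimpleGraph.reachable_iff_reflTransGen] at hz
      induction hz with
      | refl => exact ⟨a, ha, hxa⟩
      | @tail z w _ hadj ih =>
        have hzw : s(z.1, w.1) ∈ G.edgeSet := hadj
        rw [hG] at hzw
        obtain ⟨c, hc⟩ := hzw
        by_cases hcX : c ∈ X
        · exact ⟨c, hcX, hc ▸ Sym2.mem_mk_right _ _⟩
        · exact absurd (hv ⟨ih, c, hcX, hc ▸ Sym2.mem_mk_left _ _⟩) z.2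
    exact hyv (hv ⟨hcov _ (h v ⟨x, hxv⟩ ⟨y, hyv⟩), b, hb, hyb⟩)

lemma IsBlock.drawable [Finite V] (hS : S ⊆ goodTypes) {B : Set V} (hB : IsBlock G B)
    (hBn : B.Nontrivial) (hcard : 3 ≤ (G.induce B).edgeSet.ncard)
    (hR : ∀ (T : SPRTree (G.induce B)) (x : T.ι), T.label x = .R →
      SRestricted (T.skeletonPlus x) S) :
    Drawable G S (Sym2.map Subtype.val '' (G.induce B).edgeSet) ∅ := by
  let f := (Finite.equivFin (G.induce B).edgeSet).symm
  have hrange : (G.induce B).edgeSet = Set.range (fun i => (f i).1) := by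
    rw [← Function.comp_def, f.surjective.range_comp, Subtype.range_coe]
  have := Set.nontrivial_coe_sort.2 hBn
  have h := drawable_of_forall_sprTree hS
    (.of_preconnected hrange (induce_induce_preconnected hB.2.2.1))
    (by simpa [Set.ncard] using hcard) (Subtype.val_injective.comp f.injective) hrange
    (fun v => by
      obtain ⟨w, hw⟩ := hB.2.1.exists_adj_of_nontrivial v
      have hvw : s(v, w) ∈ (G.induce B).edgeSet := hw
      rw [hrange] at hvw
      obtain ⟨i, hi : (f i).1 = s(v, w)⟩ := hvw
      exact ⟨i, show v ∈ (f i).1 from hi ▸ Sym2.mem_mk_left _ _⟩) hR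
  simpa using h.map (G' := G) Subtype.val_injective fun _ _ _ _ => Iff.rfl

/-- A set of edges that is not the union of two smaller ones with at most one common vertex. -/
def Unsplittable (F : Set (Sym2 V)) : Prop :=
  ∀ X ⊆ F, X.Nonempty → (F \ X).Nonempty → ¬ (vset X ∩ vset (F \ X)).Subsingleton

lemma Unsplittable.ncard_ne_two (hF : Unsplittable F) : F.ncard ≠ 2 := by
  intro h
  obtain ⟨e, f, hef, rfl⟩ := Set.ncard_eq_two.1 h
  have hd : ({e, f} : Set (Sym2 V)) \ {e} = {f} := by
    ext g
    simp only [Set.mem_sdiff, Set.mem_insert_iff, Set.mem_singleton_iff]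
    exact ⟨fun h => h.1.resolve_left h.2, fun h => ⟨.inr h, fun h' => hef (h' ▸ h)⟩⟩
  refine hF {e} (by simp) (by simp) (by simp [hd]) ?_
  rw [hd]
  rintro v ⟨⟨_, rfl, hve⟩, ⟨_, rfl, hvf⟩⟩ w ⟨⟨_, rfl, hwe⟩, ⟨_, rfl, hwf⟩⟩
  by_contra hvw
  exact hef (((Sym2.mem_and_mem_iff hvw).1 ⟨hve, hwe⟩).trans
    ((Sym2.mem_and_mem_iff hvw).1 ⟨hvf, hwf⟩).symm)

lemma Unsplittable.preconnected (hF : Unsplittable F) (hFG : F ⊆ G.edgeSet) {C : Set V}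
    (hC : C.Subsingleton) : (G.induce (vset F \ C)).Preconnected := by
  rintro x y
  have step : ∀ e ∈ F, ∀ z w : ↥(vset F \ C), z.1 ∈ e → w.1 ∈ e →
      (G.induce (vset F \ C)).Reachable x z → (G.induce (vset F \ C)).Reachable x w := by
    intro e he z w hz hw hxz
    by_cases hzw : z.1 = w.1
    · exact Subtype.ext hzw ▸ hxz
    · have hadj : G.Adj z w := by
        rw [← SimpleGraph.mem_edgeSet, ← (Sym2.mem_and_mem_iff hzw).1 ⟨hz, hw⟩]
        exact hFG he
      exact hxz.trans (SimpleGraph.Adj.reachable (G := G.induce _) hadj)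
  obtain ⟨e, he, hxe⟩ := x.2.1
  obtain ⟨f, hf, hyf⟩ := y.2.1
  let X := {e | e ∈ F ∧ ∃ z : ↥(vset F \ C), z.1 ∈ e ∧ (G.induce (vset F \ C)).Reachable x z}
  by_cases hfX : f ∈ X
  · obtain ⟨-, z, hz, hxz⟩ := hfX
    exact step f hf z y hz hyf hxz
  · refine absurd (hC.anti ?_) (hF X (fun _ h => h.1) ⟨e, he, x, hxe, .rfl⟩ ⟨f, hf, hfX⟩)
    rintro w ⟨⟨e, ⟨he, z, hz, hxz⟩, hwe⟩, ⟨g, ⟨hg, hgX⟩, hwg⟩⟩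
    by_contra hwC
    let w' : ↥(vset F \ C) := ⟨w, ⟨e, he, hwe⟩, hwC⟩
    exact hgX ⟨hg, w', hwg, step e he z w' hz hwe hxz⟩

lemma Unsplittable.exists_isBlock [Finite V] (hF : Unsplittable F) (hFG : F ⊆ G.edgeSet)
    (hne : (vset F).Nonempty) : ∃ B, IsBlock G B ∧ vset F ⊆ B := by
  obtain ⟨B, hle, hB⟩ := Finite.exists_le_maximal
    (p := fun B : Set V => B.Nonempty ∧ (G.induce B).Preconnected ∧
      ∀ v, (G.induce (B \ {v})).Preconnected) (a := vset F)
    ⟨hne, (Set.sdiff_empty : vset F \ ∅ = _) ▸ hF.preconnected hFG Set.subsingleton_empty,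
      fun _ => hF.preconnected hFG Set.subsingleton_singleton⟩
  exact ⟨B, ⟨hB.1.1, hB.1.2.1, hB.1.2.2,
    fun B' hBB' h₁ h₂ h₃ => hB.eq_of_le ⟨h₁, h₂, h₃⟩ hBB'⟩, hle⟩

lemma drawable_of_ncard_le_one [Finite V] (h : F.ncard ≤ 1) : Drawable G S F ∅ := by
  refine drawable_of_degree_le_two fun v => ?_
  have : Nonempty (Sym2 V) := ⟨s(v, v)⟩
  obtain ⟨e, he⟩ := (Set.ncard_le_one_iff_subset_singleton (Set.toFinite _)).1 h
  refine ⟨e, fun w _ hw => ?_⟩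
  rw [Set.union_empty] at hw
  exact he hw ▸ Sym2.mem_mk_right _ _

lemma drawable_of_forall_isBlock [Finite V] (hS : S ⊆ goodTypes)
    (hR : ∀ B : Set V, IsBlock G B → ∀ (T : SPRTree (G.induce B)) (x : T.ι),
      T.label x = .R → SRestricted (T.skeletonPlus x) S)
    (hFG : F ⊆ G.edgeSet) : Drawable G S F ∅ := by
  induction hn : F.ncard using Nat.strong_induction_on generalizing F with | _ n ih =>
  by_cases hF : Unsplittable F
  · by_cases h1 : F.ncard ≤ 1
    · exact drawable_of_ncard_le_one h1
    have h2 := hF.ncard_ne_two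
    have hFn : F.Nonempty := Set.nonempty_of_ncard_ne_zero (by omega)
    have hvn : (vset F).Nontrivial := by
      obtain ⟨e, he⟩ := hFn
      induction e with | _ x y =>
      exact ⟨x, ⟨_, he, by simp⟩, y, ⟨_, he, by simp⟩, G.ne_of_adj (hFG he)⟩
    obtain ⟨B, hB, hFB⟩ := hF.exists_isBlock hFG hvn.nonempty
    have hsub : F ⊆ Sym2.map Subtype.val '' (G.induce B).edgeSet := by
      intro e he
      induction e with | _ x y =>
      exact ⟨s(⟨x, hFB ⟨_, he, by simp⟩⟩, ⟨y, hFB ⟨_, he, by simp⟩⟩), hFG he, rfl⟩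
    refine (hB.drawable hS (hvn.mono hFB) ?_ (hR B hB)).mono hsub subset_rfl
    have := (Set.ncard_le_ncard hsub).trans (Set.ncard_image_le (Set.toFinite _))
    omega
  · simp only [Unsplittable, not_forall, not_not] at hF
    obtain ⟨X, hXF, hX, hX', hs⟩ := hF
    have h1 : (F \ X).ncard < n := hn ▸ Set.ncard_lt_ncard
      ⟨Set.sdiff_subset, fun h => hX.elim fun e he => (h (hXF he)).2 he⟩
    have h2 : X.ncard < n := hn ▸ Set.ncard_lt_ncard
      ⟨hXF, fun h => hX'.elim fun e he => he.2 (h he.1)⟩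
    have := (ih _ h2 (hXF.trans hFG) rfl).union_of_vertex
      (ih _ h1 (Set.sdiff_subset.trans hFG) rfl) (Set.sdiff_subset.trans hFG) (by simpa using hs)
    rwa [Set.union_empty, Set.union_sdiff_cancel hXF] at this

end Blocks

/-- **Reduction to 3-connected components.** Assume `S ⊆ {full, almost-full, bowtie}` is
nonempty.  A graph is `S`-restricted if and only if, for every 2-connected component
(block) `B` of the graph, every SPR-tree of `G[B]` and every R-node `x` of that tree, the
skeleton+ of `x` is `S`-restricted. -/
theorem srestricted_iff_skeletonPlus_of_R_nodes {V : Type*} [Fintype V]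
    (G : SimpleGraph V) (S : Set CrossingType) (hS : S ⊆ goodTypes) (hne : S.Nonempty) :
    SRestricted G S ↔
      ∀ (B : Set V), IsBlock G B → ∀ (T : SPRTree (G.induce B)) (x : T.ι),
        T.label x = SPRLabel.R → SRestricted (T.skeletonPlus x) S :=
  ⟨fun h _ hB T x hx => hB.sRestricted_skeletonPlus hS h T x hx,
    fun h => (drawable_of_forall_isBlock hS h subset_rfl).sRestricted⟩

end OnePlanarity
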